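/- There exist absolute constants c > 0 and c0 > 0 such that the following holds. Fix a ∈ 𝒮. Let x be sufficiently large and let Q satisfy x·(log x)^{−5/9} ≤ Q ≤ x/2 and Q ≥ c0. Then there exist at least Q^{1 − 1/log log Q} values q ∈ [Q, 2Q] such that S(x; q, a) ≥ c · 𝔖 · x / (φ_𝒮(q) · (x/q)^{9/10}). -/

import Mathlib

/-- `n` is a positive integer expressible as a sum of two squares. -/
def IsSumTwoSquares (n : ℕ) : Prop := 0 < n ∧ ∃ a b : ℕ, n = a ^ 2 + b ^ 2

/-- `SAP x q a` counts positive integers `n ≤ x` with `n ∈ 𝒮` and `n ≡ a (mod q)`. -/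
noncomputable def SAP (x : ℝ) (q a : ℕ) : ℕ :=
  {n : ℕ | (n : ℝ) ≤ x ∧ IsSumTwoSquares n ∧ n % q = a % q}.ncard

/-- The multiplicative function `φ_𝒮`, defined via the prime factorization. -/
noncomputable def phiS (q : ℕ) : ℝ :=
  ∏ p ∈ q.primeFactors,
    (if p = 2 then (if 2 ≤ q.factorization 2 then (2 : ℝ) ^ (q.factorization 2 - 1) else 2)
     else if p % 4 = 1 then (p : ℝ) ^ (q.factorization p)
     else (p : ℝ) ^ (q.factorization p + 1) / ((p : ℝ) + 1))

/-- The singular constant `𝔖 = 2^{-1/2} ∏_{p ≡ 3 (mod 4)} (1 - p^{-2})^{-1/2}`. -/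
noncomputable def frakS : ℝ :=
  (2 : ℝ) ^ (-(1 : ℝ) / 2) *
    ∏' p : {p : ℕ // p.Prime ∧ p % 4 = 3}, ((1 - ((p : ℕ) : ℝ) ^ (-(2 : ℝ))) ^ (-(1 : ℝ) / 2))


section Helpers

open Finset ArithmeticFunction


/-- Abel summation bound with antitone weights. -/
lemma abel_bound (a g : ℕ → ℝ) (C : ℝ) (z y : ℕ)
    (hA : ∀ N, |∑ n ∈ Ioc 0 N, a n| ≤ C)
    (hg : ∀ n, z < n → g (n+1) ≤ g n) (hg0 : ∀ n, z < n → 0 ≤ g n) :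
    |∑ n ∈ Ioc z y, a n * g n| ≤ 2 * C * g (z+1) := by
  have hC : 0 ≤ C := le_trans (abs_nonneg _) (hA 0)
  have key : ∀ m, |∑ n ∈ Ioc z (z+1+m), a n * g n - (∑ n ∈ Ioc 0 (z+1+m), a n) * g (z+1+m)|
      ≤ C * (2 * g (z+1) - g (z+1+m)) := by
    intro m
    induction m with
    | zero =>
      have h1 : Ioc z (z+1+0) = {z+1} := by ext; simp
      have h2 : ∑ n ∈ Ioc 0 (z+1+0), a n = ∑ n ∈ Ioc 0 z, a n + a (z+1) := by
        rw [add_zero, Finset.sum_Ioc_succ_top (by omega)]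
      rw [h1, h2]
      simp only [sum_singleton, add_zero]
      have : a (z+1) * g (z+1) - (∑ n ∈ Ioc 0 z, a n + a (z+1)) * g (z+1)
        = -((∑ n ∈ Ioc 0 z, a n) * g (z+1)) := by ring
      rw [this, abs_neg, abs_mul, abs_of_nonneg (hg0 (z+1) (by omega))]
      have := mul_le_mul_of_nonneg_right (hA z) (hg0 (z+1) (by omega))
      linarith
    | succ m ih =>
      have e : z + 1 + (m+1) = (z+1+m)+1 := by ring
      rw [e, Finset.sum_Ioc_succ_top (by omega), Finset.sum_Ioc_succ_top (by omega)]
      have h1 := mul_le_mul_of_nonneg_right (hA (z+1+m))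
        (sub_nonneg.2 (hg (z+1+m) (by omega)))
      rw [← abs_of_nonneg (sub_nonneg.2 (hg (z+1+m) (by omega))), ← abs_mul,
        abs_of_nonneg (sub_nonneg.2 (hg (z+1+m) (by omega)))] at h1
      have h2 := abs_add_le (∑ n ∈ Ioc z (z+1+m), a n * g n - (∑ n ∈ Ioc 0 (z+1+m), a n) * g (z+1+m))
        ((∑ n ∈ Ioc 0 (z+1+m), a n) * (g (z+1+m) - g (z+1+m+1)))
      refine le_trans (le_of_eq ?_) (h2.trans (le_trans (add_le_add ih h1) (le_of_eq ?_)))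
      · congr 1; ring
      · ring
  rcases Nat.lt_or_ge z y with h | h
  · obtain ⟨m, rfl⟩ := Nat.exists_eq_add_of_le (show z+1 ≤ y from h)
    have h1 := key m
    have h3 := hg0 (z+1+m) (by omega)
    have h2 := mul_le_mul_of_nonneg_right (hA (z+1+m)) h3
    rw [← abs_of_nonneg h3, ← abs_mul, abs_of_nonneg h3] at h2
    rw [abs_le] at *
    constructor <;> nlinarith [h1.1, h1.2, h2.1, h2.2]
  · rw [Ioc_eq_empty (by omega)]
    simp
    have := hg0 (z+1) (by omega)
    positivity

/-- Real valued character mod 4. -/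
noncomputable def chi (n : ℕ) : ℝ := ((ZMod.χ₄ (n : ZMod 4) : ℤ) : ℝ)

lemma chi_mul (m n : ℕ) : chi (m * n) = chi m * chi n := by
  unfold chi
  rw [Nat.cast_mul, map_mul, Int.cast_mul]

lemma chi_cases (n : ℕ) : chi n = if n % 2 = 0 then 0 else if n % 4 = 1 then 1 else -1 := by
  unfold chi
  rw [ZMod.χ₄_nat_eq_if_mod_four]
  split_ifs <;> simp

lemma abs_chi_le (n : ℕ) : |chi n| ≤ 1 := by
  rw [chi_cases]; split_ifs <;> simp

lemma chi_partial (N : ℕ) : |∑ n ∈ Ioc 0 N, chi n| ≤ 1 := by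
  have : ∀ m : ℕ, ∑ n ∈ Ioc 0 (4*m), chi n = 0 := by
    intro m
    induction m with
    | zero => simp
    | succ m ih =>
      rw [show 4*(m+1) = 4*m+1+1+1+1 by ring]
      rw [Finset.sum_Ioc_succ_top (by omega), Finset.sum_Ioc_succ_top (by omega),
        Finset.sum_Ioc_succ_top (by omega), Finset.sum_Ioc_succ_top (by omega), ih]
      simp only [chi_cases]
      rw [if_neg (by omega), if_pos (by omega), if_pos (by omega), if_neg (by omega),
        if_neg (by omega), if_pos (by omega)]
      norm_num
  obtain ⟨m, r, hr, rfl⟩ : ∃ m r, r < 4 ∧ N = 4*m + r := ⟨N/4, N%4, by omega, by omega⟩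
  interval_cases r
  · rw [add_zero, this]; simp
  · rw [Finset.sum_Ioc_succ_top (by omega), this]
    simpa using abs_chi_le _
  · rw [Finset.sum_Ioc_succ_top (by omega), Finset.sum_Ioc_succ_top (by omega), this]
    simp only [chi_cases]
    rw [if_neg (by omega), if_pos (by omega), if_pos (by omega)]
    simp
  · rw [Finset.sum_Ioc_succ_top (by omega), Finset.sum_Ioc_succ_top (by omega),
      Finset.sum_Ioc_succ_top (by omega), this]
    simp only [chi_cases]
    rw [if_neg (by omega), if_pos (by omega), if_pos (by omega), if_neg (by omega),
        if_neg (by omega)]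
    norm_num

lemma chi_harm (z y : ℕ) : |∑ n ∈ Ioc z y, chi n / n| ≤ 2 / (z+1) := by
  have := abel_bound chi (fun n => 1/(n:ℝ)) 1 z y chi_partial
    (by intro n hn; push_cast; apply one_div_le_one_div_of_le <;> [(have : (0:ℝ) < n := by exact_mod_cast (by omega)); skip] <;> linarith)
    (by intro n hn; positivity)
  simp only [mul_one_div] at this
  refine this.trans (le_of_eq ?_)
  push_cast; ring

lemma chi_L : ∃ Lc : ℝ, 0 < Lc ∧ ∀ N : ℕ, |∑ n ∈ Ioc 0 N, chi n / n - Lc| ≤ 2 / (N+1) := by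
  set l : ℕ → ℝ := fun N => ∑ n ∈ Ioc 0 N, chi n / n with hl
  have hdiff : ∀ z y, z ≤ y → |l y - l z| ≤ 2 / (z+1) := by
    intro z y h
    have : l y - l z = ∑ n ∈ Ioc z y, chi n / n := by
      simp only [hl]
      rw [← Finset.sum_Ioc_consecutive _ (Nat.zero_le z) h]; ring
    rw [this]; exact chi_harm z y
  have hc : CauchySeq l := by
    apply cauchySeq_of_le_tendsto_0 (fun N : ℕ => (2 / (N+1) : ℝ) + 2 / (N+1))
    · intro n m N hn hm
      have h1 := hdiff N n hn
      have h2 := hdiff N m hm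
      rw [Real.dist_eq]
      rw [abs_le] at *
      constructor <;> linarith [h1.1, h1.2, h2.1, h2.2]
    · have : Filter.Tendsto (fun N : ℕ => (1 / ((N:ℝ)+1) : ℝ)) Filter.atTop (nhds 0) :=
        tendsto_one_div_add_atTop_nhds_zero_nat
      have := (this.const_mul 4)
      simp only [mul_zero] at this
      refine this.congr (fun N => ?_)
      ring
  obtain ⟨Lc, hLc⟩ := cauchySeq_tendsto_of_complete hc
  have hb : ∀ N : ℕ, |l N - Lc| ≤ 2 / (N+1) := by
    intro N
    have h1 : Filter.Tendsto (fun y => |l N - l y|) Filter.atTop (nhds |l N - Lc|) :=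
      (tendsto_const_nhds.sub hLc).abs
    refine le_of_tendsto h1 ?_
    filter_upwards [Filter.eventually_ge_atTop N] with y hy
    rw [abs_sub_comm]; exact hdiff N y hy
  refine ⟨Lc, ?_, hb⟩
  have h4 := hb 4
  have : l 4 = 2/3 := by
    simp only [hl]
    rw [show Ioc 0 4 = {1,2,3,4} by decide]
    simp [chi_cases]; norm_num
  rw [this, abs_le] at h4
  norm_num at h4
  linarith [h4.2]


lemma psi_nat (N : ℕ) : ∑ n ∈ Ioc 0 N, vonMangoldt n ≤ 6 * N := by
  have h := Chebyshev.psi_le_const_mul_self (x := N) (by positivity)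
  unfold Chebyshev.psi at h
  rw [Nat.floor_natCast] at h
  refine h.trans ?_
  have h4 : Real.log 4 ≤ 2 := by
    rw [show (4:ℝ) = 2^2 by norm_num, Real.log_pow]
    have := Real.log_two_lt_d9
    push_cast; linarith
  have : (0:ℝ) ≤ N := by positivity
  nlinarith

lemma log_fact (N : ℕ) : ∑ n ∈ Ioc 0 N, Real.log n = Real.log (N.factorial) := by
  induction N with
  | zero => simp
  | succ n ih =>
    rw [Finset.sum_Ioc_succ_top (by omega), ih, Nat.factorial_succ, Nat.cast_mul, Real.log_mul]
    · ring
    · positivity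
    · positivity

lemma log_fact_lower (N : ℕ) : N * Real.log N - N ≤ Real.log (N.factorial) := by
  induction N with
  | zero => simp
  | succ n ih =>
    rw [Nat.factorial_succ, Nat.cast_mul, Real.log_mul (by positivity) (by positivity)]
    rcases Nat.eq_zero_or_pos n with rfl | hn
    · simp
    have hn' : (0:ℝ) < n := by exact_mod_cast hn
    have : Real.log ((n+1 : ℕ):ℝ) - Real.log n ≤ 1 / n := by
      rw [← Real.log_div (by positivity) (by positivity)]
      have := Real.log_le_sub_one_of_pos (x := ((n+1:ℕ):ℝ)/n) (by positivity)
      refine this.trans (le_of_eq ?_)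
      push_cast; field_simp; ring
    have h2 : n * (Real.log ((n+1 : ℕ):ℝ) - Real.log n) ≤ 1 := by
      calc _ ≤ n * (1/(n:ℝ)) := by gcongr
        _ = 1 := by field_simp
    push_cast at *
    linarith

lemma log_fact_upper (N : ℕ) : Real.log (N.factorial) ≤ N * Real.log N := by
  rw [← Real.log_pow]
  apply Real.log_le_log (by positivity)
  exact_mod_cast Nat.factorial_le_pow N

lemma vm_sum_log (N : ℕ) : ∑ n ∈ Ioc 0 N, Real.log n
    = ∑ d ∈ Ioc 0 N, vonMangoldt d * ((N / d : ℕ) : ℝ) := by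
  rw [← sum_Ioc_mul_zeta_eq_sum]
  apply sum_congr rfl
  intro n hn
  rw [vonMangoldt_mul_zeta]; rfl

/-- Mertens first theorem, von Mangoldt version -/
lemma mertens_first (N : ℕ) (hN : 1 ≤ N) :
    |∑ n ∈ Ioc 0 N, vonMangoldt n / n - Real.log N| ≤ 6 := by
  have hN' : (0:ℝ) < N := by exact_mod_cast hN
  have h1 := vm_sum_log N
  rw [log_fact] at h1
  have h2 := log_fact_lower N
  have h3 := log_fact_upper N
  have hup : ∑ d ∈ Ioc 0 N, vonMangoldt d * ((N / d : ℕ) : ℝ) ≤ N * ∑ n ∈ Ioc 0 N, vonMangoldt n / n := by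
    rw [mul_sum]
    apply sum_le_sum
    intro d hd
    have : ((N / d : ℕ) : ℝ) ≤ N / d := Nat.cast_div_le
    calc _ ≤ vonMangoldt d * (N/d : ℝ) := by
          apply mul_le_mul_of_nonneg_left this vonMangoldt_nonneg
      _ = _ := by ring
  have hlo : N * ∑ n ∈ Ioc 0 N, vonMangoldt n / n - ∑ d ∈ Ioc 0 N, vonMangoldt d ≤ ∑ d ∈ Ioc 0 N, vonMangoldt d * ((N / d : ℕ) : ℝ) := by
    rw [mul_sum, ← sum_sub_distrib]
    apply sum_le_sum
    intro d hd
    have hd0 : 0 < d := (mem_Ioc.1 hd).1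
    have : (N / d : ℝ) - 1 ≤ ((N / d : ℕ) : ℝ) := by
      have := Nat.lt_floor_add_one ((N:ℝ)/d)
      rw [Nat.floor_div_eq_div] at this
      linarith
    calc _ = vonMangoldt d * (N/d - 1 : ℝ) := by ring
      _ ≤ _ := by
          apply mul_le_mul_of_nonneg_left this vonMangoldt_nonneg
  have hpsi := psi_nat N
  set S := ∑ n ∈ Ioc 0 N, vonMangoldt n / n
  rw [abs_le]
  constructor
  · have : N * (Real.log N - 1 - S) ≤ 0 := by nlinarith
    have : Real.log N - 1 - S ≤ 0 := by
      by_contra hh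
      push Not at hh
      have := mul_pos hN' hh
      linarith
    linarith
  · have : N * (S - Real.log N - 6) ≤ 0 := by nlinarith
    have : (S - Real.log N - 6) ≤ 0 := by
      by_contra hh
      push Not at hh
      have := mul_pos hN' hh
      linarith
    linarith

lemma harm_bound (N : ℕ) (hN : 1 ≤ N) : |∑ n ∈ Ioc 0 N, (1:ℝ) / n - Real.log N| ≤ 1 := by
  have e : ∑ n ∈ Ioc 0 N, (1:ℝ) / n = ((harmonic N : ℚ) : ℝ) := by
    rw [harmonic_eq_sum_Icc]
    push_cast
    apply sum_congr
    · ext; simp; omega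
    · intros; simp
  rw [e]
  have h1 := log_add_one_le_harmonic N
  have h2 := harmonic_le_one_add_log N
  have h3 : Real.log N ≤ Real.log ((N+1:ℕ):ℝ) := by
    apply Real.log_le_log (by exact_mod_cast hN)
    push_cast; linarith
  rw [abs_le]; constructor <;> linarith

lemma vm_diff_bound (N : ℕ) : |∑ n ∈ Ioc 0 N, (vonMangoldt n / n - 1/n)| ≤ 7 := by
  rcases Nat.eq_zero_or_pos N with rfl | hN
  · simp
  rw [sum_sub_distrib]
  have h1 := mertens_first N hN
  have h2 := harm_bound N hN
  rw [abs_le] at *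
  constructor <;> linarith [h1.1, h1.2, h2.1, h2.2]

lemma inv_log_anti (n : ℕ) (hn : 1 < n) : 1 / Real.log ((n+1 : ℕ):ℝ) ≤ 1 / Real.log n := by
  apply one_div_le_one_div_of_le
  · apply Real.log_pos; exact_mod_cast hn
  · apply Real.log_le_log
    · exact_mod_cast (by omega)
    · push_cast; linarith

lemma sum_inv_nlog (z y : ℕ) (hz : 2 ≤ z) (hy : z ≤ y) :
    ∑ n ∈ Ioc z y, (1/(n:ℝ)) * (1 / Real.log n) ≤ Real.log (Real.log y) - Real.log (Real.log z) := by
  induction y, hy using Nat.le_induction with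
  | base => simp
  | succ n hn ih =>
    rw [Finset.sum_Ioc_succ_top (by omega)]
    have hn' : (2:ℝ) ≤ n := by exact_mod_cast hz.trans hn
    have hl : 0 < Real.log n := Real.log_pos (by linarith)
    have hl2 : 0 < Real.log ((n+1:ℕ):ℝ) := Real.log_pos (by push_cast; linarith)
    have h1 : (1/((n+1:ℕ):ℝ)) ≤ Real.log ((n+1:ℕ):ℝ) - Real.log n := by
      have := Real.log_le_sub_one_of_pos (x := (n:ℝ)/((n+1:ℕ):ℝ)) (by positivity)
      rw [Real.log_div (by positivity) (by positivity)] at this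
      have e : (n:ℝ)/((n+1:ℕ):ℝ) - 1 = - (1/((n+1:ℕ):ℝ)) := by push_cast; field_simp; ring
      linarith
    have h2 := Real.log_le_sub_one_of_pos (x := Real.log n/Real.log ((n+1:ℕ):ℝ)) (by positivity)
    rw [Real.log_div (by positivity) (by positivity)] at h2
    have h3 : (1/((n+1:ℕ):ℝ)) * (1/Real.log ((n+1:ℕ):ℝ)) ≤ 1 - Real.log n/Real.log ((n+1:ℕ):ℝ) := by
      have : (1/((n+1:ℕ):ℝ)) * (1/Real.log ((n+1:ℕ):ℝ)) ≤ (Real.log ((n+1:ℕ):ℝ) - Real.log n) * (1/Real.log ((n+1:ℕ):ℝ)) := by gcongr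
      refine this.trans (le_of_eq ?_)
      field_simp
    linarith

/-- Mertens second theorem, upper bound on a range -/
lemma mertens_range (z y : ℕ) (hz : 2 ≤ z) (hy : z ≤ y) :
    ∑ p ∈ (Ioc z y).filter Nat.Prime, (1:ℝ)/p ≤
      Real.log (Real.log y) - Real.log (Real.log z) + 28 := by
  have h1 := abel_bound (fun n => vonMangoldt n / n - 1/n) (fun n => 1 / Real.log n) 7 z y
    vm_diff_bound (fun n hn => inv_log_anti n (by omega)) (fun n hn => by positivity)
  have h2 := sum_inv_nlog z y hz hy
  have hlog : (1/2:ℝ) ≤ Real.log ((z+1:ℕ):ℝ) := by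
    have : Real.log 2 ≤ Real.log ((z+1:ℕ):ℝ) := by
      apply Real.log_le_log (by norm_num)
      have : (2:ℝ) ≤ z := by exact_mod_cast hz
      push_cast; linarith
    have := Real.log_two_gt_d9
    linarith
  have h3 : 2 * 7 * (1 / Real.log ((z+1:ℕ):ℝ)) ≤ 28 := by
    have : 1 / Real.log ((z+1:ℕ):ℝ) ≤ 1/(1/2) := one_div_le_one_div_of_le (by norm_num) hlog
    linarith
  have h4 : ∑ n ∈ Ioc z y, (vonMangoldt n / n - 1/n) * (1 / Real.log n) =
     ∑ n ∈ Ioc z y, (vonMangoldt n / n) * (1 / Real.log n) - ∑ n ∈ Ioc z y, (1/(n:ℝ)) * (1 / Real.log n) := by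
    rw [← sum_sub_distrib]; apply sum_congr rfl; intros; ring
  have h5 : ∑ p ∈ (Ioc z y).filter Nat.Prime, (1:ℝ)/p ≤ ∑ n ∈ Ioc z y, (vonMangoldt n / n) * (1 / Real.log n) := by
    rw [sum_filter]
    apply sum_le_sum
    intro n hn
    have hn2 := (mem_Ioc.1 hn).1
    split_ifs with hp
    · rw [vonMangoldt_apply_prime hp]
      have : 0 < Real.log n := Real.log_pos (by exact_mod_cast (by omega))
      apply le_of_eq; field_simp
    · have := vonMangoldt_nonneg (n := n)
      have : 0 ≤ Real.log n := Real.log_nonneg (by exact_mod_cast (by omega))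
      positivity
  rw [abs_le] at h1
  linarith [h1.2]


lemma chi_log_bound : ∃ C : ℝ, ∀ N : ℕ, |∑ n ∈ Ioc 0 N, chi n * (Real.log n / n)| ≤ C := by
  refine ⟨∑ n ∈ Ioc 0 3, |chi n * (Real.log n / n)| + 2 * 1 * (Real.log ((3+1:ℕ):ℝ) / ((3+1:ℕ):ℝ)), fun N => ?_⟩
  have hpos : 0 ≤ 2 * 1 * (Real.log ((3+1:ℕ):ℝ) / ((3+1:ℕ):ℝ)) := by
    have : 0 ≤ Real.log ((3+1:ℕ):ℝ) := Real.log_nonneg (by norm_num)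
    positivity
  rcases Nat.lt_or_ge N 3 with h | h
  · refine (abs_sum_le_sum_abs _ _).trans ?_
    refine le_trans (sum_le_sum_of_subset_of_nonneg (Ioc_subset_Ioc_right h.le) (fun _ _ _ => abs_nonneg _)) ?_
    linarith
  · rw [← Finset.sum_Ioc_consecutive _ (Nat.zero_le 3) h]
    refine (abs_add_le _ _).trans (add_le_add (abs_sum_le_sum_abs _ _) ?_)
    apply abel_bound chi (fun n => Real.log n / n) 1 3 N chi_partial
    · intro n hn
      apply Real.log_div_self_antitoneOn
      · simp
        have : (4:ℝ) ≤ n := by exact_mod_cast hn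
        have := Real.exp_one_lt_d9
        linarith
      · simp
        have : (4:ℝ) ≤ n := by exact_mod_cast hn
        have := Real.exp_one_lt_d9
        linarith
      · push_cast; linarith
    · intro n hn
      have : 0 ≤ Real.log n := Real.log_nonneg (by exact_mod_cast (by omega))
      positivity

noncomputable def chiA : ArithmeticFunction ℝ := ⟨fun n => chi n / n, by simp⟩
noncomputable def chiL : ArithmeticFunction ℝ := ⟨fun n => chi n * vonMangoldt n / n, by simp⟩

lemma chi_conv (N : ℕ) : ∑ n ∈ Ioc 0 N, chi n * (Real.log n / n)
    = ∑ d ∈ Ioc 0 N, chi d * vonMangoldt d / d * ∑ e ∈ Ioc 0 (N/d), chi e / e := by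
  have h := sum_Ioc_mul_eq_sum_sum chiL chiA N
  have e : ∀ n, (chiL * chiA) n = chi n * (Real.log n / n) := by
    intro n
    rw [ArithmeticFunction.mul_apply]
    have : ∀ x ∈ n.divisorsAntidiagonal, chiL x.1 * chiA x.2 = chi n / n * vonMangoldt x.1 := by
      intro x hx
      rw [Nat.mem_divisorsAntidiagonal] at hx
      have h1 : x.1 ≠ 0 := by rintro h; simp [h] at hx; omega
      have h2 : x.2 ≠ 0 := by rintro h; simp [h] at hx; omega
      simp only [chiL, chiA, ArithmeticFunction.coe_mk]
      rw [← hx.1, chi_mul]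
      push_cast
      have : (x.1:ℝ) ≠ 0 := by exact_mod_cast h1
      have : (x.2:ℝ) ≠ 0 := by exact_mod_cast h2
      field_simp
    rw [sum_congr rfl this, ← mul_sum, Nat.sum_divisorsAntidiagonal (fun i _ => vonMangoldt i), vonMangoldt_sum]
    ring
  rw [sum_congr rfl (fun n _ => e n)] at h
  rw [h]
  rfl

lemma chi_vm_bound : ∃ C : ℝ, ∀ N : ℕ, |∑ n ∈ Ioc 0 N, chi n * vonMangoldt n / n| ≤ C := by
  obtain ⟨C, hC⟩ := chi_log_bound
  obtain ⟨Lc, hL, hLb⟩ := chi_L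
  refine ⟨(C + 12) / Lc, fun N => ?_⟩
  set S := ∑ n ∈ Ioc 0 N, chi n * vonMangoldt n / n with hS
  have h1 : |S * Lc - ∑ n ∈ Ioc 0 N, chi n * (Real.log n / n)| ≤ 12 := by
    rw [chi_conv, hS, sum_mul, ← sum_sub_distrib]
    refine (abs_sum_le_sum_abs _ _).trans ?_
    have : ∀ d ∈ Ioc 0 N, |chi d * vonMangoldt d / d * Lc - chi d * vonMangoldt d / d * ∑ e ∈ Ioc 0 (N/d), chi e / e| ≤ 2 / N * vonMangoldt d := by
      intro d hd
      rw [mem_Ioc] at hd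
      have hd' : (0:ℝ) < d := by exact_mod_cast hd.1
      have hN' : (0:ℝ) < N := by exact_mod_cast (by omega)
      rw [← mul_sub, abs_mul, abs_sub_comm]
      have h2 := hLb (N/d)
      have h3 : (2:ℝ) / (((N/d:ℕ):ℝ)+1) ≤ 2 * d / N := by
        have := Nat.lt_floor_add_one ((N:ℝ)/d)
        rw [Nat.floor_div_eq_div] at this
        rw [div_le_div_iff₀ (by positivity) hN']
        rw [div_lt_iff₀ hd'] at this
        nlinarith
      have h4 : |chi d * vonMangoldt d / d| ≤ vonMangoldt d / d := by
        rw [abs_div, abs_mul, abs_of_pos hd', abs_of_nonneg (vonMangoldt_nonneg (n := d))]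
        have := mul_le_mul_of_nonneg_right (abs_chi_le d) (vonMangoldt_nonneg (n := d))
        rw [one_mul] at this
        gcongr
      calc _ ≤ vonMangoldt d / d * (2 * d / N) := by
            apply mul_le_mul h4 (h2.trans h3) (abs_nonneg _)
            have := vonMangoldt_nonneg (n := d)
            positivity
        _ = _ := by field_simp
    refine (sum_le_sum this).trans ?_
    rw [← mul_sum]
    rcases Nat.eq_zero_or_pos N with rfl | hN
    · simp
    have hN' : (0:ℝ) < N := by exact_mod_cast (by omega)
    calc _ ≤ 2 / (N:ℝ) * (6 * N) := by gcongr; exact psi_nat N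
      _ = 12 := by field_simp; norm_num
  have h2 := hC N
  rw [le_div_iff₀ hL, ← abs_of_pos hL, ← abs_mul]
  rw [abs_le] at *
  constructor <;> linarith [h1.1, h1.2, h2.1, h2.2]

lemma nonprime_vm : ∃ C : ℝ, 0 ≤ C ∧ ∀ s : Finset ℕ, ∑ n ∈ s, (if n.Prime then 0 else vonMangoldt n) / n ≤ C := by
  have h := vonMangoldt.summable_residueClass_non_primes_div (q := 1) (a := 0)
  have e : (fun n : ℕ ↦ (if n.Prime then 0 else vonMangoldt.residueClass (0 : ZMod 1) n) / n)
     = fun n : ℕ ↦ (if n.Prime then 0 else vonMangoldt n) / (n:ℝ) := by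
    funext n
    congr 2
    simp [vonMangoldt.residueClass, Subsingleton.elim (n : ZMod 1) 0]
  rw [e] at h
  have hnn : ∀ n : ℕ, 0 ≤ (if n.Prime then 0 else vonMangoldt n) / (n:ℝ) := by
    intro n
    have := vonMangoldt_nonneg (n := n)
    split_ifs <;> positivity
  exact ⟨∑' n : ℕ, (if n.Prime then 0 else vonMangoldt n) / (n:ℝ), tsum_nonneg hnn, fun s => h.sum_le_tsum s (fun n _ => hnn n)⟩

/-- Sums of χ(p)/p are bounded. -/
lemma chi_prime_bound : ∃ C : ℝ, 0 < C ∧ ∀ z y : ℕ, 1 ≤ z →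
    |∑ p ∈ (Ioc z y).filter Nat.Prime, chi p / p| ≤ C := by
  obtain ⟨C, hC⟩ := chi_vm_bound
  obtain ⟨C', hC'0, hC'⟩ := nonprime_vm
  have hC0 : 0 ≤ C := le_trans (abs_nonneg _) (hC 0)
  refine ⟨4 * C + 2 * C' + 1, by positivity, fun z y hz => ?_⟩
  have h1 := abel_bound (fun n => chi n * vonMangoldt n / n) (fun n => 1 / Real.log n) C z y
    hC (fun n hn => inv_log_anti n (by omega)) (fun n hn => by positivity)
  have hlog : ∀ n : ℕ, 2 ≤ n → (1/2:ℝ) ≤ Real.log n := by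
    intro n hn
    have : Real.log 2 ≤ Real.log n := by
      apply Real.log_le_log (by norm_num)
      exact_mod_cast hn
    have := Real.log_two_gt_d9
    linarith
  have hilog : ∀ n : ℕ, 2 ≤ n → 1 / Real.log n ≤ 2 := by
    intro n hn
    have : 1 / Real.log n ≤ 1/(1/2) := one_div_le_one_div_of_le (by norm_num) (hlog n hn)
    linarith
  have h3 : 2 * C * (1 / Real.log ((z+1:ℕ):ℝ)) ≤ 4 * C := by
    have := hilog (z+1) (by omega)
    nlinarith
  have h4 : |∑ p ∈ (Ioc z y).filter Nat.Prime, chi p / p - ∑ n ∈ Ioc z y, chi n * vonMangoldt n / n * (1 / Real.log n)|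
     ≤ 2 * C' := by
    rw [sum_filter, ← sum_sub_distrib]
    refine (abs_sum_le_sum_abs _ _).trans ?_
    refine le_trans ?_ (mul_le_mul_of_nonneg_left (hC' (Ioc z y)) (by norm_num))
    rw [mul_sum]
    apply sum_le_sum
    intro n hn
    have hn2 := (mem_Ioc.1 hn).1
    have hl := hlog n (by omega)
    have hil := hilog n (by omega)
    have hvm := vonMangoldt_nonneg (n := n)
    split_ifs with hp
    · rw [vonMangoldt_apply_prime hp]
      have : chi n / n - chi n * Real.log n / n * (1 / Real.log n) = 0 := by
        have : Real.log n ≠ 0 := by linarith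
        field_simp; simp
      rw [this]; simp
    · rw [zero_sub, abs_neg, abs_mul, abs_div, abs_mul, abs_of_nonneg hvm, Nat.abs_cast,
        abs_of_nonneg (show 0 ≤ 1 / Real.log n by positivity)]
      have := mul_le_mul_of_nonneg_right (abs_chi_le n) hvm
      rw [one_mul] at this
      calc |chi n| * vonMangoldt n / n * (1/Real.log n) ≤ vonMangoldt n / n * 2 := by gcongr
        _ = _ := by ring
  have h5 := h1.trans h3
  rw [abs_le] at h4 h5 ⊢
  constructor <;> linarith [h4.1, h4.2, h5.1, h5.2]


/-- truncated alternating sum -/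
noncomputable def bA (n : ℕ) (S : Finset ℕ) (h : ℕ → ℝ) : ℝ :=
  ∑ d ∈ S.powerset, (if d.card < n then (-1:ℝ)^d.card else 0) * ∏ p ∈ d, h p

/-- elementary symmetric sum -/
noncomputable def bE (n : ℕ) (S : Finset ℕ) (h : ℕ → ℝ) : ℝ :=
  ∑ d ∈ S.powerset, (if d.card = n then (1:ℝ) else 0) * ∏ p ∈ d, h p

lemma bA_insert (n : ℕ) (S : Finset ℕ) (h : ℕ → ℝ) (p : ℕ) (hp : p ∉ S) :
    bA (n+1) (insert p S) h = bA (n+1) S h - h p * bA n S h := by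
  unfold bA
  rw [sum_powerset_insert hp, mul_sum, sub_eq_add_neg, ← sum_neg_distrib]
  congr 1
  apply sum_congr rfl
  intro d hd
  have : p ∉ d := fun h' => hp (mem_powerset.1 hd h')
  rw [card_insert_of_notMem this, prod_insert this]
  by_cases h1 : d.card < n
  · simp [h1, pow_succ]; ring
  · simp [h1]

lemma bE_insert (n : ℕ) (S : Finset ℕ) (h : ℕ → ℝ) (p : ℕ) (hp : p ∉ S) :
    bE (n+1) (insert p S) h = bE (n+1) S h + h p * bE n S h := by
  unfold bE
  rw [sum_powerset_insert hp, mul_sum]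
  congr 1
  apply sum_congr rfl
  intro d hd
  have : p ∉ d := fun h' => hp (mem_powerset.1 hd h')
  rw [card_insert_of_notMem this, prod_insert this]
  by_cases h1 : d.card = n
  · simp [h1]
  · simp [h1]

lemma bA_zero (S : Finset ℕ) (h : ℕ → ℝ) : bA 0 S h = 0 := by simp [bA]

lemma bE_zero (S : Finset ℕ) (h : ℕ → ℝ) : bE 0 S h = 1 := by
  unfold bE
  rw [sum_eq_single ∅]
  · simp
  · intro d _ hd; simp [hd]
  · simp

lemma bE_nonneg (n : ℕ) (S : Finset ℕ) (h : ℕ → ℝ) (h0 : ∀ p ∈ S, 0 ≤ h p) : 0 ≤ bE n S h := by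
  unfold bE
  apply sum_nonneg
  intro d hd
  apply mul_nonneg
  · split_ifs <;> norm_num
  · exact prod_nonneg (fun p hp => h0 p (mem_powerset.1 hd hp))

/-- Bonferroni inequalities. -/
lemma bonferroni (S : Finset ℕ) (h : ℕ → ℝ) : (∀ p ∈ S, 0 ≤ h p) → (∀ p ∈ S, h p ≤ 1) → ∀ n : ℕ,
    0 ≤ (-1:ℝ)^n * (∏ p ∈ S, (1 - h p) - bA n S h) ∧
    (-1:ℝ)^n * (∏ p ∈ S, (1 - h p) - bA n S h) ≤ bE n S h := by
  induction S using Finset.induction_on with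
  | empty =>
    intro _ _ n
    rcases n with _ | n
    · simp [bA_zero, bE_zero]
    · simp [bA, bE]
  | insert p S hp ih =>
    intro h0 h1 n
    have ih' := ih (fun q hq => h0 q (mem_insert_of_mem hq)) (fun q hq => h1 q (mem_insert_of_mem hq))
    have hp0 := h0 p (mem_insert_self _ _)
    have hp1 := h1 p (mem_insert_self _ _)
    rcases n with _ | n
    · rw [bA_zero, bE_zero]
      simp only [pow_zero, one_mul, sub_zero]
      refine ⟨prod_nonneg (fun q hq => by linarith [h1 q hq]), prod_le_one (fun q hq => by linarith [h1 q hq]) (fun q hq => by linarith [h0 q hq])⟩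
    · rw [bA_insert n S h p hp, bE_insert n S h p hp, prod_insert hp]
      obtain ⟨a1, a2⟩ := ih' (n+1)
      obtain ⟨b1, b2⟩ := ih' n
      have e : (-1:ℝ)^(n+1) * ((1 - h p) * ∏ p ∈ S, (1 - h p) - (bA (n+1) S h - h p * bA n S h))
        = (-1:ℝ)^(n+1) * (∏ p ∈ S, (1 - h p) - bA (n+1) S h) + h p * ((-1:ℝ)^n * (∏ p ∈ S, (1 - h p) - bA n S h)) := by
        rw [pow_succ]; ring
      rw [e]
      exact ⟨add_nonneg a1 (mul_nonneg hp0 b1), add_le_add a2 (mul_le_mul_of_nonneg_left b2 hp0)⟩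

lemma bE_le (S : Finset ℕ) (h : ℕ → ℝ) : (∀ p ∈ S, 0 ≤ h p) → ∀ n : ℕ,
    bE n S h ≤ (∑ p ∈ S, h p)^n / n.factorial := by
  induction S using Finset.induction_on with
  | empty =>
    intro _ n
    rcases n with _ | n
    · simp [bE_zero]
    · simp [bE]
  | insert p S hp ih =>
    intro h0 n
    have ih' := ih (fun q hq => h0 q (mem_insert_of_mem hq))
    have hp0 := h0 p (mem_insert_self _ _)
    have hs : 0 ≤ ∑ p ∈ S, h p := sum_nonneg (fun q hq => h0 q (mem_insert_of_mem hq))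
    rcases n with _ | n
    · simp [bE_zero]
    · rw [bE_insert n S h p hp, sum_insert hp]
      have key : (∑ p ∈ S, h p)^(n+1) + (n+1) * h p * (∑ p ∈ S, h p)^n ≤ (h p + ∑ p ∈ S, h p)^(n+1) := by
        set s := ∑ p ∈ S, h p
        clear_value s
        set g := h p
        clear_value g
        clear ih' ih h0
        induction n with
        | zero => simp; linarith
        | succ n ih =>
          rw [pow_succ (g+s)]
          have : 0 ≤ s^n := by positivity
          calc s^(n+1+1) + ((n+1:ℕ)+1) * g * s^(n+1) ≤ (s^(n+1) + (n+1)*g*s^n) * (g+s) := by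
                push_cast
                have : (s^(n+1) + (n+1)*g*s^n) * (g+s) = s^(n+1+1) + ((n+1)+1) * g * s^(n+1) + (n+1)*g*g*s^n := by ring
                rw [this]
                have : 0 ≤ (n+1)*g*g*s^n := by positivity
                linarith
            _ ≤ _ := by gcongr
      have hf : (0:ℝ) < n.factorial := by exact_mod_cast n.factorial_pos
      calc _ ≤ (∑ p ∈ S, h p)^(n+1) / (n+1).factorial + h p * ((∑ p ∈ S, h p)^n / n.factorial) := by
            gcongr
            · exact ih' _
            · exact ih' _
        _ = ((∑ p ∈ S, h p)^(n+1) + (n+1) * h p * (∑ p ∈ S, h p)^n) / (n+1).factorial := by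
            rw [Nat.factorial_succ]; push_cast; field_simp
        _ ≤ _ := by gcongr

/-- Polynomials in the indicator variables with bounded coefficients and controlled degree. -/
def Simp (S : Finset ℕ) (D : ℝ) (F : (ℕ → ℝ) → ℝ) : Prop :=
  ∃ c : Finset ℕ → ℝ, (∀ d, |c d| ≤ 1) ∧ (∀ d ⊆ S, c d ≠ 0 → ∏ p ∈ d, (p:ℝ) ≤ D) ∧
    ∀ h, F h = ∑ d ∈ S.powerset, c d * ∏ p ∈ d, h p

lemma Simp.mul {S1 S2 : Finset ℕ} {D1 D2 : ℝ} {F1 F2 : (ℕ → ℝ) → ℝ} (h1 : Simp S1 D1 F1)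
    (h2 : Simp S2 D2 F2) (hd : Disjoint S1 S2) (hD1 : 0 ≤ D1) :
    Simp (S1 ∪ S2) (D1 * D2) (fun h => F1 h * F2 h) := by
  obtain ⟨c1, a1, b1, e1⟩ := h1
  obtain ⟨c2, a2, b2, e2⟩ := h2
  have hdec : ∀ d ⊆ S1 ∪ S2, d = (d ∩ S1) ∪ (d ∩ S2) := by
    intro d hd
    rw [← inter_union_distrib_left]; exact (inter_eq_left.2 hd).symm
  have hdis : ∀ d : Finset ℕ, Disjoint (d ∩ S1) (d ∩ S2) := fun d =>
    disjoint_of_subset_left inter_subset_right (disjoint_of_subset_right inter_subset_right hd)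
  refine ⟨fun d => c1 (d ∩ S1) * c2 (d ∩ S2), ?_, ?_, ?_⟩
  · intro d
    rw [abs_mul]
    exact mul_le_one₀ (a1 _) (abs_nonneg _) (a2 _)
  · intro d hdS hc
    conv_lhs => rw [hdec d hdS, prod_union (hdis d)]
    exact mul_le_mul (b1 _ inter_subset_right (left_ne_zero_of_mul hc)) (b2 _ inter_subset_right (right_ne_zero_of_mul hc))
      (prod_nonneg fun _ _ => by positivity) hD1
  · intro h
    simp only [e1 h, e2 h]
    rw [sum_mul_sum, ← sum_product']
    refine sum_nbij' (fun x => x.1 ∪ x.2) (fun d => (d ∩ S1, d ∩ S2)) ?_ ?_ ?_ ?_ ?_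
    · intro x hx
      simp only [mem_product, mem_powerset] at hx ⊢
      exact union_subset_union hx.1 hx.2
    · intro d _
      simp
    · intro x hx
      simp only [mem_product, mem_powerset] at hx
      have q1 : x.2 ∩ S1 = ∅ := by
        rw [← disjoint_iff_inter_eq_empty]; exact disjoint_of_subset_left hx.2 hd.symm
      have q2 : x.1 ∩ S2 = ∅ := by
        rw [← disjoint_iff_inter_eq_empty]; exact disjoint_of_subset_left hx.1 hd
      simp [union_inter_distrib_right, q1, q2, inter_eq_left.2 hx.1, inter_eq_left.2 hx.2]
    · intro d hdS
      exact (hdec d (mem_powerset.1 hdS)).symm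
    · intro x hx
      simp only [mem_product, mem_powerset] at hx
      have q1 : x.2 ∩ S1 = ∅ := by
        rw [← disjoint_iff_inter_eq_empty]; exact disjoint_of_subset_left hx.2 hd.symm
      have q2 : x.1 ∩ S2 = ∅ := by
        rw [← disjoint_iff_inter_eq_empty]; exact disjoint_of_subset_left hx.1 hd
      rw [prod_union (disjoint_of_subset_left hx.1 (disjoint_of_subset_right hx.2 hd))]
      simp only [union_inter_distrib_right, q1, q2, inter_eq_left.2 hx.1, inter_eq_left.2 hx.2, union_empty, empty_union]
      ring

lemma Simp.prod {ι : Type*} [DecidableEq ι] (I : Finset ι) (S : ι → Finset ℕ) (D : ι → ℝ) (F : ι → (ℕ → ℝ) → ℝ)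
    (hd : ∀ i ∈ I, ∀ j ∈ I, i ≠ j → Disjoint (S i) (S j)) (hD : ∀ i ∈ I, 0 ≤ D i)
    (hF : ∀ i ∈ I, Simp (S i) (D i) (F i)) :
    Simp (I.biUnion S) (∏ i ∈ I, D i) (fun h => ∏ i ∈ I, F i h) := by
  induction I using Finset.induction_on with
  | empty =>
    refine ⟨fun d => 1, by simp, ?_, ?_⟩
    · intro d hd; simp at hd; simp [hd]
    · intro h; simp
  | insert i I hi ih =>
    have ih' := ih (fun a ha b hb => hd a (mem_insert_of_mem ha) b (mem_insert_of_mem hb))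
      (fun a ha => hD a (mem_insert_of_mem ha)) (fun a ha => hF a (mem_insert_of_mem ha))
    have := (hF i (mem_insert_self _ _)).mul ih' (by
      rw [disjoint_biUnion_right]
      intro j hj
      apply hd i (mem_insert_self _ _) j (mem_insert_of_mem hj)
      rintro rfl; exact hi hj) (hD i (mem_insert_self _ _))
    rw [biUnion_insert, prod_insert hi]
    simpa only [prod_insert hi] using this

lemma prod_primes_inj (d d' : Finset ℕ) (h : ∀ p ∈ d, p.Prime) (h' : ∀ p ∈ d', p.Prime)
    (e : ∏ p ∈ d, p = ∏ p ∈ d', p) : d = d' := by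
  rw [← Nat.primeFactors_prod h, ← Nat.primeFactors_prod h', e]

/-- transfer from points to the density model -/
lemma Simp.transfer {α : Type*} (Ω : Finset α) (P : Finset ℕ) (T : α → Finset ℕ) (g : ℕ → ℝ) (X E D : ℝ)
    (hP : ∀ p ∈ P, p.Prime) (hE : 0 ≤ E) (hD : 0 ≤ D)
    (hyp : ∀ d ⊆ P, ∏ p ∈ d, (p:ℝ) ≤ D → |((Ω.filter (fun ω => d ⊆ T ω)).card : ℝ) - X * ∏ p ∈ d, g p| ≤ E)
    (F : (ℕ → ℝ) → ℝ) (hF : Simp P D F) :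
    |∑ ω ∈ Ω, F (fun p => if p ∈ T ω then 1 else 0) - X * F g| ≤ D * E := by
  obtain ⟨c, hc1, hc2, hc3⟩ := hF
  have e1 : ∑ ω ∈ Ω, F (fun p => if p ∈ T ω then 1 else 0) - X * F g
      = ∑ d ∈ P.powerset, c d * (((Ω.filter (fun ω => d ⊆ T ω)).card : ℝ) - X * ∏ p ∈ d, g p) := by
    simp_rw [hc3, mul_sub]
    rw [sum_sub_distrib, sum_comm, mul_sum]
    congr 1
    · apply sum_congr rfl
      intro d _
      rw [← mul_sum]
      congr 1
      rw [card_filter]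
      push_cast
      apply sum_congr rfl
      intro ω _
      rw [prod_ite_zero]
      simp [subset_iff]
    · apply sum_congr rfl
      intro d _
      ring
  rw [e1]
  have e2 : ∑ d ∈ P.powerset, c d * (((Ω.filter (fun ω => d ⊆ T ω)).card : ℝ) - X * ∏ p ∈ d, g p)
     = ∑ d ∈ P.powerset.filter (fun d => c d ≠ 0), c d * (((Ω.filter (fun ω => d ⊆ T ω)).card : ℝ) - X * ∏ p ∈ d, g p) := by
    symm
    apply sum_filter_of_ne
    intro d _ h
    exact left_ne_zero_of_mul h
  rw [e2]
  refine (abs_sum_le_sum_abs _ _).trans ?_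
  have : ∀ d ∈ P.powerset.filter (fun d => c d ≠ 0), |c d * (((Ω.filter (fun ω => d ⊆ T ω)).card : ℝ) - X * ∏ p ∈ d, g p)| ≤ E := by
    intro d hd
    rw [mem_filter, mem_powerset] at hd
    rw [abs_mul]
    calc _ ≤ 1 * E := mul_le_mul (hc1 d) (hyp d hd.1 (hc2 d hd.1 hd.2)) (abs_nonneg _) (by norm_num)
      _ = E := one_mul _
  refine (sum_le_card_nsmul _ _ _ this).trans ?_
  rw [nsmul_eq_mul]
  apply mul_le_mul_of_nonneg_right _ hE
  have hcard : (P.powerset.filter (fun d => c d ≠ 0)).card ≤ (Icc 1 ⌊D⌋₊).card := by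
    apply card_le_card_of_injOn (fun d => ∏ p ∈ d, p)
    · intro d hd
      simp only [coe_filter, mem_powerset, Set.mem_setOf_eq] at hd
      simp only [coe_Icc, Set.mem_Icc]
      constructor
      · exact prod_pos (fun p hp => (hP p (hd.1 hp)).pos)
      · apply Nat.le_floor
        push_cast
        exact hc2 d hd.1 hd.2
    · intro d hd d' hd' e
      simp only [coe_filter, mem_powerset, Set.mem_setOf_eq] at hd hd'
      exact prod_primes_inj d d' (fun p hp => hP p (hd.1 hp)) (fun p hp => hP p (hd'.1 hp)) e
  rw [Nat.card_Icc, Nat.add_sub_cancel] at hcard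
  exact (Nat.cast_le.2 hcard).trans (Nat.floor_le hD)


lemma prod_telescope {ι : Type*} [DecidableEq ι] (I : Finset ι) (a b e : ι → ℝ)
    (h0 : ∀ i ∈ I, 0 ≤ a i) (h1 : ∀ i ∈ I, a i ≤ b i) (h2 : ∀ i ∈ I, b i ≤ a i + e i) :
    ∏ i ∈ I, a i ≤ ∏ i ∈ I, b i ∧ ∏ i ∈ I, b i - ∏ i ∈ I, a i ≤ ∑ i ∈ I, e i * ∏ l ∈ I.erase i, b l := by
  induction I using Finset.induction_on with
  | empty => simp
  | insert j I hj ih =>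
    obtain ⟨i1, i2⟩ := ih (fun a ha => h0 a (mem_insert_of_mem ha)) (fun a ha => h1 a (mem_insert_of_mem ha))
      (fun a ha => h2 a (mem_insert_of_mem ha))
    have a0 := h0 j (mem_insert_self _ _)
    have a1 := h1 j (mem_insert_self _ _)
    have a2 := h2 j (mem_insert_self _ _)
    have pa : 0 ≤ ∏ i ∈ I, a i := prod_nonneg (fun i hi => h0 i (mem_insert_of_mem hi))
    have pb : 0 ≤ ∏ i ∈ I, b i := pa.trans i1
    rw [prod_insert hj, prod_insert hj, sum_insert hj, erase_insert hj]
    refine ⟨mul_le_mul a1 i1 pa (a0.trans a1), ?_⟩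
    have e1 : ∑ i ∈ I, e i * ∏ l ∈ (insert j I).erase i, b l = b j * ∑ i ∈ I, e i * ∏ l ∈ I.erase i, b l := by
      rw [mul_sum]
      apply sum_congr rfl
      intro i hi
      have : i ≠ j := by rintro rfl; exact hj hi
      rw [erase_insert_of_ne this.symm, prod_insert (by simp [hj])]
      ring
    rw [e1]
    have : (b j * ∏ i ∈ I, b i) - a j * ∏ i ∈ I, a i = (b j - a j) * ∏ i ∈ I, b i + a j * (∏ i ∈ I, b i - ∏ i ∈ I, a i) := by ring
    rw [this]
    apply add_le_add
    · apply mul_le_mul_of_nonneg_right _ pb; linarith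
    · exact mul_le_mul a1 i2 (by linarith) (a0.trans a1)

lemma simp_bA (n : ℕ) (S : Finset ℕ) (Z : ℝ) (hZ : 1 ≤ Z) (hS : ∀ p ∈ S, (p:ℝ) ≤ Z) : Simp S (Z^n) (bA n S) := by
  refine ⟨fun d => if d.card < n then (-1:ℝ)^d.card else 0, ?_, ?_, fun h => rfl⟩
  · intro d; dsimp only; split_ifs <;> simp
  · intro d hd hc
    have : d.card < n := by by_contra h; simp [h] at hc
    calc ∏ p ∈ d, (p:ℝ) ≤ ∏ p ∈ d, Z := prod_le_prod (fun _ _ => by positivity) (fun p hp => hS p (hd hp))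
      _ = Z^d.card := by simp
      _ ≤ Z^n := pow_le_pow_right₀ hZ this.le

lemma simp_bE (n : ℕ) (S : Finset ℕ) (Z : ℝ) (hZ : 1 ≤ Z) (hS : ∀ p ∈ S, (p:ℝ) ≤ Z) : Simp S (Z^n) (bE n S) := by
  refine ⟨fun d => if d.card = n then (1:ℝ) else 0, ?_, ?_, fun h => rfl⟩
  · intro d; dsimp only; split_ifs <;> simp
  · intro d hd hc
    have : d.card = n := by by_contra h; simp [h] at hc
    calc ∏ p ∈ d, (p:ℝ) ≤ ∏ p ∈ d, Z := prod_le_prod (fun _ _ => by positivity) (fun p hp => hS p (hd hp))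
      _ = Z^d.card := by simp
      _ ≤ Z^n := pow_le_pow_right₀ hZ this.le

lemma Simp.mono {S : Finset ℕ} {D D' : ℝ} {F : (ℕ → ℝ) → ℝ} (h : Simp S D F) (hD : D ≤ D') : Simp S D' F := by
  obtain ⟨c, a, b, e⟩ := h
  exact ⟨c, a, fun d hd hc => (b d hd hc).trans hD, e⟩

def lev (z p : ℕ) : ℕ := Nat.log 2 (Nat.log p z)

lemma lev_spec (z p : ℕ) (hp : 2 ≤ p) (hpz : p ≤ z) : p^(2^(lev z p)) ≤ z ∧ z < p^(2^(lev z p + 1)) := by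
  have h1 : 1 ≤ Nat.log p z := by
    exact Nat.le_log_of_pow_le (by omega) (by simpa using hpz)
  unfold lev
  constructor
  · apply Nat.pow_le_of_le_log (by omega)
    exact Nat.pow_log_le_self _ (by omega)
  · apply Nat.lt_pow_of_log_lt (by omega)
    exact Nat.lt_pow_succ_log_self (by omega) _

lemma lev_lt (z p : ℕ) (hz : 2 ≤ z) : lev z p < z := by
  unfold lev
  have h1 : Nat.log 2 (Nat.log p z) ≤ Nat.log p z := Nat.log_le_self _ _
  have h2 : Nat.log p z < z := Nat.log_lt_self _ (by omega)
  omega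

lemma level_sum (z i : ℕ) (P : Finset ℕ) (hP : ∀ p ∈ P, p.Prime ∧ p ≤ z) :
    ∑ p ∈ P.filter (fun p => lev z p = i), (1:ℝ)/p ≤ 30 := by
  set S := P.filter (fun p => lev z p = i) with hS
  rcases S.eq_empty_or_nonempty with he | hne
  · rw [he]; simp
  set p0 := S.min' hne
  set p1 := S.max' hne
  have m0 : p0 ∈ S := min'_mem _ _
  have m1 : p1 ∈ S := max'_mem _ _
  have hmem : ∀ p ∈ S, p.Prime ∧ p ≤ z ∧ lev z p = i := by
    intro p hp
    rw [hS, mem_filter] at hp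
    exact ⟨(hP p hp.1).1, (hP p hp.1).2, hp.2⟩
  obtain ⟨q0, r0, l0⟩ := hmem p0 m0
  obtain ⟨q1, r1, l1⟩ := hmem p1 m1
  have hle : p0 ≤ p1 := min'_le _ _ m1
  have h2 : p1 ≤ p0^2 := by
    have a := (lev_spec z p1 q1.two_le r1).1
    have b := (lev_spec z p0 q0.two_le r0).2
    rw [l1] at a; rw [l0, pow_succ, mul_comm, pow_mul] at b
    exact ((pow_le_pow_iff_left₀ (by omega) (by positivity) (by positivity)).1 (a.trans b.le))
  have hsub : S ⊆ insert p0 ((Ioc p0 p1).filter Nat.Prime) := by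
    intro p hp
    rw [mem_insert, mem_filter, mem_Ioc]
    by_cases h : p = p0
    · left; exact h
    · right
      have := min'_le _ _ hp
      have := le_max' _ _ hp
      refine ⟨⟨?_, this⟩, (hmem p hp).1⟩
      omega
  have hm := mertens_range p0 p1 q0.two_le hle
  have h3 : ∑ p ∈ S, (1:ℝ)/p ≤ ∑ p ∈ insert p0 ((Ioc p0 p1).filter Nat.Prime), (1:ℝ)/p :=
    sum_le_sum_of_subset_of_nonneg hsub (fun _ _ _ => by positivity)
  rw [sum_insert (by simp)] at h3
  have h4 : (1:ℝ)/p0 ≤ 1/2 := by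
    apply one_div_le_one_div_of_le (by norm_num); exact_mod_cast q0.two_le
  have p0r : (2:ℝ) ≤ p0 := by exact_mod_cast q0.two_le
  have h5 : Real.log (Real.log p1) ≤ Real.log 2 + Real.log (Real.log p0) := by
    rw [← Real.log_mul (by norm_num) (Real.log_pos (by linarith)).ne']
    have p1r : (2:ℝ) ≤ p1 := by exact_mod_cast q1.two_le
    apply Real.log_le_log (Real.log_pos (by linarith))
    have : Real.log p1 ≤ Real.log ((p0:ℝ)^2) := by
      apply Real.log_le_log (by linarith); exact_mod_cast h2
    rw [Real.log_pow] at this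
    exact_mod_cast this
  have := Real.log_two_lt_d9
  linarith

lemma one_sub_ge (S : Finset ℕ) (g : ℕ → ℝ) (h0 : ∀ p ∈ S, 0 ≤ g p) (h1 : ∀ p ∈ S, g p ≤ 1/2) :
    Real.exp (-2 * ∑ p ∈ S, g p) ≤ ∏ p ∈ S, (1 - g p) := by
  rw [mul_sum, Real.exp_sum]
  apply prod_le_prod (fun _ _ => by positivity)
  intro p hp
  have a := h0 p hp
  have b := h1 p hp
  rw [← Real.le_log_iff_exp_le (by linarith)]
  have := Real.one_sub_inv_le_log_of_pos (show 0 < 1 - g p by linarith)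
  refine le_trans ?_ this
  have : (1 - g p)⁻¹ ≤ 1 + 2 * g p := by
    rw [inv_le_iff_one_le_mul₀ (by linarith)]
    nlinarith
  linarith

lemma geo_deg (R K : ℕ) : ∑ i ∈ range K, ((2*(R+i)+1 : ℕ):ℝ)/2^i = (4*R+6) - (4*R+4*K+6)/2^K := by
  induction K with
  | zero => simp
  | succ K ih =>
    rw [sum_range_succ, ih]
    push_cast
    field_simp
    ring

lemma geo_eta (R K : ℕ) (hR : 1 ≤ R) : ∑ i ∈ range K, (1/10:ℝ)^(2*(R+i)+1) ≤ 1/900 := by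
  have : ∀ i ∈ range K, (1/10:ℝ)^(2*(R+i)+1) ≤ (1/1000) * (1/100)^i := by
    intro i _
    have : (1/1000:ℝ) * (1/100)^i = (1/10)^(3+2*i) := by
      rw [pow_add, pow_mul]; norm_num
    rw [this]
    apply pow_le_pow_of_le_one (by norm_num) (by norm_num); omega
  refine (sum_le_sum this).trans ?_
  rw [← mul_sum, geom_sum_eq (by norm_num)]
  have : (0:ℝ) ≤ (1/100)^K := by positivity
  have e : (1/1000:ℝ) * (((1/100)^K - 1)/(1/100-1)) = (1/990) * (1 - (1/100)^K) := by ring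
  rw [e]
  linarith

/-- Brun sieve, fundamental-lemma form. -/
lemma brun {α : Type*} (Ω : Finset α) (z : ℕ) (hz : 2 ≤ z) (P : Finset ℕ) (hP : ∀ p ∈ P, p.Prime ∧ p ≤ z)
    (T : α → Finset ℕ) (hT : ∀ ω, T ω ⊆ P) (g : ℕ → ℝ) (κ X E D : ℝ) (R : ℕ) (hR1 : 1 ≤ R) (hκ : 0 ≤ κ) (hR : 900 * κ ≤ R)
    (hg0 : ∀ p ∈ P, 0 ≤ g p) (hg1 : ∀ p ∈ P, g p ≤ 1/2) (hg : ∀ p ∈ P, g p ≤ κ / p)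
    (hX : 0 ≤ X) (hE : 0 ≤ E) (hD : D = (z:ℝ)^(4*R+6))
    (hyp : ∀ d ⊆ P, ∏ p ∈ d, (p:ℝ) ≤ D → |((Ω.filter (fun ω => d ⊆ T ω)).card : ℝ) - X * ∏ p ∈ d, g p| ≤ E) :
    |((Ω.filter (fun ω => T ω = ∅)).card : ℝ) - X * ∏ p ∈ P, (1 - g p)| ≤ X * (∏ p ∈ P, (1 - g p)) / 100 + E * D^2 := by
  classical
  set S : ℕ → Finset ℕ := fun i => P.filter (fun p => lev z p = i) with hS
  set n : ℕ → ℕ := fun i => 2*(R+i)+1 with hn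
  set I := range z with hI
  have hSdis : ∀ i ∈ I, ∀ j ∈ I, i ≠ j → Disjoint (S i) (S j) := by
    intro i _ j _ hij
    rw [disjoint_filter]; intro p _ h1 h2; exact hij (h1.symm.trans h2)
  have hSu : I.biUnion S = P := by
    ext p
    simp only [mem_biUnion, hI, mem_range, hS, mem_filter]
    constructor
    · rintro ⟨i, _, h, _⟩; exact h
    · intro h; exact ⟨lev z p, lev_lt z p hz, h, rfl⟩
  have hSP : ∀ i, ∀ p ∈ S i, p ∈ P := fun i p hp => (mem_filter.1 hp).1
  have hprod : ∀ f : ℕ → ℝ, ∏ p ∈ P, f p = ∏ i ∈ I, ∏ p ∈ S i, f p := by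
    intro f
    rw [← prod_biUnion, hSu]
    intro i hi j hj hij; exact hSdis i hi j hj hij
  have zr : (2:ℝ) ≤ z := by exact_mod_cast hz
  set Z : ℕ → ℝ := fun i => (z:ℝ)^((1:ℝ)/2^i) with hZ
  have hZ1 : ∀ i, 1 ≤ Z i := fun i => Real.one_le_rpow (by linarith) (by positivity)
  have hSZ : ∀ i, ∀ p ∈ S i, (p:ℝ) ≤ Z i := by
    intro i p hp
    have hp' := mem_filter.1 hp
    have := (lev_spec z p (hP p hp'.1).1.two_le (hP p hp'.1).2).1
    rw [hp'.2] at this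
    have h' : (p:ℝ)^(2^i) ≤ z := by exact_mod_cast this
    have h2 := Real.rpow_le_rpow (by positivity) h' (show (0:ℝ) ≤ 1/2^i by positivity)
    rw [← Real.rpow_natCast, ← Real.rpow_mul (by positivity)] at h2
    push_cast at h2
    rw [mul_one_div_cancel (by positivity), Real.rpow_one] at h2
    exact h2
  have hDI : ∏ i ∈ I, (Z i)^(n i) ≤ D := by
    have : ∀ i ∈ I, (Z i)^(n i) = (z:ℝ)^((n i:ℝ)/2^i) := by
      intro i _
      rw [hZ, ← Real.rpow_natCast, ← Real.rpow_mul (by positivity)]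
      congr 1; ring
    rw [prod_congr rfl this, ← Real.rpow_sum_of_pos (by linarith), hD, ← Real.rpow_natCast]
    apply Real.rpow_le_rpow_of_exponent_le (by linarith)
    rw [hn, geo_deg]
    push_cast
    have : (0:ℝ) ≤ (4*R+4*z+6)/2^z := by positivity
    linarith
  have hD1 : 0 ≤ D := by rw [hD]; positivity
  set main : (ℕ → ℝ) → ℝ := fun h => ∏ i ∈ I, bA (n i) (S i) h with hmain
  set err : ℕ → (ℕ → ℝ) → ℝ := fun i h => bE (n i) (S i) h * ∏ l ∈ I.erase i, bA (n l) (S l) h with herr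
  have hsm : Simp P D main := by
    have := Simp.prod I S (fun i => (Z i)^(n i)) (fun i => bA (n i) (S i)) hSdis
      (fun i _ => by have := hZ1 i; positivity) (fun i _ => simp_bA _ _ _ (hZ1 i) (hSZ i))
    rw [hSu] at this
    exact this.mono hDI
  have hse : ∀ i ∈ I, Simp P D (err i) := by
    intro i hi
    have := Simp.prod I S (fun i => (Z i)^(n i)) (fun l => if l = i then bE (n l) (S l) else bA (n l) (S l)) hSdis
      (fun i _ => by have := hZ1 i; positivity) (fun l _ => by
        split_ifs
        · exact simp_bE _ _ _ (hZ1 l) (hSZ l)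
        · exact simp_bA _ _ _ (hZ1 l) (hSZ l))
    rw [hSu] at this
    have e : (fun h => ∏ l ∈ I, (if l = i then bE (n l) (S l) else bA (n l) (S l)) h) = err i := by
      funext h
      rw [herr, ← mul_prod_erase _ _ hi]
      simp only [if_true]
      congr 1
      apply prod_congr rfl
      intro l hl
      rw [if_neg (ne_of_mem_erase hl)]
    rw [e] at this
    exact this.mono hDI
  -- pointwise inequality
  have hbon : ∀ h : ℕ → ℝ, (∀ p ∈ P, 0 ≤ h p) → (∀ p ∈ P, h p ≤ 1) → ∀ i,
      ∏ p ∈ S i, (1 - h p) ≤ bA (n i) (S i) h ∧ bA (n i) (S i) h ≤ ∏ p ∈ S i, (1 - h p) + bE (n i) (S i) h := by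
    intro h h0 h1 i
    have := bonferroni (S i) h (fun p hp => h0 p (hSP i p hp)) (fun p hp => h1 p (hSP i p hp)) (n i)
    have hodd : (-1:ℝ)^(n i) = -1 := Odd.neg_one_pow ⟨R+i, rfl⟩
    rw [hodd] at this
    constructor <;> linarith [this.1, this.2]
  have hpt : ∀ h : ℕ → ℝ, (∀ p ∈ P, 0 ≤ h p) → (∀ p ∈ P, h p ≤ 1) →
      ∏ p ∈ P, (1 - h p) ≤ main h ∧ main h - ∏ p ∈ P, (1 - h p) ≤ ∑ i ∈ I, err i h := by
    intro h h0 h1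
    rw [hprod]
    apply prod_telescope
    · intro i _
      apply prod_nonneg; intro p hp; linarith [h1 p (hSP i p hp)]
    · exact fun i _ => (hbon h h0 h1 i).1
    · exact fun i _ => (hbon h h0 h1 i).2
  -- size of err g
  set V := ∏ p ∈ P, (1 - g p) with hV
  have hVi : ∀ i, 0 < ∏ p ∈ S i, (1 - g p) := by
    intro i
    apply prod_pos; intro p hp; linarith [hg1 p (hSP i p hp)]
  have hsumg : ∀ i, ∑ p ∈ S i, g p ≤ 30 * κ := by
    intro i
    calc ∑ p ∈ S i, g p ≤ ∑ p ∈ S i, κ * ((1:ℝ)/p) := by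
          apply sum_le_sum; intro p hp; rw [mul_one_div]; exact hg p (hSP i p hp)
      _ = κ * ∑ p ∈ S i, (1:ℝ)/p := by rw [mul_sum]
      _ ≤ κ * 30 := mul_le_mul_of_nonneg_left (level_sum z i P hP) hκ
      _ = _ := by ring
  set η : ℕ → ℝ := fun i => (1/10:ℝ)^(n i) with hη
  have heta : ∀ i, bE (n i) (S i) g ≤ η i * ∏ p ∈ S i, (1 - g p) := by
    intro i
    set s := ∑ p ∈ S i, g p with hs
    have s0 : 0 ≤ s := sum_nonneg (fun p hp => hg0 p (hSP i p hp))
    have a1 := bE_le (S i) g (fun p hp => hg0 p (hSP i p hp)) (n i)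
    have a2 := one_sub_ge (S i) g (fun p hp => hg0 p (hSP i p hp)) (fun p hp => hg1 p (hSP i p hp))
    rw [← hs] at a1 a2
    refine a1.trans (le_trans ?_ (mul_le_mul_of_nonneg_left a2 (by positivity)))
    have a3 := Real.pow_div_factorial_le_exp (20*s) (by positivity) (n i)
    have a4 : s^(n i)/(n i).factorial ≤ Real.exp (20*s) * (1/20)^(n i) := by
      rw [mul_pow] at a3
      calc s^(n i)/(n i).factorial = (20^(n i) * s^(n i) / (n i).factorial) * (1/20)^(n i) := by
            rw [one_div, inv_pow]; field_simp
        _ ≤ _ := by gcongr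
    refine a4.trans ?_
    have a5 : Real.exp (22*s) ≤ 2^(n i) := by
      have h1 : 22 * s ≤ (n i) * Real.log 2 := by
        have := hsumg i
        have h2 : (2*R:ℝ) ≤ n i := by
          have : 2 * R ≤ n i := by simp only [hn]; omega
          exact_mod_cast this
        have := Real.log_two_gt_d9
        nlinarith
      rw [← Real.le_log_iff_exp_le (by positivity), Real.log_pow]
      exact h1
    have a6 : Real.exp (20*s) = Real.exp (22*s) * Real.exp (-2*s) := by
      rw [← Real.exp_add]; congr 1; ring
    rw [a6]
    have a7 : (1/10:ℝ)^(n i) = 2^(n i) * (1/20)^(n i) := by rw [← mul_pow]; norm_num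
    simp only [hη]
    rw [a7]
    have : 0 < Real.exp (-2*s) := Real.exp_pos _
    have : (0:ℝ) < (1/20)^(n i) := by positivity
    calc _ = Real.exp (22*s) * ((1/20)^(n i) * Real.exp (-2*s)) := by ring
      _ ≤ 2^(n i) * ((1/20)^(n i) * Real.exp (-2*s)) := by gcongr
      _ = _ := by ring
  have hηs : ∑ i ∈ I, η i ≤ 1/900 := geo_eta R z hR1
  have hη0 : ∀ i, 0 ≤ η i := fun i => by positivity
  have hg1' : ∀ p ∈ P, g p ≤ 1 := fun p hp => (hg1 p hp).trans (by norm_num)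
  have hVpos : 0 < V := by rw [hV, hprod]; exact prod_pos (fun i _ => hVi i)
  have herrg : ∑ i ∈ I, err i g ≤ V / 400 := by
    have hb : ∀ i, bA (n i) (S i) g ≤ (∏ p ∈ S i, (1 - g p)) * Real.exp (η i) := by
      intro i
      have h1 := (hbon g hg0 hg1' i).2
      have h2 := heta i
      have h3 := Real.add_one_le_exp (η i)
      have h4 := hVi i
      nlinarith
    have hi : ∀ i ∈ I, err i g ≤ η i * (V * Real.exp (1/900)) := by
      intro i hi
      simp only [herr]
      have hb' : ∏ l ∈ I.erase i, bA (n l) (S l) g ≤ ∏ l ∈ I.erase i, ((∏ p ∈ S l, (1 - g p)) * Real.exp (η l)) :=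
        prod_le_prod (fun l _ => (hVi l).le.trans (hbon g hg0 hg1' l).1) (fun l _ => hb l)
      rw [prod_mul_distrib, ← Real.exp_sum] at hb'
      have hexp : Real.exp (∑ l ∈ I.erase i, η l) ≤ Real.exp (1/900) := by
        apply Real.exp_le_exp.2
        refine le_trans (sum_le_sum_of_subset_of_nonneg (erase_subset _ _) (fun l _ _ => hη0 l)) hηs
      have hpe : 0 ≤ ∏ l ∈ I.erase i, ∏ p ∈ S l, (1 - g p) := prod_nonneg (fun l _ => (hVi l).le)
      have hbA0 : 0 ≤ ∏ l ∈ I.erase i, bA (n l) (S l) g := prod_nonneg (fun l _ => (hVi l).le.trans (hbon g hg0 hg1' l).1)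
      calc _ ≤ (η i * ∏ p ∈ S i, (1 - g p)) * ((∏ l ∈ I.erase i, ∏ p ∈ S l, (1 - g p)) * Real.exp (1/900)) := by
            apply mul_le_mul (heta i) (hb'.trans (mul_le_mul_of_nonneg_left hexp hpe)) hbA0
            exact mul_nonneg (hη0 i) (hVi i).le
        _ = η i * (((∏ p ∈ S i, (1 - g p)) * ∏ l ∈ I.erase i, ∏ p ∈ S l, (1 - g p)) * Real.exp (1/900)) := by ring
        _ = _ := by rw [mul_prod_erase I (fun l => ∏ p ∈ S l, (1 - g p)) hi, ← hprod]
    refine (sum_le_sum hi).trans ?_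
    rw [← sum_mul]
    have h9 : Real.exp (1/900) ≤ 2 := by
      have : Real.exp (1/900) ≤ Real.exp (Real.log 2) := by
        apply Real.exp_le_exp.2; have := Real.log_two_gt_d9; linarith
      rwa [Real.exp_log (by norm_num)] at this
    have : V * Real.exp (1/900) ≤ V * 2 := by gcongr
    calc _ ≤ (1/900) * (V * 2) := by
          apply mul_le_mul hηs this (by positivity) (by norm_num)
      _ ≤ V/400 := by linarith
  -- assemble
  set hω : α → ℕ → ℝ := fun ω p => if p ∈ T ω then 1 else 0 with hhω
  have hind : ∀ ω, ∏ p ∈ P, (1 - hω ω p) = if T ω = ∅ then 1 else 0 := by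
    intro ω
    split_ifs with h
    · simp [hhω, h]
    · obtain ⟨p, hp⟩ := nonempty_iff_ne_empty.2 h
      apply prod_eq_zero (hT ω hp)
      simp [hhω, hp]
  have hω0 : ∀ ω, ∀ p ∈ P, 0 ≤ hω ω p := by intro ω p _; simp only [hhω]; split_ifs <;> norm_num
  have hω1 : ∀ ω, ∀ p ∈ P, hω ω p ≤ 1 := by intro ω p _; simp only [hhω]; split_ifs <;> norm_num
  have hcount : ((Ω.filter (fun ω => T ω = ∅)).card : ℝ) = ∑ ω ∈ Ω, ∏ p ∈ P, (1 - hω ω p) := by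
    rw [card_filter]; push_cast
    apply sum_congr rfl; intro ω _; rw [hind]
  have hPp : ∀ p ∈ P, p.Prime := fun p hp => (hP p hp).1
  have t1 := Simp.transfer Ω P T g X E D hPp hE hD1 hyp main hsm
  have t2 : ∀ i ∈ I, |∑ ω ∈ Ω, err i (hω ω) - X * err i g| ≤ D * E := fun i hi =>
    Simp.transfer Ω P T g X E D hPp hE hD1 hyp (err i) (hse i hi)
  have u1 : ∑ ω ∈ Ω, ∏ p ∈ P, (1 - hω ω p) ≤ ∑ ω ∈ Ω, main (hω ω) :=
    sum_le_sum (fun ω _ => (hpt _ (hω0 ω) (hω1 ω)).1)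
  have u2 : ∑ ω ∈ Ω, main (hω ω) - ∑ ω ∈ Ω, ∏ p ∈ P, (1 - hω ω p) ≤ ∑ i ∈ I, ∑ ω ∈ Ω, err i (hω ω) := by
    rw [← sum_sub_distrib, sum_comm]
    exact sum_le_sum (fun ω _ => (hpt _ (hω0 ω) (hω1 ω)).2)
  have u3 : ∑ i ∈ I, ∑ ω ∈ Ω, err i (hω ω) ≤ X * (V/400) + z * (D * E) := by
    calc _ ≤ ∑ i ∈ I, (X * err i g + D * E) := by
          apply sum_le_sum; intro i hi
          have := (abs_le.1 (t2 i hi)).2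
          linarith
      _ = X * ∑ i ∈ I, err i g + z * (D * E) := by
          rw [sum_add_distrib, ← mul_sum, sum_const, hI, card_range, nsmul_eq_mul]
      _ ≤ _ := by gcongr
  have u4 := hpt g hg0 hg1'
  rw [← hV] at u4
  have u5 : X * (main g - V) ≤ X * (V/400) := mul_le_mul_of_nonneg_left (u4.2.trans herrg) hX
  have u6 : 0 ≤ X * (main g - V) := mul_nonneg hX (by linarith [u4.1])
  have hzD : (z:ℝ) + 1 ≤ D := by
    rw [hD]
    have : (z:ℝ)^2 ≤ (z:ℝ)^(4*R+6) := pow_le_pow_right₀ (by linarith) (by omega)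
    nlinarith
  have u7 : z * (D*E) + D*E ≤ E * D^2 := by
    have : 0 ≤ D * E := by positivity
    nlinarith
  have t1' := abs_le.1 t1
  change _ ≤ ∑ ω ∈ Ω, main (hω ω) - X * main g ∧ ∑ ω ∈ Ω, main (hω ω) - X * main g ≤ _ at t1'
  have hXV : 0 ≤ X * V := by positivity
  rw [hcount, abs_le]
  constructor <;> nlinarith [t1'.1, t1'.2]


def Per (M : ℕ) (B : ℕ → ℕ → Prop) : Prop := ∀ u v, B (u % M) (v % M) ↔ B u v

open Classical in
noncomputable def cnt (M : ℕ) (B : ℕ → ℕ → Prop) : ℕ := ((range M ×ˢ range M).filter (fun x => B x.1 x.2)).card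

lemma Per.of_dvd {M N : ℕ} {B : ℕ → ℕ → Prop} (h : Per M B) (hd : M ∣ N) : Per N B := by
  intro u v
  rw [← h u v, ← h (u % N) (v % N), Nat.mod_mod_of_dvd _ hd, Nat.mod_mod_of_dvd _ hd]

lemma Per.and {M : ℕ} {B B' : ℕ → ℕ → Prop} (h : Per M B) (h' : Per M B') : Per M (fun u v => B u v ∧ B' u v) :=
  fun u v => and_congr (h u v) (h' u v)

lemma cnt_mul {M N : ℕ} (hM : 0 < M) (hN : 0 < N) (hc : Nat.Coprime M N) {B B' : ℕ → ℕ → Prop} (h : Per M B) (h' : Per N B') :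
    cnt (M * N) (fun u v => B u v ∧ B' u v) = cnt M B * cnt N B' := by
  classical
  unfold cnt
  rw [← card_product]
  have cr : ∀ a b : ℕ, ∃ k, k < M * N ∧ k % M = a % M ∧ k % N = b % N := by
    intro a b
    have k := Nat.chineseRemainder hc a b
    refine ⟨k.1 % (M*N), Nat.mod_lt _ (by positivity), ?_, ?_⟩
    · rw [Nat.mod_mod_of_dvd _ (dvd_mul_right _ _)]; exact k.2.1
    · rw [Nat.mod_mod_of_dvd _ (dvd_mul_left _ _)]; exact k.2.2
  have un : ∀ a b : ℕ, a < M * N → b < M * N → a % M = b % M → a % N = b % N → a = b := by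
    intro a b ha hb h1 h2
    have : a ≡ b [MOD M * N] := (Nat.modEq_and_modEq_iff_modEq_mul hc).1 ⟨h1, h2⟩
    rwa [Nat.ModEq, Nat.mod_eq_of_lt ha, Nat.mod_eq_of_lt hb] at this
  apply card_nbij (fun x => ((x.1 % M, x.2 % M), (x.1 % N, x.2 % N)))
  · rintro ⟨u, v⟩ hx
    simp only [coe_filter, mem_product, mem_range, Set.mem_ofPred_eq, coe_product, Set.mem_prod] at hx ⊢
    exact ⟨⟨⟨Nat.mod_lt _ hM, Nat.mod_lt _ hM⟩, (h _ _).2 hx.2.1⟩, ⟨⟨Nat.mod_lt _ hN, Nat.mod_lt _ hN⟩, (h' _ _).2 hx.2.2⟩⟩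
  · rintro ⟨u, v⟩ hx ⟨u', v'⟩ hx' e
    simp only [coe_filter, mem_product, mem_range, Set.mem_ofPred_eq] at hx hx'
    simp only [Prod.mk.injEq] at e
    rw [un u u' hx.1.1 hx'.1.1 e.1.1 e.2.1, un v v' hx.1.2 hx'.1.2 e.1.2 e.2.2]
  · rintro ⟨⟨a, b⟩, ⟨c, d⟩⟩ hx
    simp only [coe_filter, mem_product, mem_range, Set.mem_ofPred_eq, coe_product, Set.mem_prod] at hx
    obtain ⟨u, hu, u1, u2⟩ := cr a c
    obtain ⟨v, hv, v1, v2⟩ := cr b d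
    refine ⟨(u, v), ?_, ?_⟩
    · simp only [coe_filter, mem_product, mem_range, Set.mem_ofPred_eq]
      refine ⟨⟨hu, hv⟩, ?_, ?_⟩
      · rw [← h u v, u1, v1, h]; exact hx.1.2
      · rw [← h' u v, u2, v2, h']; exact hx.2.2
    · simp only [Prod.mk.injEq]
      rw [u1, v1, u2, v2, Nat.mod_eq_of_lt hx.1.1.1, Nat.mod_eq_of_lt hx.1.1.2, Nat.mod_eq_of_lt hx.2.1.1, Nat.mod_eq_of_lt hx.2.1.2]
      exact ⟨⟨rfl, rfl⟩, rfl, rfl⟩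

lemma per_prod {M0 : ℕ} {B0 : ℕ → ℕ → Prop} (h0 : Per M0 B0) (Bp : ℕ → ℕ → ℕ → Prop) (d : Finset ℕ)
    (hB : ∀ p ∈ d, Per p (Bp p)) : Per (M0 * ∏ p ∈ d, p) (fun u v => B0 u v ∧ ∀ p ∈ d, Bp p u v) := by
  apply (h0.of_dvd (dvd_mul_right _ _)).and
  intro u v
  apply forall₂_congr
  intro p hp
  exact (hB p hp).of_dvd ((dvd_prod_of_mem (fun p => p) hp).trans (dvd_mul_left _ _)) u v

lemma cnt_prod {M0 : ℕ} (hM0 : 0 < M0) {B0 : ℕ → ℕ → Prop} (h0 : Per M0 B0) (Bp : ℕ → ℕ → ℕ → Prop) (d : Finset ℕ)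
    (hB : ∀ p ∈ d, Per p (Bp p)) (hp : ∀ p ∈ d, p.Prime) (hc : ∀ p ∈ d, Nat.Coprime M0 p) :
    cnt (M0 * ∏ p ∈ d, p) (fun u v => B0 u v ∧ ∀ p ∈ d, Bp p u v) = cnt M0 B0 * ∏ p ∈ d, cnt p (Bp p) := by
  induction d using Finset.induction_on with
  | empty => simp
  | insert q d hq ih =>
    have hB' : ∀ p ∈ d, Per p (Bp p) := fun p h => hB p (mem_insert_of_mem h)
    have ih' := ih hB' (fun p h => hp p (mem_insert_of_mem h)) (fun p h => hc p (mem_insert_of_mem h))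
    have hqp := hp q (mem_insert_self _ _)
    have cop : Nat.Coprime (M0 * ∏ p ∈ d, p) q := by
      apply Nat.Coprime.mul_left (hc q (mem_insert_self _ _))
      apply Nat.Coprime.prod_left
      intro p h
      rw [Nat.coprime_primes (hp p (mem_insert_of_mem h)) hqp]
      rintro rfl; exact hq h
    have := cnt_mul (Nat.mul_pos hM0 (prod_pos (fun p h => (hp p (mem_insert_of_mem h)).pos))) hqp.pos cop
      (per_prod h0 Bp d hB') (hB q (mem_insert_self _ _))
    rw [ih'] at this
    rw [prod_insert hq, prod_insert hq]
    have e1 : M0 * (q * ∏ p ∈ d, p) = M0 * (∏ p ∈ d, p) * q := by ring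
    have e2 : cnt M0 B0 * (cnt q (Bp q) * ∏ p ∈ d, cnt p (Bp p)) = cnt M0 B0 * (∏ p ∈ d, cnt p (Bp p)) * cnt q (Bp q) := by ring
    rw [e1, e2, ← this]
    congr 1
    funext u v
    simp only [mem_insert, forall_eq_or_imp, eq_iff_iff]
    tauto

lemma interval_count (U Y M r : ℕ) (hM : 0 < M) (hr : r < M) :
    |(((Ico U (U+Y)).filter (fun u => u % M = r)).card : ℝ) - (Y:ℝ)/M| ≤ 1 := by
  have h := Nat.Ico_filter_modEq_card U (U+Y) (r := M) hM r
  have e : (Ico U (U+Y)).filter (fun u => u % M = r) = (Ico U (U+Y)).filter (fun u => u ≡ r [MOD M]) := by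
    apply filter_congr; intro u _; rw [Nat.ModEq, Nat.mod_eq_of_lt hr]
  rw [e]
  set c := ((Ico U (U+Y)).filter (fun u => u ≡ r [MOD M])).card
  have hMq : (0:ℚ) < M := by exact_mod_cast hM
  have a1 := Int.le_ceil (((U+Y:ℕ) - r : ℚ)/M)
  have a2 := Int.ceil_lt_add_one (((U+Y:ℕ) - r : ℚ)/M)
  have a3 := Int.le_ceil ((U - r : ℚ)/M)
  have a4 := Int.ceil_lt_add_one ((U - r : ℚ)/M)
  have a5 : ((U+Y:ℕ) - r : ℚ)/M = (U - r : ℚ)/M + (Y:ℚ)/M := by push_cast; ring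
  have a6 : (0:ℚ) ≤ (Y:ℚ)/M := by positivity
  have hq : |(c:ℚ) - (Y:ℚ)/M| ≤ 1 := by
    have h' : (c:ℚ) = (max (⌈((U+Y:ℕ) - r : ℚ)/M⌉ - ⌈(U - r : ℚ)/M⌉) 0 : ℤ) := by
      exact_mod_cast h
    rw [h']
    push_cast
    push_cast at a1 a2 a5
    rw [abs_le]
    rcases le_total ((⌈((U+Y:ℚ) - r : ℚ)/M⌉:ℚ) - ⌈(U - r : ℚ)/M⌉) 0 with h | h
    · rw [max_eq_right h]; constructor <;> linarith
    · rw [max_eq_left h]; constructor <;> linarith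
  have hq' : ((|(c:ℚ) - (Y:ℚ)/M| : ℚ) : ℝ) ≤ ((1:ℚ):ℝ) := Rat.cast_le.2 hq
  push_cast at hq'
  exact hq'

open Classical in
lemma box_count (U U' Y M : ℕ) (hM : 0 < M) (hY : M ≤ Y) (B : ℕ → ℕ → Prop) (hB : Per M B) :
    |(((Ico U (U+Y) ×ˢ Ico U' (U'+Y)).filter (fun x => B x.1 x.2)).card : ℝ) - cnt M B * ((Y:ℝ)/M)^2| ≤ 3 * Y * M := by
  have e : ((Ico U (U+Y) ×ˢ Ico U' (U'+Y)).filter (fun x => B x.1 x.2)).card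
     = ∑ γ ∈ (range M ×ˢ range M).filter (fun x => B x.1 x.2),
       ((Ico U (U+Y)).filter (fun u => u % M = γ.1)).card * ((Ico U' (U'+Y)).filter (fun u => u % M = γ.2)).card := by
    rw [card_eq_sum_card_fiberwise (f := fun x => (x.1 % M, x.2 % M)) (t := (range M ×ˢ range M).filter (fun x => B x.1 x.2))]
    · apply sum_congr rfl
      rintro ⟨a, b⟩ hγ
      rw [← card_product]
      congr 1
      ext ⟨u, v⟩
      simp only [mem_filter, mem_product, mem_range, Prod.mk.injEq] at hγ ⊢
      constructor
      · rintro ⟨⟨⟨h1, h2⟩, _⟩, h3, h4⟩; exact ⟨⟨h1, h3⟩, h2, h4⟩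
      · rintro ⟨⟨h1, h3⟩, h2, h4⟩
        refine ⟨⟨⟨h1, h2⟩, ?_⟩, h3, h4⟩
        rw [← hB u v, h3, h4]; exact hγ.2
    · rintro ⟨u, v⟩ hx
      simp only [coe_filter, mem_product, mem_range, Set.mem_ofPred_eq] at hx ⊢
      exact ⟨⟨Nat.mod_lt _ hM, Nat.mod_lt _ hM⟩, (hB _ _).2 hx.2⟩
  rw [e]
  unfold cnt
  have hMr : (0:ℝ) < M := by exact_mod_cast hM
  have hr : (1:ℝ) ≤ (Y:ℝ)/M := by rw [le_div_iff₀ hMr]; simpa using hY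
  push_cast
  rw [← nsmul_eq_mul, ← sum_const, ← sum_sub_distrib]
  refine (abs_sum_le_sum_abs _ _).trans ?_
  have key : ∀ γ ∈ (range M ×ˢ range M).filter (fun x => B x.1 x.2),
     |(((Ico U (U+Y)).filter (fun u => u % M = γ.1)).card:ℝ) * ((Ico U' (U'+Y)).filter (fun u => u % M = γ.2)).card - ((Y:ℝ)/M)^2| ≤ 3 * ((Y:ℝ)/M) := by
    rintro ⟨a, b⟩ hγ
    simp only [mem_filter, mem_product, mem_range] at hγ
    have h1 := abs_le.1 (interval_count U Y M a hM hγ.1.1)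
    have h2 := abs_le.1 (interval_count U' Y M b hM hγ.1.2)
    dsimp only
    set n1 := (((Ico U (U+Y)).filter (fun u => u % M = a)).card:ℝ)
    set n2 := (((Ico U' (U'+Y)).filter (fun u => u % M = b)).card:ℝ)
    rw [abs_le]
    have : 0 ≤ n1 := by positivity
    have : 0 ≤ n2 := by positivity
    constructor <;> nlinarith
  refine (sum_le_card_nsmul _ _ _ key).trans ?_
  rw [nsmul_eq_mul]
  have hc : (((range M ×ˢ range M).filter (fun x => B x.1 x.2)).card : ℝ) ≤ (M:ℝ)*M := by
    have := card_filter_le (range M ×ˢ range M) (fun x => B x.1 x.2)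
    rw [card_product, card_range] at this
    exact_mod_cast this
  calc _ ≤ (M:ℝ)*M*(3 * ((Y:ℝ)/M)) := by gcongr
    _ = _ := by field_simp

open Classical in
/-- two dimensional sieve -/
lemma sieve2 (U U' Y M0 z : ℕ) (hz : 2 ≤ z) (hM0 : 0 < M0) (P : Finset ℕ) (hP : ∀ p ∈ P, p.Prime ∧ p ≤ z)
    (hc : ∀ p ∈ P, Nat.Coprime M0 p) (B0 : ℕ → ℕ → Prop) (hB0 : Per M0 B0) (Bp : ℕ → ℕ → ℕ → Prop)
    (hBp : ∀ p ∈ P, Per p (Bp p)) (κ D : ℝ) (R : ℕ) (hR1 : 1 ≤ R) (hκ : 0 ≤ κ) (hR : 900 * κ ≤ R)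
    (g : ℕ → ℝ) (hgd : ∀ p ∈ P, g p = (cnt p (Bp p) : ℝ) / (p:ℝ)^2)
    (hg1 : ∀ p ∈ P, g p ≤ 1/2) (hg : ∀ p ∈ P, g p ≤ κ / p) (hD : D = (z:ℝ)^(4*R+6)) (hY : M0 * D ≤ Y) :
    |(((Ico U (U+Y) ×ˢ Ico U' (U'+Y)).filter (fun x => B0 x.1 x.2 ∧ ∀ p ∈ P, ¬ Bp p x.1 x.2)).card : ℝ)
      - cnt M0 B0 * ((Y:ℝ)/M0)^2 * ∏ p ∈ P, (1 - g p)| ≤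
      cnt M0 B0 * ((Y:ℝ)/M0)^2 * (∏ p ∈ P, (1 - g p)) / 100 + 3 * Y * M0 * D^3 := by
  have hD1 : 1 ≤ D := by
    rw [hD]; apply one_le_pow₀; exact_mod_cast (by omega)
  have h := brun ((Ico U (U+Y) ×ˢ Ico U' (U'+Y)).filter (fun x => B0 x.1 x.2)) z hz P hP
    (fun x => P.filter (fun p => Bp p x.1 x.2)) (fun _ => filter_subset _ _) g κ (cnt M0 B0 * ((Y:ℝ)/M0)^2) (3 * Y * M0 * D) D R hR1 hκ hR
    (fun p hp => by rw [hgd p hp]; positivity) hg1 hg (by positivity) (by positivity) hD (by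
      intro d hd hdD
      have hdp : ∀ p ∈ d, p.Prime := fun p hp => (hP p (hd hp)).1
      set M := M0 * ∏ p ∈ d, p with hM
      have hMpos : 0 < M := Nat.mul_pos hM0 (prod_pos (fun p hp => (hdp p hp).pos))
      have hMr : (M:ℝ) ≤ M0 * D := by
        rw [hM]; push_cast; gcongr
      have b := box_count U U' Y M hMpos (by exact_mod_cast hMr.trans hY) _ (per_prod hB0 Bp d (fun p hp => hBp p (hd hp)))
      rw [hM, cnt_prod hM0 hB0 Bp d (fun p hp => hBp p (hd hp)) hdp (fun p hp => hc p (hd hp)), ← hM] at b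
      have e1 : (cnt M0 B0 * ((Y:ℝ)/M0)^2) * ∏ p ∈ d, g p = ((cnt M0 B0 * ∏ p ∈ d, cnt p (Bp p) : ℕ):ℝ) * ((Y:ℝ)/M)^2 := by
        rw [prod_congr rfl (fun p hp => hgd p (hd hp)), prod_div_distrib, prod_pow, hM]
        push_cast
        have : (∏ p ∈ d, (p:ℝ)) ≠ 0 := prod_ne_zero_iff.2 (fun p hp => by exact_mod_cast (hdp p hp).ne_zero)
        have : (M0:ℝ) ≠ 0 := by exact_mod_cast hM0.ne'
        field_simp
      rw [e1]
      have e2 : (((Ico U (U+Y) ×ˢ Ico U' (U'+Y)).filter (fun x => B0 x.1 x.2)).filter (fun x => d ⊆ P.filter (fun p => Bp p x.1 x.2)))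
        = (Ico U (U+Y) ×ˢ Ico U' (U'+Y)).filter (fun x => B0 x.1 x.2 ∧ ∀ p ∈ d, Bp p x.1 x.2) := by
        rw [filter_filter]
        apply filter_congr
        intro x _
        apply and_congr_right
        intro _
        constructor
        · intro h p hp; exact (mem_filter.1 (h hp)).2
        · intro h p hp; exact mem_filter.2 ⟨hd hp, h p hp⟩
      rw [e2]
      refine le_trans (le_of_eq ?_) (b.trans ?_)
      · congr!
      calc 3 * (Y:ℝ) * M ≤ 3 * Y * (M0 * D) := by gcongr
        _ = _ := by ring)
  have e3 : (((Ico U (U+Y) ×ˢ Ico U' (U'+Y)).filter (fun x => B0 x.1 x.2)).filter (fun x => P.filter (fun p => Bp p x.1 x.2) = ∅))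
        = (Ico U (U+Y) ×ˢ Ico U' (U'+Y)).filter (fun x => B0 x.1 x.2 ∧ ∀ p ∈ P, ¬ Bp p x.1 x.2) := by
    rw [filter_filter]
    apply filter_congr
    intro x _
    apply and_congr_right
    intro _
    rw [filter_eq_empty_iff]
  rw [e3] at h
  refine h.trans (le_of_eq ?_)
  ring


lemma per_zmod (N : ℕ) (B : ZMod N → ZMod N → Prop) : Per N (fun u v => B u v) := by
  intro u v
  simp [ZMod.natCast_mod]

open Classical in
lemma cnt_zmod (N : ℕ) [NeZero N] (B : ZMod N → ZMod N → Prop) :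
    cnt N (fun u v => B u v) = (univ.filter (fun x : ZMod N × ZMod N => B x.1 x.2)).card := by
  unfold cnt
  apply card_nbij' (fun x => ((x.1 : ZMod N), (x.2 : ZMod N))) (fun x => (x.1.val, x.2.val))
  · rintro ⟨u, v⟩ hx
    simp at hx ⊢; exact hx.2
  · rintro ⟨u, v⟩ hx
    simp at hx ⊢
    exact ⟨⟨ZMod.val_lt _, ZMod.val_lt _⟩, hx⟩
  · rintro ⟨u, v⟩ hx
    simp at hx ⊢
    exact ⟨Nat.mod_eq_of_lt hx.1.1, Nat.mod_eq_of_lt hx.1.2⟩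
  · rintro ⟨u, v⟩ hx
    simp

open Classical in
noncomputable def sqfib (N : ℕ) [NeZero N] (A : ZMod N) : ℕ :=
  (univ.filter (fun x : ZMod N × ZMod N => x.1^2 + x.2^2 = A)).card

lemma sqfib_mono (N : ℕ) [NeZero N] (A c d : ZMod N) (hu : IsUnit (c^2+d^2)) :
    sqfib N A ≤ sqfib N ((c^2+d^2)*A) := by
  classical
  unfold sqfib
  apply card_le_card_of_injOn (fun x => (x.1*c - x.2*d, x.1*d+x.2*c))
  · rintro ⟨u, v⟩ hx
    simp at hx ⊢
    rw [← hx]; ring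
  · rintro ⟨u, v⟩ _ ⟨u', v'⟩ _ e
    simp only [Prod.mk.injEq] at e ⊢
    constructor
    · apply hu.mul_left_cancel
      linear_combination c * e.1 + d * e.2
    · apply hu.mul_left_cancel
      linear_combination c * e.2 - d * e.1

lemma sqfib_prime_eq (p : ℕ) [Fact p.Prime] (A C : ZMod p) (hA : A ≠ 0) (hC : C ≠ 0) : sqfib p A = sqfib p C := by
  have key : ∀ A C : ZMod p, A ≠ 0 → C ≠ 0 → sqfib p A ≤ sqfib p C := by
    intro A C hA hC
    obtain ⟨a, b, h⟩ := ZMod.sq_add_sq p (C / A)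
    have := sqfib_mono p A a b (by rw [h]; exact (div_ne_zero hC hA).isUnit)
    rwa [h, div_mul_cancel₀ _ hA] at this
  exact le_antisymm (key _ _ hA hC) (key _ _ hC hA)

lemma sqfib_zero (p : ℕ) [hp : Fact p.Prime] (h2 : p ≠ 2) : (sqfib p 0 : ℝ) = 1 + (p-1) * (1 + chi p) := by
  classical
  have hroots := legendreSym.card_sqrts p h2 (-1)
  rw [legendreSym.at_neg_one h2] at hroots
  have e : univ.filter (fun x : ZMod p × ZMod p => x.1^2 + x.2^2 = 0)
     = insert (0,0) ((({x : ZMod p | x ^ 2 = ((-1:ℤ) : ZMod p)}.toFinset) ×ˢ (univ.erase (0 : ZMod p))).image (fun x => (x.1*x.2, x.2))) := by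
    ext ⟨u, v⟩
    simp only [mem_filter, mem_univ, true_and, mem_insert, mem_image, mem_product, mem_erase, Prod.exists, Prod.mk.injEq, Set.mem_toFinset, Set.mem_ofPred_eq]
    constructor
    · intro h
      by_cases hv : v = 0
      · left; subst hv; simpa using h
      · right
        refine ⟨u / v, v, ⟨?_, hv, trivial⟩, by field_simp, rfl⟩
        rw [div_pow, div_eq_iff (pow_ne_zero _ hv)]
        push_cast
        linear_combination h
    · rintro (⟨rfl, rfl⟩ | ⟨a, b, ⟨h1, _⟩, rfl, rfl⟩)
      · simp
      · push_cast at h1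
        linear_combination b^2 * h1
  unfold sqfib
  rw [e, card_insert_of_notMem, card_image_of_injOn, card_product, card_erase_of_mem (mem_univ _), card_univ, ZMod.card]
  · push_cast
    rw [Nat.cast_sub hp.out.one_lt.le]
    have : (({x : ZMod p | x ^ 2 = ((-1:ℤ) : ZMod p)}.toFinset.card : ℤ):ℝ) = chi p + 1 := by
      rw [hroots]; push_cast; rfl
    rw [Int.cast_natCast] at this
    push_cast at this
    rw [this]; ring
  · rintro ⟨a, b⟩ h ⟨a', b'⟩ _ e
    simp only [coe_product, coe_erase, Set.mem_prod, Set.mem_sdiff, Set.mem_singleton_iff] at h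
    simp only [Prod.mk.injEq] at e ⊢
    obtain ⟨e1, rfl⟩ := e
    exact ⟨mul_right_cancel₀ h.2.2 e1, rfl⟩
  · simp only [mem_image, mem_product, mem_erase, Prod.exists, Prod.mk.injEq]
    rintro ⟨a, b, ⟨_, h, _⟩, _, h'⟩
    exact h h'

lemma sqfib_sum (p : ℕ) [Fact p.Prime] (F : Finset (ZMod p)) :
    (univ.filter (fun x : ZMod p × ZMod p => x.1^2 + x.2^2 ∈ F)).card = ∑ A ∈ F, sqfib p A := by
  classical
  rw [card_eq_sum_card_fiberwise (f := fun x => x.1^2+x.2^2) (t := F)]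
  · apply sum_congr rfl
    intro A hA
    unfold sqfib
    congr 1
    ext x
    simp only [mem_filter, mem_univ, true_and]
    constructor
    · exact fun h => h.2
    · intro h; exact ⟨h ▸ hA, h⟩
  · intro x hx
    simpa using hx

lemma sqfib_unit (p : ℕ) [hp : Fact p.Prime] (h2 : p ≠ 2) (A : ZMod p) (hA : A ≠ 0) : (sqfib p A : ℝ) = p - chi p := by
  classical
  have h := sqfib_sum p univ
  rw [← add_sum_erase univ _ (mem_univ (0 : ZMod p)), sum_congr rfl (fun C hC => sqfib_prime_eq p C A (ne_of_mem_erase hC) hA),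
    sum_const, card_erase_of_mem (mem_univ _), card_univ, ZMod.card] at h
  simp only [mem_univ, filter_true, card_univ, Fintype.card_prod, ZMod.card, smul_eq_mul] at h
  have h' : (p:ℝ) * p = sqfib p 0 + ((p:ℝ)-1) * sqfib p A := by
    have : ((p * p : ℕ):ℝ) = ((sqfib p 0 + (p-1) * sqfib p A : ℕ):ℝ) := by rw [h]
    push_cast at this
    rwa [Nat.cast_sub hp.out.one_lt.le, Nat.cast_one] at this
  rw [sqfib_zero p h2] at h'
  have hp1 : (1:ℝ) < p := by exact_mod_cast hp.out.one_lt
  have : ((p:ℝ) - 1) * (sqfib p A - (p - chi p)) = 0 := by linear_combination -h'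
  rcases mul_eq_zero.1 this with h | h <;> linarith

open Classical in
/-- local density of the sieve condition -/
lemma cnt_F (p k : ℕ) [hp : Fact p.Prime] (h2 : p ≠ 2) (F : Finset (ZMod p)) (h0 : 0 ∈ F) (hF : F.card = k + 1) :
    (cnt p (fun u v => (u:ZMod p)^2 + (v:ZMod p)^2 ∈ F) : ℝ) / (p:ℝ)^2 = 1 - (1 - (k+1)/p) * (1 - chi p / p) := by
  have this' : cnt p (fun u v => (u:ZMod p)^2 + (v:ZMod p)^2 ∈ F) = ∑ A ∈ F, sqfib p A := by
    rw [← sqfib_sum, cnt_zmod p (fun u v => u^2+v^2 ∈ F)]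
    congr!
  rw [this']
  push_cast
  rw [← add_sum_erase F _ h0, sum_congr rfl (fun C hC => sqfib_unit p h2 C (ne_of_mem_erase hC)), sum_const,
    card_erase_of_mem h0, hF, sqfib_zero p h2]
  simp only [Nat.add_sub_cancel, nsmul_eq_mul]
  have hp0 : (p:ℝ) ≠ 0 := by exact_mod_cast hp.out.ne_zero
  field_simp
  ring

lemma cnt_dvd (p : ℕ) (hp : p.Prime) (h2 : p ≠ 2) :
    (cnt p (fun u v => p ∣ u^2+v^2) : ℝ) = 1 + (p-1) * (1 + chi p) := by
  classical
  have : Fact p.Prime := ⟨hp⟩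
  rw [← sqfib_zero p h2]
  have : (fun u v : ℕ => p ∣ u^2+v^2) = (fun u v : ℕ => (u:ZMod p)^2 + (v:ZMod p)^2 = 0) := by
    funext u v
    rw [← ZMod.natCast_eq_zero_iff]; push_cast; rfl
  rw [this, cnt_zmod p (fun u v => u^2+v^2 = 0)]
  unfold sqfib
  congr!

lemma per_dvd (p : ℕ) : Per p (fun u v => p ∣ u^2+v^2) := by
  have : (fun u v : ℕ => p ∣ u^2+v^2) = (fun u v : ℕ => (u:ZMod p)^2 + (v:ZMod p)^2 = 0) := by
    funext u v
    rw [← ZMod.natCast_eq_zero_iff]; push_cast; rfl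
  rw [this]
  exact per_zmod p (fun u v => u^2+v^2=0)

lemma per_not {M : ℕ} {B : ℕ → ℕ → Prop} (h : Per M B) : Per M (fun u v => ¬ B u v) := fun u v => not_congr (h u v)

lemma cnt_not (M : ℕ) (B : ℕ → ℕ → Prop) : cnt M B + cnt M (fun u v => ¬ B u v) = M * M := by
  classical
  unfold cnt
  rw [card_filter_add_card_filter_not, card_product, card_range]

lemma cnt_ndvd (p : ℕ) (hp : p.Prime) :
    (cnt p (fun u v => ¬ p ∣ u^2+v^2) : ℝ) = (p-1) * (p - chi p) := by
  by_cases h2 : p = 2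
  · subst h2
    have : cnt 2 (fun u v => ¬ 2 ∣ u^2+v^2) = 2 := by
      classical
      unfold cnt
      rw [show (2:ℕ) = 2 from rfl]
      have : (range 2 ×ˢ range 2).filter (fun x => ¬ 2 ∣ x.1^2+x.2^2) = {(0,1),(1,0)} := by decide
      exact (by congr! : _ = _).trans ((congrArg card this).trans (by decide))
    rw [this]
    simp [chi_cases]; norm_num
  · have h := cnt_not p (fun u v => p ∣ u^2+v^2)
    have h' : (cnt p (fun u v => p ∣ u^2+v^2) : ℝ) + cnt p (fun u v => ¬ p ∣ u^2+v^2) = p * p := by exact_mod_cast h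
    rw [cnt_dvd p hp h2] at h'
    linear_combination h'

lemma cnt_multiple (M k : ℕ) (hM : 0 < M) (B : ℕ → ℕ → Prop) (hB : Per M B) : cnt (M * k) B = k^2 * cnt M B := by
  classical
  have : k^2 * cnt M B = (((range M ×ˢ range M).filter (fun x => B x.1 x.2)) ×ˢ (range k ×ˢ range k)).card := by
    rw [card_product, card_product, card_range]; unfold cnt; ring
  rw [this]
  unfold cnt
  have hu : ∀ r q, (r + M * q) % M = r % M := fun r q => by simp
  apply card_nbij' (fun x => ((x.1 % M, x.2 % M), (x.1 / M, x.2 / M))) (fun x => (x.1.1 + M * x.2.1, x.1.2 + M * x.2.2))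
  · rintro ⟨u, v⟩ hx
    simp only [coe_filter, mem_product, mem_range, Set.mem_ofPred_eq, coe_product, Set.mem_prod, coe_range, Set.mem_Iio] at hx ⊢
    exact ⟨⟨⟨Nat.mod_lt _ hM, Nat.mod_lt _ hM⟩, (hB _ _).2 hx.2⟩, Nat.div_lt_of_lt_mul hx.1.1, Nat.div_lt_of_lt_mul hx.1.2⟩
  · rintro ⟨⟨a, b⟩, ⟨c, d⟩⟩ hx
    simp only [coe_filter, mem_product, mem_range, Set.mem_ofPred_eq, coe_product, Set.mem_prod, coe_range, Set.mem_Iio] at hx ⊢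
    refine ⟨⟨?_, ?_⟩, ?_⟩
    · nlinarith
    · nlinarith
    · rw [← hB, hu, hu, hB]; exact hx.1.2
  · rintro ⟨u, v⟩ hx
    simp only [Nat.mod_add_div]
  · rintro ⟨⟨a, b⟩, ⟨c, d⟩⟩ hx
    simp only [coe_filter, mem_product, mem_range, Set.mem_ofPred_eq, coe_product, Set.mem_prod] at hx
    simp only [Nat.add_mul_mod_self_left, Nat.mod_eq_of_lt hx.1.1.1, Nat.mod_eq_of_lt hx.1.1.2, Nat.add_mul_div_left _ _ hM,
      Nat.div_eq_of_lt hx.1.1.1, Nat.div_eq_of_lt hx.1.1.2, zero_add]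

lemma cnt_unit (N : ℕ) (hN : 0 < N) : (cnt N (fun u v => Nat.Coprime (u^2+v^2) N) : ℝ)
    = (N:ℝ)^2 * ∏ p ∈ N.primeFactors, ((1 - 1/(p:ℝ)) * (1 - chi p / p)) := by
  have hpr : ∀ p ∈ N.primeFactors, p.Prime := fun p hp => Nat.prime_of_mem_primeFactors hp
  have e : (fun u v : ℕ => Nat.Coprime (u^2+v^2) N) = (fun u v => True ∧ ∀ p ∈ N.primeFactors, ¬ p ∣ u^2+v^2) := by
    funext u v
    simp only [true_and, eq_iff_iff]
    constructor
    · intro h p hp hd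
      exact (hpr p hp).one_lt.ne' (Nat.dvd_one.1 (h ▸ Nat.dvd_gcd hd (Nat.dvd_of_mem_primeFactors hp)))
    · intro h
      apply Nat.coprime_of_dvd
      intro p pp h1 h2
      exact h p (Nat.mem_primeFactors.2 ⟨pp, h2, hN.ne'⟩) h1
  rw [e]
  have pp := per_prod (M0 := 1) (B0 := fun _ _ => True) (fun _ _ => Iff.rfl) (fun p u v => ¬ p ∣ u^2+v^2) N.primeFactors (fun p _ => per_not (per_dvd p))
  have cp := cnt_prod (M0 := 1) one_pos (B0 := fun _ _ => True) (fun _ _ => Iff.rfl) (fun p u v => ¬ p ∣ u^2+v^2) N.primeFactors (fun p _ => per_not (per_dvd p)) hpr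
    (fun p _ => Nat.coprime_one_left p)
  have c1 : cnt 1 (fun _ _ => True) = 1 := by simp [cnt]
  obtain ⟨r, hr⟩ := Nat.prod_primeFactors_dvd N
  have hrp : 0 < ∏ p ∈ N.primeFactors, p := prod_pos (fun p hp => (hpr p hp).pos)
  have := cnt_multiple (1 * ∏ p ∈ N.primeFactors, p) r (by omega) _ pp
  rw [cp, c1, one_mul, one_mul, ← hr] at this
  rw [this]
  push_cast
  rw [prod_congr rfl (fun p hp => cnt_ndvd p (hpr p hp))]
  have e2 : ∏ p ∈ N.primeFactors, (((p:ℝ)-1) * (p - chi p)) = (∏ p ∈ N.primeFactors, (p:ℝ))^2 * ∏ p ∈ N.primeFactors, ((1 - 1/(p:ℝ)) * (1 - chi p / p)) := by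
    rw [← prod_pow, ← prod_mul_distrib]
    apply prod_congr rfl
    intro p hp
    have : (p:ℝ) ≠ 0 := by exact_mod_cast (hpr p hp).ne_zero
    field_simp
  rw [e2]
  have e3 : (N:ℝ) = (∏ p ∈ N.primeFactors, (p:ℝ)) * r := by
    have := congrArg (fun n : ℕ => (n:ℝ)) hr
    push_cast at this
    exact this
  conv_rhs => rw [e3]
  ring

lemma gamma_lower (N A : ℕ) (hN : 0 < N) (h4 : 4 ∣ N) (hA : Nat.Coprime A N) (hA4 : A % 4 = 1) :
    (N:ℝ) * ∏ p ∈ N.primeFactors, (1 - chi p / p) ≤ cnt N (fun u v => ((u^2+v^2 : ℕ) : ZMod N) = A) := by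
  classical
  have : NeZero N := ⟨hN.ne'⟩
  have hAu : IsUnit (A : ZMod N) := (ZMod.isUnit_iff_coprime A N).2 hA
  have e1 : cnt N (fun u v => ((u^2+v^2 : ℕ) : ZMod N) = A) = sqfib N A := by
    have : (fun u v : ℕ => ((u^2+v^2 : ℕ) : ZMod N) = A) = (fun u v : ℕ => (u:ZMod N)^2 + (v:ZMod N)^2 = A) := by
      funext u v; push_cast; rfl
    rw [this, cnt_zmod N (fun u v => u^2+v^2 = A)]; unfold sqfib; congr!
  have e2 : cnt N (fun u v => Nat.Coprime (u^2+v^2) N) = (univ.filter (fun x : ZMod N × ZMod N => IsUnit (x.1^2+x.2^2))).card := by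
    have : (fun u v : ℕ => Nat.Coprime (u^2+v^2) N) = (fun u v : ℕ => IsUnit ((u:ZMod N)^2 + (v:ZMod N)^2)) := by
      funext u v; rw [← ZMod.isUnit_iff_coprime]; push_cast; rfl
    rw [this, cnt_zmod N (fun u v => IsUnit (u^2+v^2))]; congr!
  have key : (univ.filter (fun x : ZMod N × ZMod N => IsUnit (x.1^2+x.2^2))).card ≤ sqfib N A * N.totient := by
    have hcard : (univ.map ⟨fun u : (ZMod N)ˣ => (u : ZMod N), Units.val_injective⟩).card = N.totient := by
      rw [card_map, card_univ, ZMod.card_units_eq_totient]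
    rw [← hcard]
    apply card_le_mul_card_image_of_maps_to (f := fun x => x.1^2+x.2^2)
    · intro x hx
      obtain ⟨u, hu⟩ := (mem_filter.1 hx).2
      exact mem_map.2 ⟨u, mem_univ _, hu⟩
    · intro C hC
      have hle : (filter (fun a : ZMod N × ZMod N => a.1^2 + a.2^2 = C) (univ.filter (fun x : ZMod N × ZMod N => IsUnit (x.1^2+x.2^2)))).card ≤ sqfib N C := by
        unfold sqfib
        apply card_le_card
        intro x hx
        simp only [mem_filter, mem_univ, true_and] at hx ⊢
        exact hx.2
      rcases (filter (fun a : ZMod N × ZMod N => a.1^2 + a.2^2 = C) (univ.filter (fun x : ZMod N × ZMod N => IsUnit (x.1^2+x.2^2)))).eq_empty_or_nonempty with h | ⟨⟨u, v⟩, hx⟩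
      · rw [h]; simp
      · refine hle.trans ?_
        simp only [mem_filter, mem_univ, true_and] at hx
        obtain ⟨hu, hC'⟩ := hx
        set n := u.val^2 + v.val^2 with hn
        have hnC : (n : ZMod N) = C := by rw [hn]; push_cast; simp [hC']
        have hCu : IsUnit C := hC' ▸ hu
        have hncop : Nat.Coprime n N := (ZMod.isUnit_iff_coprime n N).1 (hnC ▸ hCu)
        have hnodd : n % 2 = 1 := by
          rw [← Nat.not_even_iff]
          intro he
          have : 2 ∣ Nat.gcd n N := Nat.dvd_gcd he.two_dvd (dvd_trans (by norm_num) h4)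
          rw [hncop] at this; omega
        have hn4 : n % 4 = 1 := by
          have a1 : u.val^2 % 4 = 0 ∨ u.val^2 % 4 = 1 := by
            have : u.val % 4 < 4 := Nat.mod_lt _ (by norm_num)
            rw [Nat.pow_mod]
            interval_cases u.val % 4 <;> simp
          have a2 : v.val^2 % 4 = 0 ∨ v.val^2 % 4 = 1 := by
            have : v.val % 4 < 4 := Nat.mod_lt _ (by norm_num)
            rw [Nat.pow_mod]
            interval_cases v.val % 4 <;> simp
          omega
        obtain ⟨r, hr⟩ := hCu
        have hru : IsUnit ((A : ZMod N) * (r⁻¹ : (ZMod N)ˣ)) := hAu.mul (Units.isUnit _)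
        obtain ⟨l, _, hl, hleq⟩ := Nat.forall_exists_prime_gt_and_eq_mod hru 0
        have hlA : (l : ZMod N) * C = A := by
          rw [hleq, ← hr, mul_assoc, Units.inv_mul, mul_one]
        have hl4 : l % 4 = 1 := by
          have : ((l * n : ℕ) : ZMod N) = ((A : ℕ) : ZMod N) := by push_cast; rw [hnC, hlA]
          rw [ZMod.natCast_eq_natCast_iff] at this
          have := this.of_dvd h4
          rw [Nat.ModEq, Nat.mul_mod, hn4, hA4] at this
          omega
        have : Fact l.Prime := ⟨hl⟩
        obtain ⟨c, d, hcd⟩ := Nat.Prime.sq_add_sq (p := l) (by omega)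
        have hcd' : (c:ZMod N)^2 + (d:ZMod N)^2 = l := by rw [← hcd]; push_cast; rfl
        have := sqfib_mono N C c d (by rw [hcd', hleq]; exact hru)
        rwa [hcd', hlA] at this
  rw [e1]
  rw [← e2] at key
  have key' : (cnt N (fun u v => Nat.Coprime (u^2+v^2) N) : ℝ) ≤ sqfib N A * N.totient := by exact_mod_cast key
  have ht : (N.totient : ℝ) = N * ∏ p ∈ N.primeFactors, (1 - 1/(p:ℝ)) := by
    have := Nat.totient_eq_mul_prod_factors N
    have h' : ((N.totient : ℚ) : ℝ) = ((N * ∏ p ∈ N.primeFactors, (1 - (p : ℚ)⁻¹) : ℚ) : ℝ) := by rw [this]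
    push_cast at h'
    simpa [one_div] using h'
  rw [cnt_unit N hN, prod_mul_distrib] at key'
  have htp : (0:ℝ) < N.totient := by exact_mod_cast Nat.totient_pos.2 hN
  refine le_of_mul_le_mul_right ?_ htp
  refine le_trans (le_of_eq ?_) key'
  rw [ht]; ring


lemma prim_mod4 (n u v p : ℕ) (hn : n = u^2+v^2) (hodd : n % 2 = 1) (hc : Nat.Coprime u v) (hp : p.Prime) (hpn : p ∣ n) : p % 4 = 1 := by
  have h1 := Nat.mod_four_ne_three_of_mem_primeFactors_of_isSquare_neg_one (Nat.mem_primeFactors.2 ⟨hp, hpn, by omega⟩) (ZMod.isSquare_neg_one_of_eq_sq_add_sq_of_coprime hn hc)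
  have h2 : p % 2 = 1 := by
    rcases hp.eq_two_or_odd with rfl | h
    · omega
    · exact h
  omega

lemma prim_ndvd (n u v p : ℕ) (hn : u^2+v^2 = n) (hc : Nat.Coprime u v) (hp : p.Prime) (hpn : p ∣ n) : ¬ p ∣ u ∧ ¬ p ∣ v := by
  have key : ∀ a b : ℕ, a^2+b^2 = n → Nat.Coprime a b → ¬ p ∣ a := by
    intro a b h hab hpa
    have h1 : p ∣ b^2 := by
      rw [← h] at hpn
      exact (Nat.dvd_add_right (dvd_pow hpa (by norm_num))).1 hpn
    have h2 : p ∣ b := hp.dvd_of_dvd_pow h1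
    have := Nat.dvd_gcd hpa h2
    rw [hab] at this
    exact hp.one_lt.ne' (Nat.dvd_one.1 this)
  exact ⟨key u v hn hc, key v u (by rw [add_comm]; exact hn) hc.symm⟩

lemma rep_bound (n : ℕ) (hodd : n % 2 = 1) (S : Finset (ℕ × ℕ))
    (hS : ∀ x ∈ S, 0 < x.1 ∧ 0 < x.2 ∧ Nat.Coprime x.1 x.2 ∧ x.1^2 + x.2^2 = n) :
    S.card ≤ 2 ^ n.primeFactors.card := by
  classical
  rcases S.eq_empty_or_nonempty with rfl | ⟨⟨u0, v0⟩, hx0⟩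
  · simp
  rw [← card_powerset]
  have hn0 : n ≠ 0 := by omega
  apply card_le_card_of_injOn (fun x : ℕ × ℕ => n.primeFactors.filter (fun p : ℕ => (p:ℤ) ∣ (x.1:ℤ) * v0 - u0 * x.2))
  · intro x _
    exact mem_coe.2 (mem_powerset.2 (filter_subset _ _))
  rintro ⟨u, v⟩ hx ⟨u', v'⟩ hx' e
  obtain ⟨_, _, c0, e0⟩ := hS _ hx0
  obtain ⟨pu, pv, c1, e1⟩ := hS _ hx
  obtain ⟨pu', pv', c2, e2⟩ := hS _ hx'
  dsimp only at *
  -- for each prime power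
  have alt : ∀ u v : ℕ, Nat.Coprime u v → u^2+v^2 = n → ∀ p k : ℕ, p.Prime → 0 < k → p^k ∣ n →
      ((p:ℤ) ∣ (u:ℤ) * v0 - u0 * v → ((p:ℤ)^k) ∣ (u:ℤ) * v0 - u0 * v) ∧
      (¬ (p:ℤ) ∣ (u:ℤ) * v0 - u0 * v → ((p:ℤ)^k) ∣ (u:ℤ) * v0 + u0 * v) := by
    intro u v hc huv p k hp hk hpk
    have hpn : p ∣ n := (dvd_pow_self p hk.ne').trans hpk
    have hpi := Nat.prime_iff_prime_int.1 hp
    have hd : ((p:ℤ)^k) ∣ ((u:ℤ) * v0 - u0 * v) * ((u:ℤ) * v0 + u0 * v) := by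
      have h1 : ((n:ℤ)) ∣ ((u:ℤ) * v0 - u0 * v) * ((u:ℤ) * v0 + u0 * v) := by
        refine ⟨(v0:ℤ)^2 - v^2, ?_⟩
        have a1 : (u:ℤ)^2+v^2 = n := by exact_mod_cast huv
        have a2 : (u0:ℤ)^2+v0^2 = n := by exact_mod_cast e0
        linear_combination (v0:ℤ)^2 * a1 - (v:ℤ)^2 * a2
      refine dvd_trans ?_ h1
      exact_mod_cast hpk
    have cop : ∀ X : ℤ, ¬ (p:ℤ) ∣ X → IsCoprime ((p:ℤ)^k) X := by
      intro X hX
      exact IsCoprime.pow_left ((Prime.coprime_iff_not_dvd hpi).2 hX)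
    constructor
    · intro h
      have : ¬ (p:ℤ) ∣ (u:ℤ) * v0 + u0 * v := by
        intro h'
        have h3 : (p:ℤ) ∣ ((2 * u * v0 : ℕ) : ℤ) := by
          have := dvd_add h h'
          have e7 : ((2 * u * v0 : ℕ) : ℤ) = ((u:ℤ) * v0 - u0 * v) + ((u:ℤ) * v0 + u0 * v) := by push_cast; ring
          rw [e7]; exact this
        have h4 : p ∣ 2 * u * v0 := by exact_mod_cast h3
        rcases (Nat.Prime.dvd_mul hp).1 h4 with h5 | h5
        · rcases (Nat.Prime.dvd_mul hp).1 h5 with h6 | h6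
          · have := (Nat.prime_dvd_prime_iff_eq hp Nat.prime_two).1 h6
            subst this; omega
          · exact (prim_ndvd n u v p huv hc hp hpn).1 h6
        · exact (prim_ndvd n u0 v0 p e0 c0 hp hpn).2 h5
      exact (cop _ this).dvd_of_dvd_mul_right hd
    · intro h
      exact (cop _ h).dvd_of_dvd_mul_left hd
  have hdiv : (n:ℤ) ∣ (u:ℤ) * v' - u' * v := by
    rw [← Int.dvd_natAbs, Int.natCast_dvd_natCast, Nat.dvd_iff_prime_pow_dvd_dvd]
    intro p k hp hpk
    rcases Nat.eq_zero_or_pos k with rfl | hk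
    · simp
    rw [← Int.natCast_dvd_natCast, Int.dvd_natAbs]
    push_cast
    have hpn : p ∣ n := (dvd_pow_self p hk.ne').trans hpk
    have b1 := alt u v c1 e1 p k hp hk hpk
    have b2 := alt u' v' c2 e2 p k hp hk hpk
    have hiff : (p:ℤ) ∣ (u:ℤ) * v0 - u0 * v ↔ (p:ℤ) ∣ (u':ℤ) * v0 - u0 * v' := by
      have := congrArg (fun s => p ∈ s) e
      simpa [hp, hpn, hn0] using this
    have hv0 : IsCoprime ((p:ℤ)^k) (v0:ℤ) := by
      apply IsCoprime.pow_left
      rw [Prime.coprime_iff_not_dvd (Nat.prime_iff_prime_int.1 hp)]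
      intro h
      exact (prim_ndvd n u0 v0 p e0 c0 hp hpn).2 (by exact_mod_cast h)
    apply hv0.dvd_of_dvd_mul_left
    by_cases hh : (p:ℤ) ∣ (u:ℤ) * v0 - u0 * v
    · have := dvd_sub ((b1.1 hh).mul_right (v':ℤ)) ((b2.1 (hiff.1 hh)).mul_right (v:ℤ))
      convert this using 1; ring
    · have := dvd_sub ((b1.2 hh).mul_right (v':ℤ)) ((b2.2 (fun h => hh (hiff.2 h))).mul_right (v:ℤ))
      convert this using 1; ring
  have hsq : ((u:ℤ)*u' + v*v')^2 + ((u:ℤ) * v' - u' * v)^2 = (n:ℤ)^2 := by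
    have a1 : (u:ℤ)^2+v^2 = n := by exact_mod_cast e1
    have a2 : (u':ℤ)^2+v'^2 = n := by exact_mod_cast e2
    linear_combination ((u':ℤ)^2+v'^2) * a1 + (n:ℤ) * a2
  have hpos : 0 < (u:ℤ)*u' + v*v' := by positivity
  have hz : (u:ℤ) * v' - u' * v = 0 := by
    apply Int.eq_zero_of_abs_lt_dvd hdiv
    apply abs_lt_of_sq_lt_sq _ (by positivity)
    nlinarith
  have hcross : u * v' = u' * v := by
    have : (u:ℤ) * v' = u' * v := by linarith
    exact_mod_cast this
  have huu : u = u' := by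
    apply Nat.dvd_antisymm
    · exact c1.dvd_of_dvd_mul_right (Dvd.intro _ hcross)
    · exact c2.dvd_of_dvd_mul_right (Dvd.intro _ hcross.symm)
  subst huu
  have : v' = v := Nat.eq_of_mul_eq_mul_left pu hcross
  rw [this]


lemma dvd_count (U Y p : ℕ) (hp : 0 < p) (hpY : p ≤ Y) :
    (((Ico U (U+Y)).filter (fun u => p ∣ u)).card : ℝ) ≤ 2 * ((Y:ℝ) / p) := by
  have h := interval_count U Y p 0 hp hp
  have e : (Ico U (U+Y)).filter (fun u => p ∣ u) = (Ico U (U+Y)).filter (fun u => u % p = 0) := by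
    apply filter_congr; intro u _; exact Nat.dvd_iff_mod_eq_zero
  rw [e]
  have h1 : (1:ℝ) ≤ (Y:ℝ)/p := by
    rw [le_div_iff₀ (by exact_mod_cast hp)]; simpa using (by exact_mod_cast hpY : (p:ℝ) ≤ Y)
  have := (abs_le.1 h).2
  linarith

lemma nonprim_bound (U Y z : ℕ) (hz : 2 ≤ z) (S : Finset (ℕ × ℕ)) (hS : S ⊆ Ico U (U+Y) ×ˢ Ico 1 (1+Y))
    (h : ∀ x ∈ S, ∃ p : ℕ, z < p ∧ p ∣ x.1 ∧ p ∣ x.2) : (S.card : ℝ) ≤ 4 * (Y:ℝ)^2 / z := by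
  classical
  have hsub : S ⊆ (Ioc z Y).biUnion (fun p => ((Ico U (U+Y)).filter (fun u => p ∣ u)) ×ˢ ((Ico 1 (1+Y)).filter (fun u => p ∣ u))) := by
    intro x hx
    obtain ⟨p, hp, h1, h2⟩ := h x hx
    have hb := mem_product.1 (hS hx)
    have hb2 := mem_Ico.1 hb.2
    rw [mem_biUnion]
    refine ⟨p, mem_Ioc.2 ⟨hp, ?_⟩, mem_product.2 ⟨mem_filter.2 ⟨hb.1, h1⟩, mem_filter.2 ⟨hb.2, h2⟩⟩⟩
    have := Nat.le_of_dvd (by omega) h2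
    omega
  have h1 : (S.card : ℝ) ≤ ∑ p ∈ Ioc z Y, 4 * (Y:ℝ)^2 * ((p:ℝ)^2)⁻¹ := by
    calc (S.card : ℝ) ≤ ((∑ p ∈ Ioc z Y, (((Ico U (U+Y)).filter (fun u => p ∣ u)) ×ˢ ((Ico 1 (1+Y)).filter (fun u => p ∣ u))).card : ℕ) : ℝ) := by
          exact_mod_cast (card_le_card hsub).trans card_biUnion_le
      _ = ∑ p ∈ Ioc z Y, (((Ico U (U+Y)).filter (fun u => p ∣ u)).card : ℝ) * (((Ico 1 (1+Y)).filter (fun u => p ∣ u)).card : ℝ) := by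
          push_cast [card_product]; rfl
      _ ≤ _ := by
          apply sum_le_sum
          intro p hp
          rw [mem_Ioc] at hp
          have := mul_le_mul (dvd_count U Y p (by omega) hp.2) (dvd_count 1 Y p (by omega) hp.2) (by positivity) (by positivity)
          refine this.trans (le_of_eq ?_)
          have : (p:ℝ) ≠ 0 := by exact_mod_cast (by omega)
          field_simp; ring
  rw [← mul_sum] at h1
  rcases le_or_gt z Y with hzY | hzY
  · have h2 := sum_Ioc_inv_sq_le_sub (α := ℝ) (k := z) (n := Y) (by omega) hzY
    refine h1.trans ?_
    rw [div_eq_mul_inv]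
    have : (0:ℝ) ≤ ((Y:ℝ))⁻¹ := by positivity
    gcongr
    linarith
  · rw [Ioc_eq_empty (by omega), sum_empty] at h1
    refine h1.trans ?_
    rw [mul_zero]; positivity

set_option maxHeartbeats 2000000 in
open Classical in
lemma core1 (U Y N A z y R E lam : ℕ) (hz : 2 ≤ z) (hzy : z ≤ y) (hN : 0 < N) (hN2 : 2 ∣ N) (hA : Nat.Coprime A N) (hNz : N ≤ z)
    (hU : 1 ≤ U)
    (P : Finset ℕ) (hP : ∀ p, p ∈ P ↔ p.Prime ∧ p ≤ z ∧ ¬ p ∣ N) (Bp : ℕ → ℕ → ℕ → Prop)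
    (hBp : ∀ p ∈ P, Per p (Bp p)) (hBp0 : ∀ p ∈ P, ∀ u v, p ∣ u^2+v^2 → Bp p u v)
    (κ D : ℝ) (hR1 : 1 ≤ R) (hκ : 0 ≤ κ) (hR : 900 * κ ≤ R)
    (g : ℕ → ℝ) (hgd : ∀ p ∈ P, g p = (cnt p (Bp p) : ℝ) / (p:ℝ)^2)
    (hg1 : ∀ p ∈ P, g p ≤ 1/2) (hg : ∀ p ∈ P, g p ≤ κ / p) (hD : D = (z:ℝ)^(4*R+6)) (hY : N * y * D ≤ Y)
    (hE : (U+Y)^2 + (1+Y)^2 ≤ y^E)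
    (X V Lm : ℝ) (hX : X = cnt N (fun u v => ((u^2+v^2:ℕ):ZMod N) = A) * ((Y:ℝ)/N)^2) (hV : V = ∏ p ∈ P, (1 - g p))
    (hLm : Lm = ∑ p ∈ (Ioc z y).filter (fun p => p.Prime ∧ p % 4 = 1), (2:ℝ)/p) :
    0.99 * X * V - 3 * Y * N * D^3 - 4 * (Y:ℝ)^2/z - (1.01 * X * V * Lm + 3 * Y * N * y^2 * D^3)/(lam+1) ≤
      2^(lam+E) * ((((Ico U (U+Y) ×ˢ Ico 1 (1+Y)).filter (fun x => ((x.1^2+x.2^2:ℕ):ZMod N) = A ∧ ∀ p ∈ P, ¬ Bp p x.1 x.2)).image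
        (fun x => x.1^2+x.2^2)).card : ℝ) := by
  set B0 : ℕ → ℕ → Prop := fun u v => ((u^2+v^2:ℕ):ZMod N) = A with hB0
  set Good := ((Ico U (U+Y) ×ˢ Ico 1 (1+Y)).filter (fun x => B0 x.1 x.2 ∧ ∀ p ∈ P, ¬ Bp p x.1 x.2)) with hGood
  have hD1 : 1 ≤ D := by
    rw [hD]; apply one_le_pow₀; exact_mod_cast (by omega)
  have hPer : Per N B0 := by
    have := per_zmod N (fun u v => u^2+v^2 = (A:ZMod N))
    intro u v
    have h := this u v
    simp only [hB0]; push_cast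
    exact h
  have hy1 : (1:ℝ) ≤ y := by exact_mod_cast (by omega)
  have hX0 : 0 ≤ X := by rw [hX]; positivity
  have hV0 : 0 ≤ V := by
    rw [hV]; apply prod_nonneg; intro p hp; have := hg1 p hp; linarith
  have h1 := sieve2 U 1 Y N z hz hN P (fun p hp => ⟨((hP p).1 hp).1, ((hP p).1 hp).2.1⟩)
    (fun p hp => ((Nat.Prime.coprime_iff_not_dvd ((hP p).1 hp).1).2 ((hP p).1 hp).2.2).symm)
    B0 hPer Bp hBp κ D R hR1 hκ hR g hgd hg1 hg hD (by
      refine le_trans ?_ hY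
      have : (N:ℝ) * 1 ≤ N * y := by gcongr
      nlinarith)
  rw [← hX, ← hV] at h1
  have h1' := (abs_le.1 h1).1
  have hcop : ∀ x ∈ Good, Nat.Coprime (x.1^2+x.2^2) N := by
    intro x hx
    have hx' := (mem_filter.1 hx).2.1
    have : (x.1^2+x.2^2) ≡ A [MOD N] := (ZMod.natCast_eq_natCast_iff _ _ _).1 hx'
    rw [Nat.Coprime, this.gcd_eq]; exact hA
  have hbig : ∀ x ∈ Good, ∀ p : ℕ, p.Prime → p ∣ x.1^2+x.2^2 → z < p := by
    intro x hx p hp hpn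
    by_contra hpz
    have hpN : ¬ p ∣ N := by
      intro h
      have := Nat.dvd_gcd hpn h
      rw [hcop x hx] at this
      exact hp.one_lt.ne' (Nat.dvd_one.1 this)
    have hpP : p ∈ P := (hP p).2 ⟨hp, by omega, hpN⟩
    exact (mem_filter.1 hx).2.2 p hpP (hBp0 p hpP _ _ hpn)
  have h2 := nonprim_bound U Y z hz (Good.filter (fun x => ¬ Nat.Coprime x.1 x.2))
    ((filter_subset _ _).trans (filter_subset _ _)) (by
      intro x hx
      obtain ⟨hx1, hx2⟩ := mem_filter.1 hx
      obtain ⟨p, hp, hpu, hpv⟩ := Nat.Prime.not_coprime_iff_dvd.1 hx2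
      exact ⟨p, hbig x hx1 p hp (dvd_add (dvd_pow hpu (by norm_num)) (dvd_pow hpv (by norm_num))), hpu, hpv⟩)
  set Q := (Ioc z y).filter (fun p => p.Prime ∧ p % 4 = 1) with hQ
  set om : ℕ × ℕ → ℕ := fun x => (Q.filter (fun p => p ∣ x.1^2+x.2^2)).card with hom
  have h3 : ((Good.filter (fun x => lam < om x)).card : ℝ) * (lam + 1) ≤ 1.01 * X * V * Lm + 3 * Y * N * y^2 * D^3 := by
    have a1 : ((Good.filter (fun x => lam < om x)).card : ℝ) * (lam + 1) ≤ ∑ x ∈ Good, (om x : ℝ) := by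
      calc _ = ∑ x ∈ Good.filter (fun x => lam < om x), ((lam:ℝ)+1) := by rw [sum_const, nsmul_eq_mul]
        _ ≤ ∑ x ∈ Good.filter (fun x => lam < om x), (om x : ℝ) := by
          apply sum_le_sum; intro x hx
          exact_mod_cast (mem_filter.1 hx).2
        _ ≤ _ := sum_le_sum_of_subset_of_nonneg (filter_subset _ _) (fun _ _ _ => by positivity)
    have a2 : ∑ x ∈ Good, (om x : ℝ) = ∑ p ∈ Q, ((Good.filter (fun x => p ∣ x.1^2+x.2^2)).card : ℝ) := by
      simp only [hom, card_filter]
      push_cast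
      rw [sum_comm]
    have a3 : ∀ p ∈ Q, ((Good.filter (fun x => p ∣ x.1^2+x.2^2)).card : ℝ) ≤ 1.01 * X * V * (2/p) + 3 * Y * N * y * D^3 := by
      intro p hp
      obtain ⟨hp1, hpp, hp4⟩ := mem_filter.1 hp
      rw [mem_Ioc] at hp1
      have hpN : Nat.Coprime N p := by
        apply Nat.Coprime.symm
        rw [Nat.Prime.coprime_iff_not_dvd hpp]
        intro h; have := Nat.le_of_dvd hN h; omega
      have hcm := cnt_mul hN hpp.pos hpN hPer (per_dvd p)
      have hpd := cnt_dvd p hpp (by omega)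
      have hchi : chi p = 1 := by rw [chi_cases, if_neg (by omega), if_pos hp4]
      have hs := sieve2 U 1 Y (N*p) z hz (Nat.mul_pos hN hpp.pos) P (fun p hp => ⟨((hP p).1 hp).1, ((hP p).1 hp).2.1⟩)
        (fun q hq => by
          have hq' := (hP q).1 hq
          apply Nat.Coprime.mul_left
          · exact ((Nat.Prime.coprime_iff_not_dvd hq'.1).2 hq'.2.2).symm
          · exact (Nat.coprime_primes hpp hq'.1).2 (by omega))
        (fun u v => B0 u v ∧ p ∣ u^2+v^2) ((hPer.of_dvd (dvd_mul_right _ _)).and ((per_dvd p).of_dvd (dvd_mul_left _ _)))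
        Bp hBp κ D R hR1 hκ hR g hgd hg1 hg hD (by
          refine le_trans ?_ hY
          push_cast
          gcongr
          exact_mod_cast hp1.2)
      rw [hcm, ← hV] at hs
      have hs' := (abs_le.1 hs).2
      have hpr : (0:ℝ) < p := by exact_mod_cast hpp.pos
      have hXX : ((cnt N B0 * cnt p (fun u v => p ∣ u^2+v^2) : ℕ):ℝ) * ((Y:ℝ)/((N*p:ℕ):ℝ))^2 ≤ X * (2/p) := by
        push_cast
        rw [hpd, hchi, hX]
        have hNr : (0:ℝ) < N := by exact_mod_cast hN
        have : (cnt N B0:ℝ) * (1 + ((p:ℝ)-1)*(1+1)) * ((Y:ℝ)/(N*p))^2 = (cnt N B0 * ((Y:ℝ)/N)^2) * ((2*p-1)/p^2) := by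
          field_simp; ring
        rw [this]
        gcongr ?_ * ?_
        rw [div_le_div_iff₀ (by positivity) (by positivity)]
        nlinarith
      have hcard : (Good.filter (fun x => p ∣ x.1^2+x.2^2)) = ((Ico U (U+Y) ×ˢ Ico 1 (1+Y)).filter (fun x => (B0 x.1 x.2 ∧ p ∣ x.1^2+x.2^2) ∧ ∀ p ∈ P, ¬ Bp p x.1 x.2)) := by
        rw [hGood, filter_filter]
        apply filter_congr; intro x _; tauto
      rw [hcard]
      have e5 : ((N*p:ℕ):ℝ) ≤ N * y := by
        push_cast; gcongr; exact_mod_cast hp1.2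
      have e6 : 3 * (Y:ℝ) * ((N*p:ℕ):ℝ) * D^3 ≤ 3 * Y * (N * y) * D^3 := by gcongr
      have e7 := mul_le_mul_of_nonneg_right hXX hV0
      have e8 : 3 * (Y:ℝ) * (N * y) * D^3 = 3 * Y * N * y * D^3 := by ring
      have e9 : 1.01 * X * V * (2/p) = 1.01 * (X * (2/p) * V) := by ring
      rw [e9]
      rw [e8] at e6
      refine le_trans ?_ ((sub_le_iff_le_add'.1 hs').trans (by linarith))
      apply le_of_eq
      congr!
    have a4 : (Q.card : ℝ) ≤ y := by
      have : Q.card ≤ y := by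
        calc Q.card ≤ (Ioc z y).card := card_filter_le _ _
          _ = y - z := by simp
          _ ≤ y := by omega
      exact_mod_cast this
    calc _ ≤ _ := a1
      _ = _ := a2
      _ ≤ ∑ p ∈ Q, (1.01 * X * V * (2/p) + 3 * Y * N * y * D^3) := sum_le_sum a3
      _ = 1.01 * X * V * Lm + Q.card * (3 * Y * N * y * D^3) := by
        rw [sum_add_distrib, ← mul_sum, ← hLm, sum_const, nsmul_eq_mul]
      _ ≤ 1.01 * X * V * Lm + y * (3 * Y * N * y * D^3) := by gcongr
      _ = _ := by ring
  set G := Good.filter (fun x => Nat.Coprime x.1 x.2 ∧ om x ≤ lam) with hG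
  have h4 : (Good.card : ℝ) ≤ G.card + (Good.filter (fun x => ¬ Nat.Coprime x.1 x.2)).card + (Good.filter (fun x => lam < om x)).card := by
    have : Good ⊆ (G ∪ Good.filter (fun x => ¬ Nat.Coprime x.1 x.2)) ∪ Good.filter (fun x => lam < om x) := by
      intro x hx
      simp only [hG, mem_union, mem_filter, hx, true_and]
      by_cases hc : Nat.Coprime x.1 x.2
      · by_cases hl : om x ≤ lam
        · exact Or.inl (Or.inl ⟨hc, hl⟩)
        · exact Or.inr (by omega)
      · exact Or.inl (Or.inr hc)
    have h := (card_le_card this).trans ((card_union_le _ _).trans (add_le_add_left (card_union_le _ _) _))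
    exact_mod_cast h
  have h5 : G.card ≤ 2^(lam+E) * (G.image (fun x => x.1^2+x.2^2)).card := by
    apply card_le_mul_card_image
    intro n hn
    obtain ⟨x0, hx0, hxn⟩ := mem_image.1 hn
    have hx0g := (mem_filter.1 hx0).1
    have hnlt : n < y^E := by
      have hb := mem_product.1 (mem_filter.1 hx0g).1
      have b1 := (mem_Ico.1 hb.1).2
      have b2 := (mem_Ico.1 hb.2).2
      have c1 : x0.1^2 < (U+Y)^2 := Nat.pow_lt_pow_left b1 (by norm_num)
      have c2 : x0.2^2 < (1+Y)^2 := Nat.pow_lt_pow_left b2 (by norm_num)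
      omega
    have hodd : n % 2 = 1 := by
      have h := hcop x0 hx0g
      rw [hxn] at h
      have h2 := Nat.Coprime.coprime_dvd_right hN2 h
      exact Nat.odd_iff.1 (Nat.coprime_two_right.1 h2)
    have hr := rep_bound n hodd (G.filter (fun x => x.1^2+x.2^2 = n)) (by
      intro x hx
      obtain ⟨hx1, hx2⟩ := mem_filter.1 hx
      obtain ⟨hx3, hx4, _⟩ := mem_filter.1 hx1
      have hb := mem_product.1 (mem_filter.1 hx3).1
      have b1 := (mem_Ico.1 hb.1).1
      have b2 := (mem_Ico.1 hb.2).1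
      exact ⟨by omega, by omega, hx4, hx2⟩)
    refine hr.trans (Nat.pow_le_pow_right (by norm_num) ?_)
    have hn0 : n ≠ 0 := by omega
    have hsub : n.primeFactors ⊆ (Q.filter (fun p => p ∣ x0.1^2+x0.2^2)) ∪ n.primeFactors.filter (fun p => y < p) := by
      intro p hp
      have hpp := Nat.prime_of_mem_primeFactors hp
      have hpd := Nat.dvd_of_mem_primeFactors hp
      rw [mem_union]
      by_cases hy : y < p
      · exact Or.inr (mem_filter.2 ⟨hp, hy⟩)
      · left
        have h4 := prim_mod4 n x0.1 x0.2 p hxn.symm hodd (mem_filter.1 hx0).2.1 hpp hpd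
        have hzp := hbig x0 hx0g p hpp (by rw [hxn]; exact hpd)
        refine mem_filter.2 ⟨mem_filter.2 ⟨mem_Ioc.2 ⟨hzp, by omega⟩, hpp, h4⟩, by rw [hxn]; exact hpd⟩
    have hE2 : (n.primeFactors.filter (fun p => y < p)).card ≤ E := by
      have : y ^ (n.primeFactors.filter (fun p => y < p)).card ≤ n := by
        calc y ^ (n.primeFactors.filter (fun p => y < p)).card = ∏ p ∈ n.primeFactors.filter (fun p => y < p), y := by rw [prod_const]
          _ ≤ ∏ p ∈ n.primeFactors.filter (fun p => y < p), p := by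
            apply prod_le_prod'
            intro p hp; exact (mem_filter.1 hp).2.le
          _ ≤ n := by
            apply Nat.le_of_dvd (by omega)
            exact (prod_dvd_prod_of_subset _ _ (fun p => p) (filter_subset _ _)).trans (Nat.prod_primeFactors_dvd n)
      exact ((Nat.pow_lt_pow_iff_right (by omega)).1 (this.trans_lt hnlt)).le
    calc n.primeFactors.card ≤ _ := card_le_card hsub
      _ ≤ _ := card_union_le _ _
      _ ≤ _ := add_le_add (mem_filter.1 hx0).2.2 hE2
  have h6 : (G.card:ℝ) ≤ 2^(lam+E) * ((Good.image (fun x => x.1^2+x.2^2)).card : ℝ) := by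
    have : G.card ≤ 2^(lam+E) * (Good.image (fun x => x.1^2+x.2^2)).card :=
      h5.trans (Nat.mul_le_mul_left _ (card_le_card (image_subset_image (filter_subset _ _))))
    exact_mod_cast this
  have h3' : ((Good.filter (fun x => lam < om x)).card : ℝ) ≤ (1.01 * X * V * Lm + 3 * Y * N * y^2 * D^3)/(lam+1) := by
    rw [le_div_iff₀ (by positivity)]; exact h3
  refine le_trans ?_ h6
  have h7 : 0.99 * X * V - 3 * Y * N * D^3 ≤ (Good.card : ℝ) := by
    have h8 : X * V - (X * V / 100 + 3 * Y * N * D^3) = 0.99 * X * V - 3 * Y * N * D^3 := by ring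
    rw [← h8]
    have h9 := neg_le_sub_iff_le_add.1 h1'
    refine le_trans (sub_le_iff_le_add.2 h9) ?_
    apply le_of_eq
    rw [hGood]
    congr!
  linarith


lemma one_sub_exp (x : ℝ) (hx : |x| ≤ 1/2) : Real.exp (-x - 2*x^2) ≤ 1 - x := by
  have h := Real.abs_log_sub_add_sum_range_le (x := x) (by linarith) 1
  simp at h
  have hx1 : x ≤ 1/2 := (abs_le.1 hx).2
  have h2 : x^2/(1-|x|) ≤ 2 * x^2 := by
    rw [div_le_iff₀ (by linarith)]; nlinarith [sq_nonneg x]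
  rw [← Real.le_log_iff_exp_le (by linarith)]
  have := (abs_le.1 h).1
  linarith

lemma chi_prod_lower : ∃ c1 : ℝ, 0 < c1 ∧ ∀ z : ℕ, c1 ≤ ∏ p ∈ (range (z+1)).filter Nat.Prime, (1 - chi p / p) := by
  obtain ⟨C, hC, h⟩ := chi_prime_bound
  refine ⟨Real.exp (-(C + 4)), Real.exp_pos _, fun z => ?_⟩
  have e : (range (z+1)).filter Nat.Prime = (Ioc 1 z).filter Nat.Prime := by
    ext p; simp only [mem_filter, mem_range, mem_Ioc]
    constructor
    · rintro ⟨h1, h2⟩; exact ⟨⟨h2.one_lt, by omega⟩, h2⟩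
    · rintro ⟨h1, h2⟩; exact ⟨by omega, h2⟩
  rw [e]
  calc Real.exp (-(C+4)) ≤ Real.exp (∑ p ∈ (Ioc 1 z).filter Nat.Prime, (-(chi p / p) - 2 * (chi p / p)^2)) := by
        apply Real.exp_le_exp.2
        rw [sum_sub_distrib, sum_neg_distrib, ← mul_sum]
        have h1 := (abs_le.1 (h 1 z le_rfl)).2
        have h2 : ∑ p ∈ (Ioc 1 z).filter Nat.Prime, (chi p / p)^2 ≤ 1 := by
          calc _ ≤ ∑ p ∈ (Ioc 1 z).filter Nat.Prime, ((p:ℝ)^2)⁻¹ := by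
                apply sum_le_sum; intro p hp
                rw [div_pow, div_eq_mul_inv]
                have := abs_chi_le p
                have : chi p ^2 ≤ 1 := by rw [sq_le_one_iff_abs_le_one]; exact this
                have h0 : (0:ℝ) ≤ ((p:ℝ)^2)⁻¹ := by positivity
                nlinarith
            _ ≤ ∑ p ∈ Ioc 1 z, ((p:ℝ)^2)⁻¹ := sum_le_sum_of_subset_of_nonneg (filter_subset _ _) (fun _ _ _ => by positivity)
            _ ≤ 1 := by
                rcases le_or_gt 1 z with hz | hz
                · have := sum_Ioc_inv_sq_le_sub (α := ℝ) (k := 1) (n := z) (by norm_num) hz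
                  have h0 : (0:ℝ) ≤ ((z:ℝ))⁻¹ := by positivity
                  norm_num at this ⊢
                  linarith
                · rw [Ioc_eq_empty (by omega)]; simp
        linarith
    _ = ∏ p ∈ (Ioc 1 z).filter Nat.Prime, Real.exp (-(chi p / p) - 2 * (chi p / p)^2) := Real.exp_sum _ _
    _ ≤ _ := by
        apply prod_le_prod
        · intro p _; positivity
        · intro p hp
          apply one_sub_exp
          have hp2 : 2 ≤ p := by have := (mem_Ioc.1 (mem_filter.1 hp).1).1; omega
          rw [abs_div, Nat.abs_cast]
          rw [div_le_div_iff₀ (by exact_mod_cast (by omega)) (by norm_num)]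
          have := abs_chi_le p
          have : (2:ℝ) ≤ p := by exact_mod_cast hp2
          linarith

def Lf (a2 W j t : ℕ) : ℕ := a2 + 4*W*j*(1+a2*t)
def PS (B z : ℕ) : Finset ℕ := (range (z+1)).filter (fun p => p.Prime ∧ ¬ p ∣ B)
def Sf (a2 W k z t : ℕ) : Prop := ∀ p ∈ PS (4*W*a2) z, ¬ p ∣ (1+a2*t) ∧ ∀ j ∈ Icc 1 k, ¬ p ∣ Lf a2 W j t

def Bad (a2 k j p u v : ℕ) : Prop :=
  ((u^2+v^2:ℕ):ZMod p) = a2 ∨ ∃ i ∈ Icc 1 k, (i:ZMod p)*((u^2+v^2:ℕ):ZMod p) = ((i:ZMod p)-j)*a2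

lemma per_bad (a2 k j p : ℕ) : Per p (Bad a2 k j p) := by
  have := per_zmod p (fun u v => u^2+v^2 = (a2 : ZMod p) ∨ ∃ i ∈ Icc 1 k, (i:ZMod p)*(u^2+v^2) = ((i:ZMod p)-j)*a2)
  intro u v
  have h := this u v
  unfold Bad; push_cast
  exact h

lemma cnt_bad (a2 k j p : ℕ) (hp : p.Prime) (hpk : 2*k+4 < p) (ha : ¬ p ∣ a2) (hj : 1 ≤ j) (hjk : j ≤ k) :
    (cnt p (Bad a2 k j p) : ℝ) / (p:ℝ)^2 = 1-(1-((k:ℝ)+1)/p)*(1-chi p/p) := by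
  classical
  have : Fact p.Prime := ⟨hp⟩
  have ha' : (a2 : ZMod p) ≠ 0 := by rwa [Ne, ZMod.natCast_eq_zero_iff]
  have hi : ∀ i ∈ Icc 1 k, (i : ZMod p) ≠ 0 := by
    intro i hi h
    rw [mem_Icc] at hi
    rw [ZMod.natCast_eq_zero_iff] at h
    have := Nat.le_of_dvd (by omega) h
    omega
  have hj0 : (j : ZMod p) ≠ 0 := hi j (mem_Icc.2 ⟨hj, hjk⟩)
  set F : Finset (ZMod p) := insert (a2 : ZMod p) ((Icc 1 k).image (fun i : ℕ => ((i:ZMod p)-j)*a2/i)) with hF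
  have h0 : (0 : ZMod p) ∈ F := by
    rw [hF, mem_insert]; right
    rw [mem_image]; exact ⟨j, mem_Icc.2 ⟨hj, hjk⟩, by simp⟩
  have hcard : F.card = k + 1 := by
    rw [hF, card_insert_of_notMem, card_image_of_injOn]
    · simp
    · intro i1 h1 i2 h2 e
      have n1 := hi i1 (mem_coe.1 h1)
      have n2 := hi i2 (mem_coe.1 h2)
      dsimp only at e
      rw [div_eq_div_iff n1 n2] at e
      have e2 : (j : ZMod p) * a2 * ((i1 : ZMod p) - i2) = 0 := by linear_combination e
      have e3 : ((i1 : ZMod p) - i2) = 0 := by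
        rcases mul_eq_zero.1 e2 with h | h
        · exact absurd h (mul_ne_zero hj0 ha')
        · exact h
      have e4 := (ZMod.natCast_eq_natCast_iff _ _ _).1 (sub_eq_zero.1 e3)
      have c1 := mem_Icc.1 (mem_coe.1 h1)
      have c2 := mem_Icc.1 (mem_coe.1 h2)
      rwa [Nat.ModEq, Nat.mod_eq_of_lt (by omega), Nat.mod_eq_of_lt (by omega)] at e4
    · rw [mem_image]
      rintro ⟨i, hi1, e⟩
      rw [div_eq_iff (hi i hi1)] at e
      have : (j : ZMod p) * a2 = 0 := by linear_combination -e
      exact mul_ne_zero hj0 ha' this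
  have h := cnt_F p k (by omega) F h0 hcard
  rw [← h]
  congr 3
  funext u v
  apply propext
  unfold Bad
  rw [hF, mem_insert, mem_image]
  push_cast
  apply or_congr Iff.rfl
  apply exists_congr; intro i
  apply and_congr_right; intro hi1
  rw [div_eq_iff (hi i hi1)]
  constructor <;> (intro h; linear_combination -h)

lemma g_bounds (k p : ℕ) (hpk : 2*k+4 < p) :
    1-(1-((k:ℝ)+1)/p)*(1-chi p/p) ≤ ((k:ℝ)+2)/p ∧ 1-(1-((k:ℝ)+1)/p)*(1-chi p/p) ≤ 1/2 := by
  have hp0 : (0:ℝ) < p := by exact_mod_cast (by omega)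
  have hpk' : 2*(k:ℝ)+4 < p := by exact_mod_cast hpk
  have h1 : 1-(1-((k:ℝ)+1)/p)*(1-chi p/p) ≤ ((k:ℝ)+2)/p := by
    have hc := abs_le.1 (abs_chi_le p)
    have e : ((k:ℝ)+2)/p - (1-(1-((k:ℝ)+1)/p)*(1-chi p/p)) = (1 - chi p)/p + ((k:ℝ)+1) * chi p/p^2 := by
      field_simp; ring
    have e2 : (1 - chi p)/p + ((k:ℝ)+1) * chi p/p^2 = ((1 - chi p) * p + (k+1) * chi p) / p^2 := by
      field_simp
    have : 0 ≤ ((1 - chi p) * p + (k+1) * chi p) / (p:ℝ)^2 := by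
      apply div_nonneg _ (by positivity)
      have hk : (0:ℝ) ≤ k := by positivity
      nlinarith
    linarith
  refine ⟨h1, h1.trans ?_⟩
  rw [div_le_div_iff₀ hp0 (by norm_num)]
  linarith

set_option maxHeartbeats 1000000 in
open Classical in
lemma core2 (a2 W k j U Y z y E lam t1 T : ℕ) (D c1 : ℝ) (ha4 : a2 % 4 = 1) (hW0 : 0 < W) (hcop : Nat.Coprime a2 W)
    (hW : ∀ p : ℕ, p.Prime → p ≤ 2*k+4 → p ∣ W) (hj : 1 ≤ j) (hjk : j ≤ k)
    (hz : 2 ≤ z) (hzy : z ≤ y) (hNz : j*(4*W*a2) ≤ z) (hU : 1 ≤ U)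
    (hD : D = (z:ℝ)^(4*(900*(k+2))+6)) (hY : ((j*(4*W*a2):ℕ):ℝ) * y * D ≤ Y)
    (hE : (U+Y)^2 + (1+Y)^2 ≤ y^E)
    (hUL : Lf a2 W j t1 ≤ U^2) (hUR : (U+Y)^2 + (1+Y)^2 ≤ Lf a2 W j (t1+T))
    (hc0 : 0 < c1) (hc1 : c1 ≤ ∏ p ∈ (range (z+1)).filter Nat.Prime, (1 - chi p / p))
    (hlam : 1.1 * (∑ p ∈ (Ioc z y).filter (fun p => p.Prime ∧ p % 4 = 1), (2:ℝ)/p) ≤ lam + 1)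
    (V1 : ℝ) (hV1 : V1 = ∏ p ∈ PS (4*W*a2) z, (1 - ((k:ℝ)+1)/p))
    (herr : 6 * Y * ((j*(4*W*a2):ℕ):ℝ) * y^2 * D^3 + 4 * (Y:ℝ)^2/z ≤ 0.01 * (c1 * Y^2 * V1 / ((j*(4*W*a2):ℕ):ℝ))) :
    0.05 * (c1 * Y^2 * V1 / ((j*(4*W*a2):ℕ):ℝ)) ≤
      2^(lam+E) * (((Ico t1 (t1+T)).filter (fun t => Sf a2 W k z t ∧ IsSumTwoSquares (Lf a2 W j t))).card : ℝ) := by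
  set N := j*(4*W*a2) with hN
  have ha0 : 0 < a2 := by omega
  have hN0 : 0 < N := by positivity
  set A := a2 + 4*W*j with hA
  set P := PS (4*W*a2) z with hP
  have hLf : ∀ t, Lf a2 W j t = A + N * t := by intro t; rw [Lf, hA, hN]; ring
  have hNp : ∀ p : ℕ, p.Prime → (p ∣ N ↔ p ∣ 4*W*a2) := by
    intro p hp
    constructor
    · intro h
      rcases (Nat.Prime.dvd_mul hp).1 h with h | h
      · have := hW p hp (by have := Nat.le_of_dvd (by omega) h; omega)
        exact (this.mul_left 4).mul_right a2
      · exact h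
    · intro h; exact h.mul_left j
  have hPm : ∀ p, p ∈ P ↔ p.Prime ∧ p ≤ z ∧ ¬ p ∣ N := by
    intro p
    rw [hP, PS, mem_filter, mem_range]
    constructor
    · rintro ⟨h1, h2, h3⟩; exact ⟨h2, by omega, by rwa [hNp p h2]⟩
    · rintro ⟨h1, h2, h3⟩; exact ⟨by omega, h1, by rwa [← hNp p h1]⟩
  have hPbig : ∀ p ∈ P, 2*k+4 < p ∧ ¬ p ∣ a2 ∧ ¬ p ∣ W ∧ p.Prime ∧ ¬ p ∣ j := by
    intro p hp
    obtain ⟨h1, h2, h3⟩ := (hPm p).1 hp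
    rw [hNp p h1] at h3
    have h4 : ¬ p ∣ W := fun h => h3 ((h.mul_left 4).mul_right a2)
    have h5 : 2*k+4 < p := by
      by_contra h; exact h4 (hW p h1 (by omega))
    exact ⟨h5, fun h => h3 (h.mul_left _), h4, h1, fun h => by have := Nat.le_of_dvd (by omega) h; omega⟩
  have hAN : Nat.Coprime A N := by
    apply Nat.Coprime.symm
    rw [Nat.Coprime, Nat.coprime_iff_gcd_eq_one.symm]
    by_contra hnc
    obtain ⟨p, hp, h1, h2⟩ := Nat.Prime.not_coprime_iff_dvd.1 hnc
    have h3 : p ∣ 4*W*j → p ∣ W := by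
      intro h
      rcases (Nat.Prime.dvd_mul hp).1 h with h | h
      · rcases (Nat.Prime.dvd_mul hp).1 h with h | h
        · have : p ∣ 2 := hp.dvd_of_dvd_pow (n := 2) (by simpa using h)
          have := Nat.le_of_dvd (by norm_num) this
          exact hW p hp (by omega)
        · exact h
      · exact hW p hp (by have := Nat.le_of_dvd (by omega) h; omega)
    have h4 : p ∣ W ∨ p ∣ a2 := by
      rcases (Nat.Prime.dvd_mul hp).1 ((hNp p hp).1 h1) with h | h
      · left; exact h3 (h.mul_right j)
      · right; exact h
    have hcontra : p ∣ W → p ∣ a2 → False := by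
      intro h5 h6
      have := Nat.dvd_gcd h6 h5
      rw [hcop] at this
      exact hp.one_lt.ne' (Nat.dvd_one.1 this)
    rcases h4 with h5 | h5
    · apply hcontra h5
      exact (Nat.dvd_add_left ((h5.mul_left 4).mul_right j)).1 h2
    · exact hcontra (h3 ((Nat.dvd_add_right h5).1 h2)) h5
  have h4N : 4 ∣ N := ⟨j*(W*a2), by rw [hN]; ring⟩
  set g : ℕ → ℝ := fun p => 1-(1-((k:ℝ)+1)/p)*(1-chi p/p) with hg
  set X : ℝ := cnt N (fun u v => ((u^2+v^2:ℕ):ZMod N) = A) * ((Y:ℝ)/N)^2 with hX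
  set V : ℝ := ∏ p ∈ P, (1 - g p) with hV
  have main := core1 U Y N A z y (900*(k+2)) E lam hz hzy hN0 (dvd_trans (by norm_num) h4N) hAN hNz hU P hPm (Bad a2 k j)
    (fun p _ => per_bad a2 k j p) (by
      intro p hp u v h
      right
      refine ⟨j, mem_Icc.2 ⟨hj, hjk⟩, ?_⟩
      rw [(ZMod.natCast_eq_zero_iff _ _).2 h]; simp) ((k:ℝ)+2) D (by omega) (by positivity) (by push_cast; linarith)
    g (by
      intro p hp
      obtain ⟨b1, b2, b3, b4, _⟩ := hPbig p hp
      exact (cnt_bad a2 k j p b4 b1 b2 hj hjk).symm)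
    (fun p hp => (g_bounds k p (hPbig p hp).1).2) (fun p hp => (g_bounds k p (hPbig p hp).1).1) hD hY hE X V _ hX hV rfl
  have hNr : (0:ℝ) < N := by exact_mod_cast hN0
  have hV10 : 0 ≤ V1 := by
    rw [hV1]; apply prod_nonneg; intro p hp
    have hb : 2*(k:ℝ)+4 < p := by exact_mod_cast (hPbig p hp).1
    have : ((k:ℝ)+1)/p ≤ 1 := by
      rw [div_le_one (by linarith)]; linarith
    linarith
  have hpr : c1 ≤ (∏ p ∈ N.primeFactors, (1 - chi p / p)) * ∏ p ∈ P, (1 - chi p / p) := by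
    refine hc1.trans (le_of_eq ?_)
    rw [← prod_union]
    · apply prod_congr _ (fun _ _ => rfl)
      ext p
      simp only [mem_filter, mem_range, mem_union, Nat.mem_primeFactors, hPm]
      constructor
      · rintro ⟨h1, h2⟩
        by_cases h : p ∣ N
        · exact Or.inl ⟨h2, h, hN0.ne'⟩
        · exact Or.inr ⟨h2, by omega, h⟩
      · rintro (⟨h1, h2, _⟩ | ⟨h1, h2, _⟩)
        · exact ⟨by have := Nat.le_of_dvd hN0 h2; omega, h1⟩
        · exact ⟨by omega, h1⟩
    · rw [disjoint_left]
      intro p h1 h2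
      exact ((hPm p).1 h2).2.2 (Nat.dvd_of_mem_primeFactors h1)
  have hXV : c1 * Y^2 * V1 / N ≤ X * V := by
    have hgl := gamma_lower N A hN0 h4N hAN (by rw [hA]; have : 4*W*j = 4*(W*j) := by ring
                                                omega)
    have e1 : V = V1 * ∏ p ∈ P, (1 - chi p / p) := by
      rw [hV1, hV, ← prod_mul_distrib]
      apply prod_congr rfl; intro p _; simp only [hg]; ring
    have hchi0 : 0 ≤ ∏ p ∈ P, (1 - chi p / p) := by
      apply prod_nonneg; intro p hp
      have := (abs_le.1 (abs_chi_le p)).2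
      have h2 : chi p / p ≤ 1 := by
        apply div_le_one_of_le₀ _ (by positivity)
        have : (1:ℝ) ≤ p := by exact_mod_cast (hPbig p hp).2.2.2.1.one_lt.le
        linarith
      linarith
    calc c1 * Y^2 * V1 / N ≤ ((∏ p ∈ N.primeFactors, (1 - chi p / p)) * ∏ p ∈ P, (1 - chi p / p)) * Y^2 * V1 / N := by gcongr
      _ = (N * ∏ p ∈ N.primeFactors, (1 - chi p / p)) * ((Y:ℝ)/N)^2 * (V1 * ∏ p ∈ P, (1 - chi p / p)) := by
        field_simp
      _ ≤ X * V := by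
        rw [e1, hX]; gcongr
  set Lm : ℝ := ∑ p ∈ (Ioc z y).filter (fun p => p.Prime ∧ p % 4 = 1), (2:ℝ)/p with hLm
  have hD1 : 1 ≤ D := by
    rw [hD]; apply one_le_pow₀; exact_mod_cast (by omega)
  have hy1 : (1:ℝ) ≤ y := by exact_mod_cast (by omega)
  have hXV0 : 0 ≤ X * V := le_trans (by positivity) hXV
  have hlam0 : (1:ℝ) ≤ (lam:ℝ) + 1 := by linarith [(by positivity : (0:ℝ) ≤ lam)]
  have m1 : (1.01 * X * V * Lm + 3 * Y * N * y^2 * D^3)/((lam:ℝ)+1) ≤ 0.92 * (X*V) + 3 * Y * N * y^2 * D^3 := by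
    rw [add_div]
    have i1 : 1.01 * X * V * Lm / ((lam:ℝ)+1) ≤ 0.92 * (X*V) := by
      rw [div_le_iff₀ (by linarith)]
      have := mul_le_mul_of_nonneg_left hlam hXV0
      nlinarith
    have i2 : 3 * Y * N * y^2 * D^3/((lam:ℝ)+1) ≤ 3 * Y * N * y^2 * D^3 := by
      apply div_le_self (by positivity) hlam0
    linarith
  have m2 : 3 * (Y:ℝ) * N * D^3 ≤ 3 * Y * N * y^2 * D^3 := by
    have : (1:ℝ) ≤ (y:ℝ)^2 := one_le_pow₀ hy1
    have h0 : 0 ≤ 3 * (Y:ℝ) * N * D^3 := by positivity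
    nlinarith
  have m3 : 0.05 * (c1 * Y^2 * V1 / N) ≤ 0.99 * X * V - 3 * Y * N * D^3 - 4 * (Y:ℝ)^2/z - (1.01 * X * V * Lm + 3 * Y * N * y^2 * D^3)/((lam:ℝ)+1) := by
    have e3 : 0.99 * X * V = 0.99 * (X * V) := by ring
    rw [e3]
    linarith
  refine m3.trans (main.trans ?_)
  apply mul_le_mul_of_nonneg_left _ (by positivity)
  rw [Nat.cast_le]
  -- injection
  apply card_le_card_of_injOn (fun n => (n - A) / N)
  all_goals
    have key : ∀ n ∈ (((Ico U (U+Y) ×ˢ Ico 1 (1+Y)).filter (fun x => ((x.1^2+x.2^2:ℕ):ZMod N) = A ∧ ∀ p ∈ P, ¬ Bad a2 k j p x.1 x.2)).image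
        (fun x => x.1^2+x.2^2)), ∃ t, n = A + N * t ∧ (n - A) / N = t ∧ t1 ≤ t ∧ t < t1 + T ∧ Sf a2 W k z t ∧ IsSumTwoSquares (Lf a2 W j t) := by
      intro n hn
      obtain ⟨x, hx, rfl⟩ := mem_image.1 hn
      obtain ⟨hx1, hx2, hx3⟩ := mem_filter.1 hx
      obtain ⟨hu, hv⟩ := mem_product.1 hx1
      rw [mem_Ico] at hu hv
      have q1 : U^2 ≤ x.1^2 := Nat.pow_le_pow_left hu.1 2
      have q2 : x.1^2 < (U+Y)^2 := Nat.pow_lt_pow_left hu.2 (by norm_num)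
      have q3 : x.2^2 < (1+Y)^2 := Nat.pow_lt_pow_left hv.2 (by norm_num)
      have q4 : A ≡ x.1^2+x.2^2 [MOD N] := ((ZMod.natCast_eq_natCast_iff _ _ _).1 hx2).symm
      have q5 : A ≤ x.1^2+x.2^2 := by
        have := hLf t1
        have : A ≤ Lf a2 W j t1 := by rw [this]; exact Nat.le_add_right _ _
        omega
      obtain ⟨t, ht⟩ := (Nat.modEq_iff_dvd' q5).1 q4
      have hnt : x.1^2+x.2^2 = A + N * t := by omega
      refine ⟨t, hnt, by rw [ht]; exact Nat.mul_div_cancel_left t hN0, ?_, ?_, ?_, ?_⟩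
      · rw [hLf] at hUL
        have : N * t1 ≤ N * t := by omega
        exact Nat.le_of_mul_le_mul_left this hN0
      · rw [hLf] at hUR
        have : N * t < N * (t1+T) := by omega
        exact Nat.lt_of_mul_lt_mul_left this
      · intro p hp
        obtain ⟨b1, b2, b3, b4, b5⟩ := hPbig p hp
        have hb := hx3 p hp
        unfold Bad at hb
        push Not at hb
        have cast1 : ((x.1^2+x.2^2:ℕ):ZMod p) = a2 + 4*W*j*(1+a2*t) := by
          rw [hnt, hA, hN]; push_cast; ring
        rw [cast1] at hb
        constructor
        · intro h
          apply hb.1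
          have : ((1+a2*t:ℕ):ZMod p) = 0 := (ZMod.natCast_eq_zero_iff _ _).2 h
          push_cast at this
          rw [this]; ring
        · intro i hi h
          apply hb.2 i hi
          have : ((Lf a2 W i t:ℕ):ZMod p) = 0 := (ZMod.natCast_eq_zero_iff _ _).2 h
          rw [Lf] at this
          push_cast at this
          linear_combination (j:ZMod p) * this
      · rw [hLf, ← hnt]
        refine ⟨?_, x.1, x.2, rfl⟩
        have : 0 < x.1^2 := by have : 0 < x.1 := by omega
                               positivity
        omega
  · intro n hn
    obtain ⟨t, h1, h2, h3, h4, h5⟩ := key n hn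
    rw [mem_coe, mem_filter, mem_Ico]
    dsimp only
    rw [h2]
    exact ⟨⟨h3, h4⟩, h5⟩
  · intro n hn n' hn' e
    obtain ⟨t, h1, h2, _⟩ := key n hn
    obtain ⟨t', h1', h2', _⟩ := key n' hn'
    dsimp only at e
    rw [h2, h2'] at e
    rw [h1, h1', e]


lemma PS_big {W a2 k z : ℕ} (hW : ∀ p : ℕ, p.Prime → p ≤ 2*k+4 → p ∣ W) {p : ℕ} (hp : p ∈ PS (4*W*a2) z) :
    2*k+4 < p ∧ ¬ p ∣ a2 ∧ ¬ p ∣ W ∧ p.Prime ∧ p ≤ z := by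
  rw [PS, mem_filter, mem_range] at hp
  obtain ⟨h1, h2, h3⟩ := hp
  have h4 : ¬ p ∣ W := fun h => h3 ((h.mul_left 4).mul_right a2)
  have h5 : 2*k+4 < p := by
    by_contra h; exact h4 (hW p h2 (by omega))
  exact ⟨h5, fun h => h3 (h.mul_left _), h4, h2, by omega⟩

def Bad1 (a2 W k p u v : ℕ) : Prop := p ∣ (1+a2*u) ∨ ∃ j ∈ Icc 1 k, p ∣ Lf a2 W j u

lemma bad1_iff (a2 W k p u v : ℕ) : Bad1 a2 W k p u v ↔
    (1 + (a2:ZMod p) * u = 0 ∨ ∃ j ∈ Icc 1 k, (a2:ZMod p) + 4*W*j*(1+a2*u) = 0) := by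
  unfold Bad1 Lf
  apply or_congr
  · rw [← ZMod.natCast_eq_zero_iff]; push_cast; exact Iff.rfl
  · apply exists_congr; intro j; apply and_congr_right; intro _
    rw [← ZMod.natCast_eq_zero_iff]; push_cast; exact Iff.rfl

lemma per_bad1 (a2 W k p : ℕ) : Per p (Bad1 a2 W k p) := by
  have := per_zmod p (fun u _ => (1 + (a2:ZMod p) * u = 0 ∨ ∃ j ∈ Icc 1 k, (a2:ZMod p) + 4*W*j*(1+a2*u) = 0))
  intro u v
  rw [bad1_iff, bad1_iff]
  exact this u v

lemma cnt_bad1 (a2 W k p : ℕ) (hp : p.Prime) (hpk : 2*k+4 < p) (ha : ¬ p ∣ a2) (hpW : ¬ p ∣ W) :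
    (cnt p (Bad1 a2 W k p) : ℝ) / (p:ℝ)^2 = ((k:ℝ)+1)/p := by
  classical
  have : Fact p.Prime := ⟨hp⟩
  have ha' : (a2 : ZMod p) ≠ 0 := by rwa [Ne, ZMod.natCast_eq_zero_iff]
  have hW' : (W : ZMod p) ≠ 0 := by rwa [Ne, ZMod.natCast_eq_zero_iff]
  have hi : ∀ i : ℕ, 1 ≤ i → i ≤ k + 4 → (i : ZMod p) ≠ 0 := by
    intro i hi hi2 h
    rw [ZMod.natCast_eq_zero_iff] at h
    have := Nat.le_of_dvd (by omega) h
    omega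
  have h4 : (4 : ZMod p) ≠ 0 := by exact_mod_cast hi 4 (by norm_num) (by omega)
  set f : ℕ → ZMod p := fun j => -((a2:ZMod p) + 4*W*j)/(4*W*j*a2) with hf
  set F : Finset (ZMod p) := insert (-1/(a2:ZMod p)) ((Icc 1 k).image f) with hF
  have hcard : F.card = k + 1 := by
    rw [hF, card_insert_of_notMem, card_image_of_injOn]
    · simp
    · intro i1 h1 i2 h2 e
      have c1 := mem_Icc.1 (mem_coe.1 h1)
      have c2 := mem_Icc.1 (mem_coe.1 h2)
      have n1 := hi i1 c1.1 (by omega)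
      have n2 := hi i2 c2.1 (by omega)
      simp only [hf] at e
      rw [div_eq_div_iff (mul_ne_zero (mul_ne_zero (mul_ne_zero h4 hW') n1) ha') (mul_ne_zero (mul_ne_zero (mul_ne_zero h4 hW') n2) ha')] at e
      have e2 : (4 * (W:ZMod p) * a2 * a2) * ((i1 : ZMod p) - i2) = 0 := by linear_combination e
      have e3 : ((i1 : ZMod p) - i2) = 0 := by
        rcases mul_eq_zero.1 e2 with h | h
        · exact absurd h (mul_ne_zero (mul_ne_zero (mul_ne_zero h4 hW') ha') ha')
        · exact h
      have e4 := (ZMod.natCast_eq_natCast_iff _ _ _).1 (sub_eq_zero.1 e3)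
      rwa [Nat.ModEq, Nat.mod_eq_of_lt (by omega), Nat.mod_eq_of_lt (by omega)] at e4
    · rw [mem_image]
      rintro ⟨i, hi1, e⟩
      rw [mem_Icc] at hi1
      simp only [hf] at e
      rw [div_eq_div_iff (mul_ne_zero (mul_ne_zero (mul_ne_zero h4 hW') (hi i hi1.1 (by omega))) ha') ha'] at e
      have : (a2 : ZMod p) * a2 = 0 := by linear_combination -e
      exact mul_ne_zero ha' ha' this
  have hz := cnt_zmod p (fun u _ => u ∈ F)
  have hB : Bad1 a2 W k p = fun u v : ℕ => (u : ZMod p) ∈ F := by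
    funext u v
    apply propext
    rw [bad1_iff, hF, mem_insert, mem_image]
    apply or_congr
    · rw [eq_div_iff ha']
      constructor <;> (intro h; linear_combination h)
    · apply exists_congr; intro j
      apply and_congr_right; intro hj
      rw [mem_Icc] at hj
      simp only [hf]
      rw [div_eq_iff (mul_ne_zero (mul_ne_zero (mul_ne_zero h4 hW') (hi j hj.1 (by omega))) ha')]
      constructor <;> (intro h; linear_combination -h)
  rw [hB, hz]
  have hc : ((univ : Finset (ZMod p × ZMod p)).filter (fun x => x.1 ∈ F)).card = (k+1) * p := by
    have : (univ : Finset (ZMod p × ZMod p)).filter (fun x => x.1 ∈ F) = F ×ˢ univ := by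
      ext x; simp
    rw [this, card_product, hcard, card_univ, ZMod.card]
  have hp0 : (p:ℝ) ≠ 0 := by exact_mod_cast hp.ne_zero
  have hc' : (((univ : Finset (ZMod p × ZMod p)).filter (fun x => x.1 ∈ F)).card : ℝ) = ((k:ℝ)+1) * p := by rw [hc]; push_cast; ring
  trans (((univ : Finset (ZMod p × ZMod p)).filter (fun x => x.1 ∈ F)).card : ℝ) / (p:ℝ)^2
  · congr!
  · rw [hc']
    field_simp

open Classical in
lemma A_upper (a2 W k z t1 T : ℕ) (D V1 : ℝ) (hW : ∀ p : ℕ, p.Prime → p ≤ 2*k+4 → p ∣ W) (hz : 2 ≤ z)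
    (hD : D = (z:ℝ)^(4*(900*(k+2))+6)) (hDT : D ≤ T)
    (hV1 : V1 = ∏ p ∈ PS (4*W*a2) z, (1 - ((k:ℝ)+1)/p)) :
    (((Ico t1 (t1+T)).filter (fun t => Sf a2 W k z t)).card : ℝ) ≤ 1.01 * T * V1 + 3 * D^3 := by
  have h := sieve2 t1 0 T 1 z hz one_pos (PS (4*W*a2) z) (fun p hp => ⟨(PS_big hW hp).2.2.2.1, (PS_big hW hp).2.2.2.2⟩)
    (fun p _ => Nat.coprime_one_left p) (fun _ _ => True) (fun _ _ => Iff.rfl) (Bad1 a2 W k) (fun p _ => per_bad1 a2 W k p)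
    ((k:ℝ)+2) D (900*(k+2)) (by omega) (by positivity) (by push_cast; linarith) (fun p => ((k:ℝ)+1)/p)
    (fun p hp => by
      obtain ⟨h1, h2, h3, h4, _⟩ := PS_big hW hp
      exact (cnt_bad1 a2 W k p h4 h1 h2 h3).symm)
    (fun p hp => by
      have h1 : 2*(k:ℝ)+4 < p := by exact_mod_cast (PS_big hW hp).1
      have hk : (0:ℝ) ≤ k := by positivity
      rw [div_le_div_iff₀ (by linarith) (by norm_num)]; linarith)
    (fun p hp => by gcongr; norm_num) hD (by simpa using hDT)
  rw [← hV1] at h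
  have hc1 : cnt 1 (fun _ _ => True) = 1 := by simp [cnt]
  rw [hc1] at h
  have h' := (abs_le.1 h).2
  have hT : (0:ℝ) < T := by
    refine lt_of_lt_of_le ?_ hDT
    rw [hD]; positivity
  have hcard : (((Ico t1 (t1+T) ×ˢ Ico 0 (0+T)).filter (fun x => True ∧ ∀ p ∈ PS (4*W*a2) z, ¬ Bad1 a2 W k p x.1 x.2)).card : ℝ)
      = (((Ico t1 (t1+T)).filter (fun t => Sf a2 W k z t)).card : ℝ) * T := by
    have e : (Ico t1 (t1+T) ×ˢ Ico 0 (0+T)).filter (fun x => True ∧ ∀ p ∈ PS (4*W*a2) z, ¬ Bad1 a2 W k p x.1 x.2) =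
        ((Ico t1 (t1+T)).filter (fun t => Sf a2 W k z t)) ×ˢ Ico 0 (0+T) := by
      have hS : ∀ t v : ℕ, (∀ p ∈ PS (4*W*a2) z, ¬ Bad1 a2 W k p t v) ↔ Sf a2 W k z t := by
        intro t v
        simp only [Sf, Bad1, not_or, not_exists, not_and]
      ext x
      simp only [mem_filter, mem_product, true_and, hS]
      tauto
    rw [e, card_product]; simp
  have h2 : (((Ico t1 (t1+T)).filter (fun t => Sf a2 W k z t)).card : ℝ) * T ≤ (1.01 * T * V1 + 3 * D^3) * T := by
    rw [← hcard]
    refine le_trans (le_of_eq ?_) ((sub_le_iff_le_add'.1 h').trans (le_of_eq ?_))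
    · congr!
    · push_cast; ring
  exact le_of_mul_le_mul_right h2 hT


open Classical in
lemma pigeon (A J : Finset ℕ) (r : ℕ → ℕ → Prop) (σ θ : ℝ) (hJ : 0 < J.card) (hθ : 0 ≤ θ)
    (h : ∀ j ∈ J, σ ≤ ((A.filter (fun t => r j t)).card : ℝ)) (hA : θ * A.card ≤ J.card * σ / 2) :
    σ / 2 ≤ ((A.filter (fun t => θ ≤ ((J.filter (fun j => r j t)).card : ℝ))).card : ℝ) := by
  set G := A.filter (fun t => θ ≤ ((J.filter (fun j => r j t)).card : ℝ)) with hG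
  have h1 : (J.card:ℝ) * σ ≤ ∑ j ∈ J, ((A.filter (fun t => r j t)).card : ℝ) := by
    rw [← nsmul_eq_mul]; exact card_nsmul_le_sum _ _ _ h
  have h2 : ∑ j ∈ J, ((A.filter (fun t => r j t)).card : ℝ) = ∑ t ∈ A, ((J.filter (fun j => r j t)).card : ℝ) := by
    simp only [card_filter]; push_cast; rw [sum_comm]
  have h3 : ∑ t ∈ A, ((J.filter (fun j => r j t)).card : ℝ) ≤ J.card * G.card + θ * A.card := by
    rw [← sum_filter_add_sum_filter_not A (fun t => θ ≤ ((J.filter (fun j => r j t)).card : ℝ))]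
    apply add_le_add
    · calc _ ≤ ∑ t ∈ G, (J.card:ℝ) := sum_le_sum (fun t _ => by exact_mod_cast card_filter_le _ _)
        _ = _ := by rw [sum_const, nsmul_eq_mul, mul_comm]
    · calc _ ≤ ∑ t ∈ A.filter (fun t => ¬ θ ≤ ((J.filter (fun j => r j t)).card : ℝ)), θ :=
            sum_le_sum (fun t ht => (not_le.1 (mem_filter.1 ht).2).le)
        _ = _ := by rw [sum_const, nsmul_eq_mul, mul_comm]
        _ ≤ _ := by gcongr; exact filter_subset _ _
  have hJ' : (0:ℝ) < J.card := by exact_mod_cast hJ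
  have h4 : (J.card:ℝ) * (σ/2) ≤ J.card * G.card := by linarith
  exact le_of_mul_le_mul_left h4 hJ'

lemma IsSumTwoSquares.mul' {m n : ℕ} (hm : IsSumTwoSquares m) (hn : IsSumTwoSquares n) : IsSumTwoSquares (m*n) := by
  obtain ⟨h1, a, b, h2⟩ := hm
  obtain ⟨h3, c, d, h4⟩ := hn
  obtain ⟨r, s, h⟩ := Nat.sq_add_sq_mul h2 h4
  exact ⟨Nat.mul_pos h1 h3, r, s, h⟩

open Classical in
lemma SAP_lower (a a1 a2 W k t : ℕ) (x : ℝ) (ha : a = a1 * a2) (h1 : IsSumTwoSquares a1) (hW : 0 < W)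
    (hx : ((a + k * (4*a1*W*(1+a2*t)) : ℕ) : ℝ) ≤ x) :
    ((Icc 1 k).filter (fun j => IsSumTwoSquares (Lf a2 W j t))).card ≤ SAP x (4*a1*W*(1+a2*t)) a := by
  set q := 4*a1*W*(1+a2*t) with hq
  have ha1 := h1.1
  have hq0 : 0 < q := by positivity
  have hinj : Set.InjOn (fun j => a + j * q) ((Icc 1 k).filter (fun j => IsSumTwoSquares (Lf a2 W j t)) : Finset ℕ) := by
    intro i _ j _ e
    dsimp only at e
    exact Nat.eq_of_mul_eq_mul_right hq0 (Nat.add_left_cancel e)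
  rw [SAP, ← card_image_of_injOn hinj, ← Set.ncard_coe_finset]
  apply Set.ncard_le_ncard
  · intro n hn
    rw [mem_coe, mem_image] at hn
    obtain ⟨j, hj, rfl⟩ := hn
    obtain ⟨hj1, hj2⟩ := mem_filter.1 hj
    rw [mem_Icc] at hj1
    rw [Set.mem_ofPred_eq]
    refine ⟨le_trans ?_ hx, ?_, ?_⟩
    · have : a + j * q ≤ a + k * q := by gcongr; exact hj1.2
      exact_mod_cast this
    · have e : a + j * q = a1 * Lf a2 W j t := by rw [ha, hq, Lf]; ring
      rw [e]; exact h1.mul' hj2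
    · exact Nat.add_mul_mod_self_right _ _ _
  · apply Set.Finite.subset (Set.finite_Iic ⌊x⌋₊)
    intro n hn
    exact Nat.le_floor hn.1

lemma phiS_pos (q : ℕ) : 0 < phiS q := by
  unfold phiS
  apply prod_pos
  intro p hp
  have hpp : 0 < p := (Nat.prime_of_mem_primeFactors hp).pos
  have : (0:ℝ) < p := by exact_mod_cast hpp
  split_ifs <;> positivity

lemma phi_lower : ∃ C1 : ℝ, 0 < C1 ∧ ∀ q w z : ℕ, 0 < q → 4 ∣ q → 2 ≤ w → 0 < z → Real.log q ≤ z →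
    (∀ p : ℕ, p.Prime → p ∣ q → p ≤ w ∨ z < p) → (q:ℝ) ≤ C1 * Real.log w * phiS q := by
  refine ⟨Real.exp (31 - Real.log (Real.log 2)), Real.exp_pos _, ?_⟩
  intro q w z hq h4 hw hz hlog hp
  set h : ℕ → ℝ := fun p => if p = 2 then 2 else 1 + 1/(p:ℝ) with hh
  set h' : ℕ → ℝ := fun p => if p = 2 then 1 else 1/(p:ℝ) with hh'
  have hfac : (q:ℝ) = ∏ p ∈ q.primeFactors, (p:ℝ)^(q.factorization p) := by
    conv_lhs => rw [← Nat.prod_factorization_pow_eq_self hq.ne']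
    rw [Finsupp.prod, Nat.support_factorization]
    push_cast; rfl
  have h1 : (q:ℝ) ≤ phiS q * ∏ p ∈ q.primeFactors, h p := by
    conv_lhs => rw [hfac]
    rw [phiS, ← prod_mul_distrib]
    apply prod_le_prod
    · intro p _; positivity
    · intro p hpm
      have hpp := Nat.prime_of_mem_primeFactors hpm
      have hp0 : (0:ℝ) < p := by exact_mod_cast hpp.pos
      simp only [hh]
      by_cases h2 : p = 2
      · subst h2
        have hf : 2 ≤ q.factorization 2 := by
          rw [← Nat.Prime.pow_dvd_iff_le_factorization Nat.prime_two hq.ne']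
          exact h4
        rw [if_pos rfl, if_pos rfl, if_pos hf, ← pow_succ, Nat.sub_add_cancel (by omega)]
        norm_num
      · rw [if_neg h2, if_neg h2]
        split_ifs with h5
        · have : 0 ≤ (p:ℝ)^(q.factorization p) * (1/p) := by positivity
          rw [mul_add]; linarith
        · apply le_of_eq
          field_simp
          ring
  have h2 : ∏ p ∈ q.primeFactors, h p ≤ Real.exp (∑ p ∈ q.primeFactors, h' p) := by
    rw [Real.exp_sum]
    apply prod_le_prod
    · intro p _; simp only [hh]; split_ifs <;> positivity
    · intro p _
      simp only [hh, hh']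
      split_ifs
      · have := Real.add_one_le_exp (1:ℝ); linarith
      · have := Real.add_one_le_exp (1/(p:ℝ)); linarith
  have hzr : (0:ℝ) < z := by exact_mod_cast hz
  have hcard : (q.primeFactors.card : ℝ) ≤ 2 * z := by
    have c1 : 2 ^ q.primeFactors.card ≤ q := by
      calc 2 ^ q.primeFactors.card = ∏ p ∈ q.primeFactors, 2 := by rw [prod_const]
        _ ≤ ∏ p ∈ q.primeFactors, p := prod_le_prod' (fun p hp => (Nat.prime_of_mem_primeFactors hp).two_le)
        _ ≤ q := Nat.le_of_dvd hq (Nat.prod_primeFactors_dvd q)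
    have c2 : (2:ℝ) ^ q.primeFactors.card ≤ q := by exact_mod_cast c1
    have c3 := Real.log_le_log (by positivity) c2
    rw [Real.log_pow] at c3
    have := Real.log_two_gt_d9
    nlinarith [(by positivity : (0:ℝ) ≤ q.primeFactors.card)]
  have h3 : ∑ p ∈ q.primeFactors, h' p ≤ 1 + (Real.log (Real.log w) - Real.log (Real.log 2) + 28) + 2 := by
    have d1 : ∀ p ∈ q.primeFactors, h' p ≤ (if p = 2 then (1:ℝ) else 0) + (if p ∈ (Ioc 2 w).filter Nat.Prime then 1/(p:ℝ) else 0) + 1/z := by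
      intro p hpm
      have hpp := Nat.prime_of_mem_primeFactors hpm
      have hzi : (0:ℝ) ≤ 1/z := by positivity
      have hpi : (0:ℝ) ≤ 1/p := by positivity
      simp only [hh']
      by_cases h2 : p = 2
      · rw [if_pos h2, if_pos h2]
        have : (0:ℝ) ≤ (if p ∈ (Ioc 2 w).filter Nat.Prime then 1/(p:ℝ) else 0) := by split_ifs <;> positivity
        linarith
      · rw [if_neg h2, if_neg h2]
        rcases hp p hpp (Nat.dvd_of_mem_primeFactors hpm) with h6 | h6
        · rw [if_pos (mem_filter.2 ⟨mem_Ioc.2 ⟨lt_of_le_of_ne hpp.two_le (Ne.symm h2), h6⟩, hpp⟩)]; linarith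
        · have : (0:ℝ) ≤ (if p ∈ (Ioc 2 w).filter Nat.Prime then 1/(p:ℝ) else 0) := by split_ifs <;> positivity
          have : 1/(p:ℝ) ≤ 1/z := by
            apply one_div_le_one_div_of_le hzr; exact_mod_cast h6.le
          linarith
    refine (sum_le_sum d1).trans ?_
    rw [sum_add_distrib, sum_add_distrib]
    apply add_le_add (add_le_add ?_ ?_)
    · rw [sum_const, nsmul_eq_mul, mul_one_div, div_le_iff₀ hzr]; exact hcard
    · rw [sum_ite_eq']; split_ifs <;> norm_num
    · refine le_trans ?_ (mertens_range 2 w le_rfl hw)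
      rw [← sum_filter]
      apply sum_le_sum_of_subset_of_nonneg
      · intro p hp; exact (mem_filter.1 hp).2
      · intro p _ _; positivity
  have hlw : 0 < Real.log w := Real.log_pos (by exact_mod_cast (by omega))
  have h4 : Real.exp (∑ p ∈ q.primeFactors, h' p) ≤ Real.exp (31 - Real.log (Real.log 2)) * Real.log w := by
    calc _ ≤ Real.exp ((31 - Real.log (Real.log 2)) + Real.log (Real.log w)) := Real.exp_le_exp.2 (by linarith)
      _ = _ := by rw [Real.exp_add, Real.exp_log hlw]
  calc (q:ℝ) ≤ phiS q * ∏ p ∈ q.primeFactors, h p := h1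
    _ ≤ phiS q * (Real.exp (31 - Real.log (Real.log 2)) * Real.log w) := by
      have := (phiS_pos q).le
      gcongr
      exact h2.trans h4
    _ = _ := by ring


lemma choose_UY (A N T t1 : ℕ) (hA : A ≤ 2 * N) (ht : t1 + 2 ≤ 17 * T) (hNT : 1600 ≤ N * T) :
    ∃ U Y : ℕ, 1 ≤ U ∧ A + N * t1 ≤ U^2 ∧ (U+Y)^2 + (1+Y)^2 ≤ A + N * (t1 + T) ∧ N * T ≤ 1600 * Y^2 := by
  set s := Nat.sqrt (A + N * t1) with hs
  set m := Nat.sqrt (N * T) with hm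
  have s1 : s * s ≤ A + N * t1 := Nat.sqrt_le _
  have s2 : A + N * t1 < (s+1) * (s+1) := Nat.lt_succ_sqrt _
  have m1 : m * m ≤ N * T := Nat.sqrt_le _
  have m2 : N * T < (m+1) * (m+1) := Nat.lt_succ_sqrt _
  have m3 : 40 ≤ m := by rw [hm, Nat.le_sqrt]; exact hNT
  refine ⟨s+1, m/20, by omega, by nlinarith, ?_, ?_⟩
  · set Y := m/20 with hY
    have y1 : 10 * (1+Y) ≤ m := by omega
    have h17 : A + N * t1 ≤ 17 * (N * T) := by nlinarith
    zify at *
    have e4 : (A:ℤ) + N * (t1 + T) = A + N * t1 + N * T := by ring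
    rw [e4]
    generalize (N:ℤ) * T = P at *
    have e1 : 2 * (s:ℤ) * m ≤ 9 * P := by nlinarith [sq_nonneg ((s:ℤ) - 4 * m)]
    have e2 : 20 * (1+(Y:ℤ)) * s ≤ 9 * P := by nlinarith
    have e3 : 100 * (1+(Y:ℤ))^2 ≤ P := by nlinarith
    nlinarith
  · set Y := m/20 with hY
    have y1 : m + 1 ≤ 40 * Y := by omega
    nlinarith

set_option maxHeartbeats 1000000 in
open Classical in
lemma comb1 (a2 W k z y E lam t1 T : ℕ) (c1 M X V1 : ℝ)
    (ha4 : a2 % 4 = 1) (hW0 : 0 < W) (hcop : Nat.Coprime a2 W)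
    (hW : ∀ p : ℕ, p.Prime → p ≤ 2*k+4 → p ∣ W) (hk : 1 ≤ k) (hz : 2 ≤ z) (hzy : z ≤ y)
    (hc0 : 0 < c1) (hc1 : c1 ≤ ∏ p ∈ (range (z+1)).filter Nat.Prime, (1 - (chi p : ℝ)/p))
    (hlam : 1.1*(∑ p ∈ (Ioc z y).filter (fun p => p.Prime ∧ p % 4 = 1), (2:ℝ)/p) ≤ lam+1)
    (hV1 : V1 = ∏ p ∈ PS (4*W*a2) z, (1 - ((k:ℝ)+1)/p))
    (hM1 : 48000 / c1 ≤ M) (hM0 : 48000 ≤ M) (hMX : M^4 ≤ X)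
    (hN : ((k*(4*W*a2) : ℕ):ℝ) ≤ M) (hV : 1/M ≤ V1) (hyX : (y:ℝ) ≤ X)
    (hDX : (z:ℝ)^(4*(900*(k+2))+6) ≤ X) (hzM : M^3 ≤ z) (hT : X^20 ≤ T) (ht : t1+2 ≤ 17*T)
    (hE : Lf a2 W k (t1+T) ≤ y^E) :
    0.05*(c1*(T/1600)*V1)/2^(lam+E)/2 ≤ (((Ico t1 (t1+T)).filter (fun t => Sf a2 W k z t ∧
      k*(0.05*c1/(1600*2.08))/2^(lam+E) ≤
        (((Icc 1 k).filter (fun j => IsSumTwoSquares (Lf a2 W j t))).card : ℝ))).card : ℝ) := by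
  have hMp : 0 < M := by linarith
  have hMX' : M ≤ X := by
    refine le_trans ?_ hMX
    nlinarith [mul_le_mul hM0 hM0 (by norm_num) hMp.le, pow_pos hMp 3, pow_pos hMp 2, sq_nonneg (M^2-M), mul_pos hMp (pow_pos hMp 2)]
  have hXp : 0 < X := by linarith
  have hX1 : 48000 ≤ X := by linarith
  have hVp : 0 < V1 := lt_of_lt_of_le (by positivity) hV
  have hMV : 1 ≤ M * V1 := by
    have := mul_le_mul_of_nonneg_left hV hMp.le
    rwa [mul_one_div_cancel hMp.ne'] at this
  set D : ℝ := (z:ℝ)^(4*(900*(k+2))+6) with hD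
  have hD0 : 0 ≤ D := by positivity
  have hzr : (0:ℝ) < z := by exact_mod_cast (by omega : 0 < z)
  have hTp : (0:ℝ) < T := lt_of_lt_of_le (by positivity) hT
  have ha20 : 0 < a2 := by omega
  have hM1' : 48000 ≤ c1 * M := by rwa [div_le_iff₀' hc0] at hM1
  have key : ∀ j ∈ Icc 1 k, 0.05*(c1*(T/1600)*V1)/2^(lam+E) ≤
      ((((Ico t1 (t1+T)).filter (fun t => Sf a2 W k z t)).filter (fun t => IsSumTwoSquares (Lf a2 W j t))).card : ℝ) := by
    intro j hj
    obtain ⟨hj1, hjk⟩ := mem_Icc.1 hj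
    set N := j*(4*W*a2) with hNdef
    have hWa : 0 < W * a2 := Nat.mul_pos hW0 ha20
    have hN0 : 0 < N := by positivity
    have hNr : (0:ℝ) < N := by exact_mod_cast hN0
    have hNM : (N:ℝ) ≤ M := by
      refine le_trans ?_ hN
      exact_mod_cast Nat.mul_le_mul_right _ hjk
    have hLf : ∀ t, Lf a2 W j t = (a2+4*W*j) + N * t := by intro t; simp only [Lf, hNdef]; ring
    have hA : a2 + 4*W*j ≤ 2*N := by
      have e1 : a2 ≤ N := by
        rw [hNdef]
        calc a2 = 1*(1*a2) := by ring
          _ ≤ j*(4*W*a2) := Nat.mul_le_mul hj1 (Nat.mul_le_mul_right _ (by omega))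
      have e2 : 4*W*j ≤ N := by
        rw [hNdef]
        calc 4*W*j = j*(4*W*1) := by ring
          _ ≤ j*(4*W*a2) := Nat.mul_le_mul_left _ (Nat.mul_le_mul_left _ ha20)
      omega
    have hX20 : (1600:ℝ) ≤ X^20 := by
      have : X ≤ X^20 := le_self_pow₀ (by linarith) (by norm_num)
      linarith
    have hT1600 : 1600 ≤ T := by exact_mod_cast hX20.trans hT
    have hNT : 1600 ≤ N*T := le_trans hT1600 (Nat.le_mul_of_pos_left _ hN0)
    obtain ⟨U, Y, hU1, hU2, hU3, hY⟩ := choose_UY (a2+4*W*j) N T t1 hA ht hNT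
    have hYr : (N:ℝ)*T ≤ 1600*(Y:ℝ)^2 := by exact_mod_cast hY
    have hY10 : X^10 ≤ 40 * (Y:ℝ) := by
      refine (sq_le_sq₀ (by positivity) (by positivity)).1 ?_
      have : (1:ℝ) ≤ N := by exact_mod_cast hN0
      calc (X^10)^2 = (X^20:ℝ) := by ring
        _ ≤ (T:ℝ) := hT
        _ ≤ (N:ℝ)*(T:ℝ) := le_mul_of_one_le_left hTp.le this
        _ ≤ (40*(Y:ℝ))^2 := by linarith
    have hYp : (0:ℝ) < Y := by have := pow_pos hXp 10; linarith
    have hX6 : X^6 * 48000 ≤ X^10 := by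
      have : 48000 ≤ X^4 := hX1.trans (le_self_pow₀ (by linarith) (by norm_num))
      calc X^6*48000 ≤ X^6*X^4 := by gcongr
        _ = _ := by ring
    have hX36 : X^3 ≤ X^6 := pow_le_pow_right₀ (by linarith) (by norm_num)
    have hy0 : (0:ℝ) ≤ y := by positivity
    have hc := core2 a2 W k j U Y z y E lam t1 T D c1 ha4 hW0 hcop hW hj1 hjk hz hzy ?_ hU1 hD ?_ ?_ ?_ ?_ hc0 hc1 hlam V1 hV1 ?_
    · rw [← hNdef] at hc
      rw [filter_filter]
      rw [div_le_iff₀' (by positivity)]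
      refine le_trans ?_ hc
      have : c1*(T/1600)*V1 ≤ c1*(Y:ℝ)^2*V1/N := by
        rw [le_div_iff₀ hNr]
        have : (T/1600 : ℝ) * N ≤ (Y:ℝ)^2 := by linarith
        calc c1*(T/1600)*V1*N = c1*V1*(T/1600*N) := by ring
          _ ≤ c1*V1*(Y:ℝ)^2 := by gcongr
          _ = _ := by ring
      linarith
    · have : (N:ℝ) ≤ z := by
        refine le_trans (hNM.trans ?_) hzM
        exact le_self_pow₀ (by linarith) (by norm_num)
      exact_mod_cast this
    · rw [← hNdef]
      calc (N:ℝ)*y*D ≤ X*X*X := by gcongr; exact hNM.trans hMX'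
        _ = X^3 := by ring
        _ ≤ Y := by nlinarith [pow_pos hXp 6]
    · refine hU3.trans (le_trans ?_ hE)
      rw [← hLf]
      unfold Lf; gcongr
    · rw [hLf]; exact hU2
    · rw [hLf]; exact hU3
    · rw [← hNdef]
      have e0 : c1*(Y:ℝ)^2*V1/N ≥ 48000 * (Y:ℝ)^2/M^3 := by
        rw [ge_iff_le, div_le_div_iff₀ (by positivity) hNr]
        calc 48000*(Y:ℝ)^2*N ≤ (c1*M)*(Y:ℝ)^2*M := by gcongr
          _ = c1*(Y:ℝ)^2*M^2*1 := by ring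
          _ ≤ c1*(Y:ℝ)^2*M^2*(M*V1) := by gcongr
          _ = _ := by ring
      have e1 : 4*(Y:ℝ)^2/z ≤ 240 * (Y:ℝ)^2/M^3 := by
        have : 4*(Y:ℝ)^2/z ≤ 4*(Y:ℝ)^2/M^3 := by gcongr
        refine this.trans ?_
        gcongr; norm_num
      have e2 : 6*Y*(N:ℝ)*y^2*D^3 ≤ 240 * (Y:ℝ)^2/M^3 := by
        rw [le_div_iff₀ (by positivity)]
        calc 6*Y*(N:ℝ)*y^2*D^3*M^3 ≤ 6*Y*M*X^2*X^3*M^3 := by gcongr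
          _ = 6*Y*(X^5)*M^4 := by ring
          _ ≤ 6*Y*X^5*X := by gcongr
          _ = 6*Y*X^6 := by ring
          _ ≤ 6*Y*(40*Y) := by
              have : X^6 ≤ 40*Y := by nlinarith [pow_pos hXp 6]
              gcongr
          _ = _ := by ring
      have e3 : 48000 * (Y:ℝ)^2/M^3 * 0.01 = 240 * (Y:ℝ)^2/M^3 + 240 * (Y:ℝ)^2/M^3 := by ring
      linarith
  have hA := A_upper a2 W k z t1 T D V1 hW hz hD ?_ hV1
  · have hA2 : (((Ico t1 (t1+T)).filter (fun t => Sf a2 W k z t)).card:ℝ) ≤ 1.04*T*V1 := by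
      have : 3*D^3 ≤ 0.03*(T*V1) := by
        have e1 : 100*D^3*M ≤ T := by
          refine le_trans ?_ hT
          calc 100*D^3*M ≤ X*X^3*X := by gcongr; linarith
            _ = X^5 := by ring
            _ ≤ X^20 := pow_le_pow_right₀ (by linarith) (by norm_num)
        have e2 : D^3*100*1 ≤ D^3*100*(M*V1) := by gcongr
        have e3 : 100*D^3*M*V1 ≤ T*V1 := by gcongr
        linarith only [e2,e3]
      linarith only [hA, this]
    have hp := pigeon ((Ico t1 (t1+T)).filter (fun t => Sf a2 W k z t)) (Icc 1 k) (fun j t => IsSumTwoSquares (Lf a2 W j t))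
      (0.05*(c1*(T/1600)*V1)/2^(lam+E)) (k*(0.05*c1/(1600*2.08))/2^(lam+E)) (by simp; omega) (by positivity) key ?_
    · refine hp.trans (le_of_eq ?_)
      rw [filter_filter]
    · rw [Nat.card_Icc, Nat.add_sub_cancel]
      calc _ ≤ k*(0.05*c1/(1600*2.08))/2^(lam+E) * (1.04*T*V1) := by gcongr
        _ = _ := by ring
  · calc D ≤ X := hDX
      _ ≤ X^20 := le_self_pow₀ (by linarith) (by norm_num)
      _ ≤ T := hT


lemma lam_sum : ∃ C2 : ℝ, 0 < C2 ∧ ∀ z y : ℕ, 2 ≤ z → z ≤ y →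
    ∑ p ∈ (Ioc z y).filter (fun p => p.Prime ∧ p % 4 = 1), (2:ℝ)/p ≤
      Real.log (Real.log y) - Real.log (Real.log z) + C2 := by
  obtain ⟨C, hC, h⟩ := chi_prime_bound
  refine ⟨28 + C, by linarith, ?_⟩
  intro z y hz hzy
  have h1 := mertens_range z y hz hzy
  have h2 := (abs_le.1 (h z y (by omega))).2
  have : ∑ p ∈ (Ioc z y).filter (fun p => p.Prime ∧ p % 4 = 1), (2:ℝ)/p ≤
      ∑ p ∈ (Ioc z y).filter Nat.Prime, (1:ℝ)/p + ∑ p ∈ (Ioc z y).filter Nat.Prime, (chi p:ℝ)/p := by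
    rw [← sum_add_distrib, ← filter_filter, sum_filter]
    apply sum_le_sum
    intro p hp
    rw [chi_cases]
    have hpz : p.Prime := (mem_filter.1 hp).2
    split_ifs with h1 h2 h3
    · omega
    · apply le_of_eq; ring
    · have : (0:ℝ) ≤ 1/p := by positivity
      simp
    · apply le_of_eq; ring
  linarith

lemma V1_lower : ∃ C3 : ℝ, 0 < C3 ∧ ∀ a2 W k z : ℕ, (∀ p : ℕ, p.Prime → p ≤ 2*k+4 → p ∣ W) → 2 ≤ z →
    Real.exp (-(2*((k:ℝ)+1)*(Real.log (Real.log z) + C3))) ≤ ∏ p ∈ PS (4*W*a2) z, (1 - ((k:ℝ)+1)/p) := by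
  refine ⟨28 + |Real.log (Real.log 2)|, by positivity, ?_⟩
  intro a2 W k z hW hz
  refine le_trans ?_ (one_sub_ge _ _ ?_ ?_)
  · apply Real.exp_le_exp.2
    have h1 : ∑ p ∈ PS (4*W*a2) z, ((k:ℝ)+1)/p ≤ ((k:ℝ)+1) * ∑ p ∈ (Ioc 2 z).filter Nat.Prime, (1:ℝ)/p := by
      rw [mul_sum]
      calc _ = ∑ p ∈ PS (4*W*a2) z, ((k:ℝ)+1)*(1/p) := by
            apply sum_congr rfl; intro p _; ring
        _ ≤ _ := by
            apply sum_le_sum_of_subset_of_nonneg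
            · intro p hp
              obtain ⟨b1, b2, b3, b4, b5⟩ := PS_big hW hp
              exact mem_filter.2 ⟨mem_Ioc.2 ⟨by omega, b5⟩, b4⟩
            · intros; positivity
    have h2 := mertens_range 2 z le_rfl hz
    have h3 : ((k:ℝ)+1) * ∑ p ∈ (Ioc 2 z).filter Nat.Prime, (1:ℝ)/p ≤ ((k:ℝ)+1) * (Real.log (Real.log z) + (28 + |Real.log (Real.log 2)|)) := by
      gcongr
      have := neg_abs_le (Real.log (Real.log 2))
      push_cast at h2
      linarith
    linarith
  · intro p hp; positivity
  · intro p hp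
    obtain ⟨b1, b2, b3, b4, b5⟩ := PS_big hW hp
    have : (2*(k:ℝ)+4) < p := by exact_mod_cast b1
    rw [div_le_div_iff₀ (by linarith [(by positivity : (0:ℝ) ≤ k)]) (by norm_num)]
    linarith

lemma split_a (a W : ℕ) (ha : IsSumTwoSquares a) (hW2 : 2 ∣ W) :
    ∃ a1 a2 : ℕ, a = a1 * a2 ∧ IsSumTwoSquares a1 ∧ a2 % 4 = 1 ∧ Nat.Coprime a2 W ∧
      ∀ p : ℕ, p.Prime → p ∣ a1 → p ∣ W := by
  obtain ⟨ha0, hab⟩ := ha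
  have hab' : ∃ x y : ℕ, a = x^2+y^2 := hab
  rw [Nat.eq_sq_add_sq_iff] at hab'
  set a1 := ∏ p ∈ a.primeFactors.filter (fun p => p ∣ W), p^(a.factorization p) with h1
  set a2 := ∏ p ∈ a.primeFactors.filter (fun p => ¬ p ∣ W), p^(a.factorization p) with h2
  have hprod : a = a1 * a2 := by
    rw [h1, h2, prod_filter_mul_prod_filter_not]
    conv_lhs => rw [← Nat.prod_factorization_pow_eq_self ha0.ne']
    rw [Finsupp.prod, Nat.support_factorization]
  have d1 : ∀ p : ℕ, p.Prime → p ∣ a1 → p ∣ W := by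
    intro p hp hd
    obtain ⟨q, hq, hd⟩ := (hp.prime.dvd_finsetProd_iff _).1 hd
    have hd := hp.dvd_of_dvd_pow hd
    have hq1 := mem_filter.1 hq
    rw [(Nat.prime_dvd_prime_iff_eq hp (Nat.prime_of_mem_primeFactors hq1.1)).1 hd]
    exact hq1.2
  have d2 : ∀ p : ℕ, p.Prime → p ∣ a2 → ¬ p ∣ W := by
    intro p hp hd
    obtain ⟨q, hq, hd⟩ := (hp.prime.dvd_finsetProd_iff _).1 hd
    have hd := hp.dvd_of_dvd_pow hd
    have hq1 := mem_filter.1 hq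
    rw [(Nat.prime_dvd_prime_iff_eq hp (Nat.prime_of_mem_primeFactors hq1.1)).1 hd]
    exact hq1.2
  have p1 : 0 < a1 := Nat.pos_of_ne_zero (by rintro h; rw [h] at hprod; omega)
  have p2 : 0 < a2 := Nat.pos_of_ne_zero (by rintro h; rw [h] at hprod; omega)
  have s1 : ∃ x y : ℕ, a1 = x^2+y^2 := by
    rw [Nat.eq_sq_add_sq_iff]
    intro q hq hq3
    have hqp := Nat.prime_of_mem_primeFactors hq
    have hqd := Nat.dvd_of_mem_primeFactors hq
    have : Fact q.Prime := ⟨hqp⟩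
    have := hab' (q := q) (Nat.mem_primeFactors.2 ⟨hqp, hprod ▸ hqd.mul_right _, ha0.ne'⟩) hq3
    rw [hprod, padicValNat.mul p1.ne' p2.ne', padicValNat.eq_zero_of_not_dvd (n := a2) (fun h => d2 q hqp h (d1 q hqp hqd))] at this
    simpa using this
  have s2 : ∃ x y : ℕ, a2 = x^2+y^2 := by
    rw [Nat.eq_sq_add_sq_iff]
    intro q hq hq3
    have hqp := Nat.prime_of_mem_primeFactors hq
    have hqd := Nat.dvd_of_mem_primeFactors hq
    have : Fact q.Prime := ⟨hqp⟩
    have := hab' (q := q) (Nat.mem_primeFactors.2 ⟨hqp, hprod ▸ hqd.mul_left _, ha0.ne'⟩) hq3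
    rw [hprod, padicValNat.mul p1.ne' p2.ne', padicValNat.eq_zero_of_not_dvd (n := a1) (fun h => d2 q hqp hqd (d1 q hqp h))] at this
    simpa using this
  refine ⟨a1, a2, hprod, ⟨p1, s1⟩, ?_, ?_, d1⟩
  · obtain ⟨u, v, huv⟩ := s2
    have hodd : a2 % 2 = 1 := by
      have := d2 2 Nat.prime_two
      by_contra h
      exact this (by omega) hW2
    rw [huv] at hodd ⊢
    have e1 : u^2 % 4 = 0 ∨ u^2 % 4 = 1 := by
      rcases Nat.even_or_odd' u with ⟨m, rfl | rfl⟩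
      · left; ring_nf; omega
      · right; ring_nf; omega
    have e2 : v^2 % 4 = 0 ∨ v^2 % 4 = 1 := by
      rcases Nat.even_or_odd' v with ⟨m, rfl | rfl⟩
      · left; ring_nf; omega
      · right; ring_nf; omega
    omega
  · apply Nat.Coprime.symm
    apply Nat.coprime_of_dvd
    intro p hp h3 h4
    exact d2 p hp h4 h3

lemma q_primes (a1 a2 W k z t : ℕ) (hW : ∀ p : ℕ, p.Prime → (p ∣ W ↔ p ≤ 2*k+4))
    (ha1 : ∀ p : ℕ, p.Prime → p ∣ a1 → p ∣ W) (hS : Sf a2 W k z t) :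
    ∀ p : ℕ, p.Prime → p ∣ 4*a1*W*(1+a2*t) → p ≤ 2*k+4 ∨ z < p := by
  intro p hp hd
  by_cases hpw : p ≤ 2*k+4
  · left; exact hpw
  right
  have hpW : ¬ p ∣ W := fun h => hpw ((hW p hp).1 h)
  have hp4 : ¬ p ∣ 4 := fun h => by
    have := Nat.le_of_dvd (by norm_num) h
    omega
  have h1 : p ∣ 1 + a2*t := by
    rcases hp.dvd_mul.1 hd with h | h
    · rcases hp.dvd_mul.1 h with h | h
      · rcases hp.dvd_mul.1 h with h | h
        · exact absurd h hp4
        · exact absurd (ha1 p hp h) hpW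
      · exact absurd h hpW
    · exact h
  have hpa : ¬ p ∣ a2 := fun h => by
    have := (Nat.dvd_add_left (h.mul_right t)).1 h1
    exact hp.one_lt.ne' (Nat.dvd_one.1 this)
  by_contra hz
  have hm : p ∈ PS (4*W*a2) z := by
    unfold PS
    refine mem_filter.2 ⟨mem_range.2 (by omega), hp, ?_⟩
    intro h
    rcases hp.dvd_mul.1 h with h | h
    · rcases hp.dvd_mul.1 h with h | h
      · exact hp4 h
      · exact hpW h
    · exact hpa h
  exact (hS p hm).1 h1


lemma large_v (K : ℝ) : ∃ V : ℝ, ∀ v : ℝ, V ≤ v → K ≤ v ∧ K + 144 * Real.log v ≤ v := by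
  have h := Real.isLittleO_log_id_atTop.bound (show (0:ℝ) < 1/288 by norm_num)
  obtain ⟨V, hV⟩ := Filter.eventually_atTop.1 h
  refine ⟨max V (max 1 (2 * |K|)), ?_⟩
  intro v hv
  have h1 := hV v (le_trans (le_max_left _ _) hv)
  have h2 : 1 ≤ v := le_trans (le_trans (le_max_left _ _) (le_max_right _ _)) hv
  have h3 : 2 * |K| ≤ v := le_trans (le_trans (le_max_right _ _) (le_max_right _ _)) hv
  have h4 := le_abs_self K
  have h5 := abs_nonneg K
  simp only [id, Real.norm_eq_abs] at h1
  rw [abs_of_nonneg (by linarith : 0 ≤ v), abs_of_nonneg (Real.log_nonneg h2)] at h1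
  constructor <;> linarith

lemma lam_pick (C2 : ℝ) (hC2 : 0 < C2) : ∃ K2 : ℝ, 0 < K2 ∧ ∀ k : ℕ, 1 ≤ k → ∃ lam : ℕ,
    1.1 * (Real.log (21612 * k) + C2) ≤ lam + 1 ∧ (2:ℝ)^lam ≤ K2 * (k:ℝ)^((5:ℝ)/6) := by
  refine ⟨Real.exp (5/6 * (Real.log 21612 + C2)), Real.exp_pos _, ?_⟩
  intro k hk
  have hkr : (1:ℝ) ≤ k := by exact_mod_cast hk
  have hL : 0 ≤ Real.log (21612 * k) := Real.log_nonneg (by linarith)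
  refine ⟨⌊1.1 * (Real.log (21612 * k) + C2)⌋₊, (Nat.lt_floor_add_one _).le, ?_⟩
  have h1 := Nat.floor_le (show 0 ≤ 1.1 * (Real.log (21612 * k) + C2) by positivity)
  set lam := ⌊1.1 * (Real.log (21612 * k) + C2)⌋₊
  rw [Real.rpow_def_of_pos (by linarith : (0:ℝ) < k), ← Real.exp_add, ← Real.rpow_natCast, Real.rpow_def_of_pos (by norm_num : (0:ℝ) < 2)]
  apply Real.exp_le_exp.2
  have h2 : Real.log (21612 * k) = Real.log 21612 + Real.log k := Real.log_mul (by norm_num) (by linarith)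
  have h3 := Real.log_two_lt_d9
  have h4 : Real.log 2 * lam ≤ Real.log 2 * (1.1 * (Real.log (21612 * k) + C2)) := by gcongr
  have h5 : Real.log 2 * 1.1 * (Real.log (21612 * k) + C2) ≤ 5/6 * (Real.log (21612 * k) + C2) := by
    apply mul_le_mul_of_nonneg_right _ (by positivity)
    linarith
  rw [h2] at h4 h5
  linarith

lemma log_pow_bound (k : ℕ) (H : ℝ) (hk : 1 ≤ k) (hH : 1 ≤ H) (h : H^((4:ℝ)/5) / 8 ≤ k) :
    Real.log ((2*k+4:ℕ):ℝ) * H^((1:ℝ)/10) ≤ 1152 * (k:ℝ)^((1:ℝ)/6) := by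
  have hkr : (1:ℝ) ≤ k := by exact_mod_cast hk
  have h1 : H^((1:ℝ)/10) ≤ 8 * (k:ℝ)^((1:ℝ)/8) := by
    calc H^((1:ℝ)/10) = (H^((4:ℝ)/5))^((1:ℝ)/8) := by
          rw [← Real.rpow_mul (by linarith)]; norm_num
      _ ≤ (8*(k:ℝ))^((1:ℝ)/8) := by
          apply Real.rpow_le_rpow (by positivity) (by linarith) (by norm_num)
      _ = 8^((1:ℝ)/8) * (k:ℝ)^((1:ℝ)/8) := Real.mul_rpow (by norm_num) (by linarith)
      _ ≤ _ := by
          gcongr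
          calc (8:ℝ)^((1:ℝ)/8) ≤ 8^(1:ℝ) := Real.rpow_le_rpow_of_exponent_le (by norm_num) (by norm_num)
            _ = 8 := by norm_num
  have h2 : Real.log ((2*k+4:ℕ):ℝ) ≤ 144 * (k:ℝ)^((1:ℝ)/24) := by
    calc Real.log ((2*k+4:ℕ):ℝ) ≤ Real.log (6*k) := by
          apply Real.log_le_log (by positivity)
          push_cast; linarith
      _ ≤ (6*(k:ℝ))^((1:ℝ)/24) / (1/24) := Real.log_le_rpow_div (by positivity) (by norm_num)
      _ = 24 * (6^((1:ℝ)/24) * (k:ℝ)^((1:ℝ)/24)) := by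
          rw [Real.mul_rpow (by norm_num) (by linarith)]; ring
      _ ≤ 24 * (6 * (k:ℝ)^((1:ℝ)/24)) := by
          gcongr
          calc (6:ℝ)^((1:ℝ)/24) ≤ 6^(1:ℝ) := Real.rpow_le_rpow_of_exponent_le (by norm_num) (by norm_num)
            _ = 6 := by norm_num
      _ = _ := by ring
  have h3 : (k:ℝ)^((1:ℝ)/24) * (k:ℝ)^((1:ℝ)/8) = (k:ℝ)^((1:ℝ)/6) := by
    rw [← Real.rpow_add (by linarith)]; norm_num
  calc _ ≤ 144 * (k:ℝ)^((1:ℝ)/24) * (8 * (k:ℝ)^((1:ℝ)/8)) := by gcongr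
    _ = 1152 * ((k:ℝ)^((1:ℝ)/24) * (k:ℝ)^((1:ℝ)/8)) := by ring
    _ = _ := by rw [h3]

lemma z_choice (v : ℝ) (k : ℕ) (hv : 5000000 ≤ v) (hk : 1 ≤ k) (hkv : (k:ℝ) ≤ v^8) :
    ∃ z : ℕ, 2 ≤ z ∧ (z:ℝ)^(4*(900*(k+2))+6) ≤ Real.exp (v^18/100) ∧ Real.exp (v^9)^3 ≤ z ∧
      v^18 / (2161200 * k) ≤ Real.log z ∧ (z:ℝ) ≤ Real.exp (v^18/100) := by
  obtain ⟨s, hs⟩ : ∃ s : ℕ, s = 4*(900*(k+2))+6 := ⟨_, rfl⟩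
  rw [← hs]
  have hkr : (1:ℝ) ≤ k := by exact_mod_cast hk
  have hs1 : (1:ℝ) ≤ s := by exact_mod_cast (by omega : 1 ≤ s)
  have hs2 : (s:ℝ) ≤ 10806 * k := by
    exact_mod_cast (by omega : s ≤ 10806*k)
  have hvp : 0 < v := by linarith
  set b : ℝ := v^18/(100*s) with hb
  have hb1 : v^18/(1080600*k) ≤ b := by
    rw [hb]; exact div_le_div_of_nonneg_left (by positivity) (by positivity) (by linarith)
  have hb2 : 4*v^9 ≤ b := by
    refine le_trans ?_ hb1
    rw [le_div_iff₀ (by positivity)]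
    calc 4*v^9*(1080600*k) ≤ 4*v^9*(1080600*v^8) := by gcongr
      _ = 4322400 * v^17 := by ring
      _ ≤ v * v^17 := by gcongr; linarith
      _ = _ := by ring
  have hv9 : 1 ≤ v^9 := one_le_pow₀ (by linarith)
  have hBfl := Nat.floor_le (Real.exp_pos b).le
  have hBlt := Nat.lt_floor_add_one (Real.exp b)
  set z := ⌊Real.exp b⌋₊ with hz
  have hM2 : 2 ≤ Real.exp (v^9) := by have := Real.add_one_le_exp (v^9); linarith
  have hz3 : Real.exp (v^9)^3 ≤ z := by
    have e1 : Real.exp (v^9)^4 ≤ Real.exp b := by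
      rw [← Real.exp_nat_mul]; apply Real.exp_le_exp.2; push_cast; linarith
    have e2 : 1 ≤ Real.exp (v^9)^3 := one_le_pow₀ (by linarith)
    have e3 : 2*Real.exp (v^9)^3 ≤ Real.exp (v^9)^4 := by
      rw [pow_succ _ 3, mul_comm]; gcongr
    linarith
  have hzp : (2:ℝ) ≤ z := le_trans (hM2.trans (le_self_pow₀ (by linarith) (by norm_num))) hz3
  refine ⟨z, by exact_mod_cast hzp, ?_, hz3, ?_, ?_⟩
  · calc (z:ℝ)^s ≤ Real.exp b^s := by gcongr
      _ = _ := by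
        rw [← Real.exp_nat_mul]; congr 1; rw [hb]; field_simp
  · have e1 : b/2 ≤ Real.log z := by
      rw [Real.le_log_iff_exp_le (by linarith)]
      have e2 : Real.exp b = Real.exp (b/2) * Real.exp (b/2) := by rw [← Real.exp_add]; congr 1; ring
      have e3 : 2 ≤ Real.exp (b/2) := by have := Real.add_one_le_exp (b/2); linarith
      nlinarith
    refine le_trans ?_ e1
    have : v^18/(2161200*k) = v^18/(1080600*k)/2 := by field_simp; norm_num
    linarith
  · refine hBfl.trans (Real.exp_le_exp.2 ?_)
    rw [hb]; gcongr
    linarith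

lemma geo (a a1 a2 W k : ℕ) (Q x M : ℝ) (ha : a = a1*a2) (ha0 : 0 < a) (hW : 0 < W) (hk : 1 ≤ k)
    (hM : ((k*(4*W*a):ℕ):ℝ) ≤ M) (hQ : 8*M*8 ≤ Q) (hkQ : k*Q ≤ x/2) (hax : 4*(a:ℝ) ≤ x) :
    ∃ t1 T : ℕ, t1+2 ≤ 17*T ∧ Q/(8*M) ≤ T ∧
      (∀ t, t ≤ t1+T → ((a+k*(4*a1*W*(1+a2*t)):ℕ):ℝ) ≤ x) ∧
      (∀ t, t1 ≤ t → t ≤ t1+T → Q ≤ ((4*a1*W*(1+a2*t):ℕ):ℝ) ∧ ((4*a1*W*(1+a2*t):ℕ):ℝ) ≤ 1.5*Q) := by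
  have ha20 : 0 < a2 := Nat.pos_of_ne_zero (by rintro rfl; simp at ha; omega)
  have ha10 : 0 < a1 := Nat.pos_of_ne_zero (by rintro rfl; simp at ha; omega)
  set G : ℝ := 4*a*W with hG
  have har : (1:ℝ) ≤ a := by exact_mod_cast ha0
  have hWr : (1:ℝ) ≤ W := by exact_mod_cast hW
  have hkr : (1:ℝ) ≤ k := by exact_mod_cast hk
  have hGp : 0 < G := by positivity
  have hGM : G ≤ M := by
    refine le_trans ?_ hM
    push_cast
    calc G = 1*(4*W*a) := by rw [hG]; ring
      _ ≤ k*(4*W*a) := by gcongr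
  have hMp : 0 < M := by linarith
  have hQp : 0 < Q := by linarith
  have hQG : 64 ≤ Q/G := by rw [le_div_iff₀ hGp]; linarith
  have hc1 := Nat.le_ceil (Q/G)
  have hc2 := Nat.ceil_lt_add_one (show 0 ≤ Q/G by positivity)
  have hf1 := Nat.floor_le (show 0 ≤ Q/G/4 by positivity)
  have hf2 := Nat.lt_floor_add_one (Q/G/4)
  set t1 := ⌈Q/G⌉₊
  set T := ⌊Q/G/4⌋₊
  have hq : ∀ t : ℕ, ((4*a1*W*(1+a2*t):ℕ):ℝ) = 4*a1*W + G*t := by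
    intro t; rw [hG, ha]; push_cast; ring
  have hqG : (4*a1*W:ℝ) ≤ G := by
    rw [hG, ha]; push_cast
    have : (1:ℝ) ≤ a2 := by exact_mod_cast ha20
    calc (4*a1*W:ℝ) = 4*(a1*1)*W := by ring
      _ ≤ _ := by gcongr
  have hQG' : Q/G*G = Q := by field_simp
  have hup : ∀ t : ℕ, t ≤ t1+T → ((4*a1*W*(1+a2*t):ℕ):ℝ) ≤ 1.5*Q := by
    intro t ht
    rw [hq]
    have h1 : (t:ℝ) ≤ t1 + T := by exact_mod_cast ht
    have h2 : (t:ℝ) ≤ Q/G+1+Q/G/4 := by linarith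
    have h3 : G*t ≤ G*(Q/G+1+Q/G/4) := by gcongr
    have h4 : G*(Q/G+1+Q/G/4) = 1.25*(Q/G*G) + G := by ring
    rw [hQG'] at h4
    linarith
  refine ⟨t1, T, ?_, ?_, ?_, ?_⟩
  · have : (t1:ℝ)+2 ≤ 17*T := by linarith
    exact_mod_cast this
  · have : Q/(8*M) ≤ Q/(8*G) := by gcongr
    have e : Q/(8*G) = Q/G/8 := by field_simp
    linarith
  · intro t ht
    have h1 := hup t ht
    rw [Nat.cast_add, Nat.cast_mul k]
    have h2 : (k:ℝ)*((4*a1*W*(1+a2*t):ℕ):ℝ) ≤ k*(1.5*Q) := by gcongr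
    linarith
  · intro t ht ht'
    refine ⟨?_, hup t ht'⟩
    rw [hq]
    have h1 : Q/G ≤ t := hc1.trans (by exact_mod_cast ht)
    have h2 : G*(Q/G) ≤ G*t := by gcongr
    have : (0:ℝ) ≤ 4*a1*W := by positivity
    linarith


lemma target_bound (x q Q C1 L B ph : ℝ) (hx : 0 < x) (hQ : 0 < Q) (hq : Q ≤ q) (hph : 0 < ph)
    (hC1 : 0 < C1) (hL : 0 ≤ L) (h1 : q ≤ C1*L*ph) (h2 : L*(x/Q)^((1:ℝ)/10) ≤ B) :
    x/(ph*(x/q)^((9:ℝ)/10)) ≤ C1*B := by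
  have hqp : 0 < q := by linarith
  have hR : 0 < x/q := by positivity
  have e1 : x/(ph*(x/q)^((9:ℝ)/10)) = q/ph*(x/q)^((1:ℝ)/10) := by
    have : (x/q)^((9:ℝ)/10)*(x/q)^((1:ℝ)/10) = x/q := by
      rw [← Real.rpow_add hR]; norm_num
    have hp : 0 < (x/q)^((9:ℝ)/10) := by positivity
    rw [div_eq_iff (by positivity)]
    calc x = q*(x/q) := by field_simp
      _ = q*((x/q)^((9:ℝ)/10)*(x/q)^((1:ℝ)/10)) := by rw [this]
      _ = _ := by field_simp
  rw [e1]
  have e2 : q/ph ≤ C1*L := by rw [div_le_iff₀ hph]; exact h1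
  have e3 : (x/q)^((1:ℝ)/10) ≤ (x/Q)^((1:ℝ)/10) := by
    apply Real.rpow_le_rpow hR.le _ (by norm_num)
    gcongr
  calc _ ≤ C1*L*(x/Q)^((1:ℝ)/10) := by gcongr
    _ = C1*(L*(x/Q)^((1:ℝ)/10)) := by ring
    _ ≤ _ := by gcongr

lemma k_choice (v H : ℝ) (hv : 1 ≤ v) (hH : 2 ≤ H) (hHv : H ≤ v^10) :
    ∃ k : ℕ, 1 ≤ k ∧ (k:ℝ) ≤ v^8 ∧ H^((4:ℝ)/5)/8 ≤ k ∧ (k:ℝ) ≤ H/2 := by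
  have h1 : H^((4:ℝ)/5) ≤ v^8 := by
    calc H^((4:ℝ)/5) ≤ (v^10)^((4:ℝ)/5) := Real.rpow_le_rpow (by linarith) hHv (by norm_num)
      _ = v^8 := by
        rw [← Real.rpow_natCast, ← Real.rpow_mul (by linarith), ← Real.rpow_natCast]; norm_num
  have h2 : H^((4:ℝ)/5) ≤ H := by
    calc H^((4:ℝ)/5) ≤ H^(1:ℝ) := Real.rpow_le_rpow_of_exponent_le (by linarith) (by norm_num)
      _ = H := Real.rpow_one H
  by_cases h : H^((4:ℝ)/5) < 8
  · refine ⟨1, le_rfl, ?_, ?_, ?_⟩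
    · simpa using one_le_pow₀ hv
    · push_cast; linarith
    · push_cast; linarith
  · push Not at h
    have f1 := Nat.floor_le (show 0 ≤ H^((4:ℝ)/5)/4 by linarith)
    have f2 := Nat.lt_floor_add_one (H^((4:ℝ)/5)/4)
    refine ⟨⌊H^((4:ℝ)/5)/4⌋₊, ?_, ?_, ?_, ?_⟩
    · apply Nat.le_floor; push_cast; linarith
    · linarith
    · linarith
    · linarith

lemma N_bound (a k : ℕ) (v : ℝ) (ha : 0 < a) (hk : 1 ≤ k) (hkv : (k:ℝ) ≤ v^8) (hv1 : 1 ≤ v)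
    (hv : |Real.log (1024*a)| + 5 ≤ v) :
    ((k*(4*primorial (2*k+4)*a):ℕ):ℝ) ≤ Real.exp (v^9) := by
  have har : (1:ℝ) ≤ a := by exact_mod_cast ha
  have h1 : k*(4*primorial (2*k+4)*a) ≤ 1024*a*64^k := by
    calc k*(4*primorial (2*k+4)*a) ≤ 4^k*(4*4^(2*k+4)*a) := by
          gcongr
          · exact (Nat.lt_pow_self (by norm_num)).le
          · exact primorial_le_four_pow _
      _ = 1024*a*64^k := by
          rw [show (64:ℕ) = 4^3 by norm_num, ← pow_mul, pow_add, pow_mul, pow_mul]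
          rw [show (4:ℕ)^4 = 256 by norm_num]
          have : (4:ℕ)^k*((4^2)^k) = (4^3)^k := by rw [← mul_pow]; norm_num
          calc 4^k*(4*((4^2)^k*256)*a) = 1024*a*(4^k*((4^2)^k)) := by ring
            _ = _ := by rw [this]
  have h2 : ((k*(4*primorial (2*k+4)*a):ℕ):ℝ) ≤ 1024*a*64^k := by exact_mod_cast h1
  refine h2.trans ?_
  rw [← Real.exp_log (show (0:ℝ) < 1024*a*64^k by positivity)]
  apply Real.exp_le_exp.2
  rw [Real.log_mul (by positivity) (by positivity), Real.log_pow]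
  have h64 : Real.log 64 ≤ 5 := by
    rw [show (64:ℝ) = 2^6 by norm_num, Real.log_pow]
    have := Real.log_two_lt_d9; push_cast; linarith
  have hk0 : (0:ℝ) ≤ k := by positivity
  have hv8 : 1 ≤ v^8 := one_le_pow₀ hv1
  have e1 := le_abs_self (Real.log (1024*a))
  have e0 := abs_nonneg (Real.log (1024*a))
  calc Real.log (1024*a) + k*Real.log 64 ≤ |Real.log (1024*a)| * v^8 + v^8*5 := by
        apply add_le_add
        · exact e1.trans (le_mul_of_one_le_right e0 hv8)
        · gcongr
    _ = (|Real.log (1024*a)| + 5)*v^8 := by ring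
    _ ≤ v*v^8 := by gcongr
    _ = _ := by ring


set_option maxHeartbeats 2000000 in
lemma main_v : ∃ c : ℝ, 0 < c ∧ ∀ a : ℕ, IsSumTwoSquares a → ∃ V : ℝ, ∀ v : ℝ, V ≤ v →
    ∀ Q x : ℝ, x = Real.exp (v^18) → x ≤ Q * v^10 → Q ≤ x/2 →
    Q / Real.exp (v^9)^4 ≤ (({q : ℕ | Q ≤ (q : ℝ) ∧ (q : ℝ) ≤ 2 * Q ∧
              c * frakS * x / (phiS q * (x / (q : ℝ)) ^ ((9 : ℝ) / 10)) ≤ (SAP x q a : ℝ)}).ncard : ℝ) := by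
  classical
  obtain ⟨c1, hc1p, hc1⟩ := chi_prod_lower
  obtain ⟨C1, hC1p, hC1⟩ := phi_lower
  obtain ⟨C2, hC2p, hC2⟩ := lam_sum
  obtain ⟨C3, hC3p, hC3⟩ := V1_lower
  obtain ⟨K2, hK2p, hK2⟩ := lam_pick C2 hC2p
  obtain ⟨κ, hκ⟩ : ∃ κ : ℝ, κ = 0.05*c1/(1600*2.08) := ⟨_, rfl⟩
  have hκp : 0 < κ := by rw [hκ]; positivity
  obtain ⟨P, hP⟩ : ∃ P : ℝ, P = 2^200 := ⟨_, rfl⟩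
  have hPp : 0 < P := by rw [hP]; positivity
  refine ⟨κ/(K2*P)/(1152*C1*(|frakS|+1)), by positivity, ?_⟩
  intro a ha
  have ha0 : 0 < a := ha.1
  have har : (1:ℝ) ≤ a := by exact_mod_cast ha0
  set K4 : ℝ := 1600*8*2*20*P*K2/c1 with hK4
  have hK4p : 0 < K4 := by positivity
  set K : ℝ := 10000000 + (|Real.log (1024*a)| + 5) + 4*C3 + 48000/c1 + K4 + 4*a with hK
  have hKc : 0 < 48000/c1 := by positivity
  have habs := abs_nonneg (Real.log (1024*a))
  obtain ⟨V, hV⟩ := large_v K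
  refine ⟨V, ?_⟩
  intro v hvV Q x hx hxQ hQx
  obtain ⟨hvK, hvlog⟩ := hV v hvV
  have hv1 : 10000000 ≤ v := by linarith only [hvK, hK, hKc, habs, hK4p, hC3p, har]
  have hv1' : 1 ≤ v := by linarith only [hv1]
  have hvp : 0 < v := by linarith only [hv1]
  have hlogv : 0 ≤ Real.log v := Real.log_nonneg hv1'
  have hxp : 0 < x := by rw [hx]; exact Real.exp_pos _
  have hQp : 0 < Q := by
    by_contra h
    push Not at h
    have := mul_nonpos_of_nonpos_of_nonneg h (pow_nonneg hvp.le 10)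
    linarith only [this, hxQ, hxp]
  obtain ⟨M, hM⟩ : ∃ M, M = Real.exp (v^9) := ⟨_, rfl⟩
  obtain ⟨X, hX⟩ : ∃ X, X = Real.exp (v^18/100) := ⟨_, rfl⟩
  have hv9 : v ≤ v^9 := le_self_pow₀ hv1' (by norm_num)
  have hMv : v^9 + v^18/2 ≤ M := by
    have := Real.quadratic_le_exp_of_nonneg (show 0 ≤ v^9 by positivity)
    rw [← hM] at this
    have e : (v^9)^2 = v^18 := by ring
    rw [e] at this
    linarith only [this]
  have hv18p : 0 < v^18 := by positivity
  have hMv1 : v ≤ M := by linarith only [hMv, hv9, hv18p]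
  have hMp : 0 < M := by linarith only [hMv1, hvp]
  have hM1 : 1 ≤ M := by linarith only [hMv1, hv1']
  have hM10 : v^10 ≤ M := by
    have : v^10*2 ≤ v^18 := by
      calc v^10*2 ≤ v^10*v^8 := by
            gcongr
            calc 2 ≤ v := by linarith only [hv1]
              _ ≤ v^8 := le_self_pow₀ hv1' (by norm_num)
        _ = v^18 := by ring
    have := pow_pos hvp 9
    linarith
  have hX100 : X^100 = x := by
    rw [hX, hx, ← Real.exp_nat_mul]; congr 1; push_cast; ring
  have hMX : M^4 ≤ X := by
    rw [hM, hX, ← Real.exp_nat_mul]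
    apply Real.exp_le_exp.2
    have : 400*v^9 ≤ v^9*v^9 := by
      gcongr
      linarith only [hv9, hv1]
    have e : v^9*v^9 = v^18 := by ring
    push_cast
    linarith only [this, e]
  have hM4 : M ≤ M^4 := le_self_pow₀ hM1 (by norm_num)
  have hX1 : 10000000 ≤ X := by linarith only [hMX, hM4, hMv1, hv1]
  have hXp : 0 < X := by linarith only [hX1]
  have hXx : X ≤ x := by rw [← hX100]; exact le_self_pow₀ (by linarith only [hX1]) (by norm_num)
  have hQM : x ≤ Q*M := hxQ.trans (by gcongr)
  have hQX : X^99 ≤ Q := by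
    have : X^99*M ≤ Q*M := by
      refine le_trans ?_ hQM
      rw [← hX100]
      calc X^99*M ≤ X^99*X := by gcongr; linarith only [hMX, hM4]
        _ = _ := by ring
    exact le_of_mul_le_mul_right this hMp
  have h64M : 64*M ≤ M^4 := by
    have : M^2 ≤ M^4 := pow_le_pow_right₀ hM1 (by norm_num)
    have : 64*M ≤ M*M := by gcongr; linarith only [hMv1, hv1]
    linarith [sq M]
  -- choice of k
  have hH2 : 2 ≤ x/Q := by rw [le_div_iff₀ hQp]; linarith only [hQx]
  have hHv : x/Q ≤ v^10 := by rw [div_le_iff₀ hQp]; linarith only [hxQ]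
  obtain ⟨k, hk, hkv, hkH, hkH2⟩ := k_choice v (x/Q) hv1' hH2 hHv
  have hkr : (1:ℝ) ≤ k := by exact_mod_cast hk
  have hkQ : k*Q ≤ x/2 := by
    calc k*Q ≤ x/Q/2*Q := by gcongr
      _ = x/2 := by field_simp
  obtain ⟨W, hWd⟩ : ∃ W, W = primorial (2*k+4) := ⟨_, rfl⟩
  have hW0 : 0 < W := by rw [hWd]; exact primorial_pos _
  have hW : ∀ p : ℕ, p.Prime → (p ∣ W ↔ p ≤ 2*k+4) := by
    intro p hp; rw [hWd]; exact hp.dvd_primorial_iff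
  have hW' : ∀ p : ℕ, p.Prime → p ≤ 2*k+4 → p ∣ W := fun p hp h => (hW p hp).2 h
  obtain ⟨a1, a2, haa, hs1, ha4, hcop, hd1⟩ := split_a a W ha (hW' 2 Nat.prime_two (by omega))
  have ha10 : 0 < a1 := hs1.1
  have ha20 : 0 < a2 := by omega
  have hNa : ((k*(4*W*a):ℕ):ℝ) ≤ M := by
    rw [hWd, hM]
    exact N_bound a k v ha0 hk hkv hv1' (by linarith only [hvK, hK, hKc, habs, hK4p, hC3p, har])
  have hN : ((k*(4*W*a2):ℕ):ℝ) ≤ M := by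
    refine le_trans ?_ hNa
    have : a2 ≤ a := by rw [haa]; exact Nat.le_mul_of_pos_left _ ha10
    exact_mod_cast Nat.mul_le_mul_left _ (Nat.mul_le_mul_left _ this)
  obtain ⟨z, hz2, hzD, hzM, hzlog, hzX⟩ := z_choice v k (by linarith only [hv1]) hk hkv
  rw [← hX] at hzD hzX
  rw [← hM] at hzM
  have hax : 4*(a:ℝ) ≤ x := by
    have : 4*(a:ℝ) ≤ v := by linarith only [hvK, hK, hKc, habs, hK4p, hC3p, har]
    linarith only [this, hMv1, hM4, hMX, hXx]
  obtain ⟨t1, T, ht17, hTQ, hnx, hqQ⟩ := geo a a1 a2 W k Q x M haa ha0 hW0 hk hNa (by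
    have : X ≤ X^99 := le_self_pow₀ (by linarith only [hX1]) (by norm_num)
    linarith only [h64M, hMX, this, hQX]) hkQ hax
  -- y
  have hy1 := Nat.floor_le hXp.le
  have hy2 := Nat.lt_floor_add_one X
  obtain ⟨y, hy⟩ : ∃ y, y = ⌊X⌋₊ := ⟨_, rfl⟩
  rw [← hy] at hy1 hy2
  have hzy : z ≤ y := by rw [hy]; exact Nat.le_floor hzX
  have hzr : (2:ℝ) ≤ z := by exact_mod_cast hz2
  have hyr : (2:ℝ) ≤ y := by exact_mod_cast hz2.trans hzy
  have hlogz : 0 < Real.log z := Real.log_pos (by linarith only [hzr])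
  have hlogy : 0 < Real.log y := Real.log_pos (by linarith only [hyr])
  have hlogX : Real.log X = v^18/100 := by rw [hX, Real.log_exp]
  obtain ⟨lam, hlam1, hlam2⟩ := hK2 k hk
  have hlam : 1.1*(∑ p ∈ (Ioc z y).filter (fun p => p.Prime ∧ p % 4 = 1), (2:ℝ)/p) ≤ lam+1 := by
    refine le_trans ?_ hlam1
    have e1 := hC2 z y hz2 hzy
    have e2 : Real.log (Real.log y) ≤ Real.log (21612*k) + Real.log (Real.log z) := by
      rw [← Real.log_mul (by positivity) hlogz.ne']
      apply Real.log_le_log hlogy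
      calc Real.log y ≤ Real.log X := Real.log_le_log (by linarith only [hyr]) hy1
        _ = 21612*k*(v^18/(2161200*k)) := by rw [hlogX]; field_simp; norm_num
        _ ≤ _ := by gcongr
    linarith only [e1, e2]
  obtain ⟨V1, hV1⟩ : ∃ V1 : ℝ, V1 = ∏ p ∈ PS (4*W*a2) z, (1 - ((k:ℝ)+1)/p) := ⟨_, rfl⟩
  have hVM : 1/M ≤ V1 := by
    have e0 := hC3 a2 W k z hW' hz2
    rw [← hV1] at e0
    refine le_trans ?_ e0
    rw [one_div, hM, ← Real.exp_neg]
    apply Real.exp_le_exp.2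
    apply neg_le_neg
    have e1 : Real.log (Real.log z) ≤ 18*Real.log v := by
      have : (18:ℝ)*Real.log v = Real.log (v^18) := by rw [Real.log_pow]; norm_num
      rw [this]
      apply Real.log_le_log hlogz
      calc Real.log z ≤ Real.log X := Real.log_le_log (by linarith only [hzr]) hzX
        _ ≤ _ := by rw [hlogX]; linarith only [hv18p]
    calc 2*((k:ℝ)+1)*(Real.log (Real.log z) + C3) ≤ 2*((k:ℝ)+1)*(18*Real.log v + C3) := by gcongr
      _ ≤ 4*v^8*(18*Real.log v + C3) := by
          apply mul_le_mul_of_nonneg_right _ (by positivity)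
          linarith only [hkv, hkr]
      _ = v^8*(72*Real.log v + 4*C3) := by ring
      _ ≤ v^8*v := by
          gcongr
          linarith only [hvlog, hlogv, hvK, hK, hKc, habs, hK4p, hC3p, har]
      _ = v^9 := by ring
  have hVp : 0 < V1 := lt_of_lt_of_le (by positivity) hVM
  have hT20 : X^20 ≤ T := by
    refine le_trans ?_ hTQ
    rw [le_div_iff₀ (by positivity)]
    calc X^20*(8*M) ≤ X^20*X := by
          gcongr
          linarith only [h64M, hMX, hMp]
      _ = X^21 := by ring
      _ ≤ X^99 := pow_le_pow_right₀ (by linarith only [hX1]) (by norm_num)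
      _ ≤ Q := hQX
  have hLE : Lf a2 W k (t1+T) ≤ y^200 := by
    have e1 := hnx (t1+T) le_rfl
    have e2 : Lf a2 W k (t1+T) ≤ a+k*(4*a1*W*(1+a2*(t1+T))) := by
      calc Lf a2 W k (t1+T) = 1*Lf a2 W k (t1+T) := by ring
        _ ≤ a1*Lf a2 W k (t1+T) := Nat.mul_le_mul_right _ ha10
        _ = _ := by rw [haa]; unfold Lf; ring
    have e3 : (Lf a2 W k (t1+T) : ℝ) ≤ x := le_trans (by exact_mod_cast e2) e1
    have e4 : X ≤ (y:ℝ)^2 := by nlinarith only [hy2, hX1]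
    have e5 : x ≤ (y:ℝ)^200 := by
      rw [← hX100]
      calc X^100 ≤ ((y:ℝ)^2)^100 := by gcongr
        _ = _ := by rw [← pow_mul]
    exact_mod_cast e3.trans e5
  have hcomb := comb1 a2 W k z y 200 lam t1 T c1 M X V1 ha4 hW0 hcop hW' hk hz2 hzy hc1p (hc1 z) hlam hV1
    (by linarith only [hMv1, hvK, hK, hKc, habs, hK4p, hC3p, har]) (by linarith only [hMv1, hv1]) hMX hN hVM hy1 hzD hzM hT20 ht17 hLE
  rw [← hκ] at hcomb
  have h2lam : (2:ℝ)^(lam+200) ≤ K2*(k:ℝ)^((5:ℝ)/6)*P := by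
    rw [pow_add, ← hP]; gcongr
  have h2pos : (0:ℝ) < 2^(lam+200) := by positivity
  have hkpos : (0:ℝ) < k := by linarith only [hkr]
  -- lower count
  have hcount : Q/M^4 ≤ 0.05*(c1*(T/1600)*V1)/2^(lam+200)/2 := by
    have hkM : (k:ℝ) ≤ M := by
      refine le_trans ?_ hNa
      have : 0 < 4*W*a := by positivity
      exact_mod_cast Nat.le_mul_of_pos_right _ this
    have f1 : (k:ℝ)^((5:ℝ)/6) ≤ M := by
      refine le_trans ?_ hkM
      calc (k:ℝ)^((5:ℝ)/6) ≤ (k:ℝ)^(1:ℝ) := Real.rpow_le_rpow_of_exponent_le hkr (by norm_num)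
        _ = k := Real.rpow_one _
    have f2 : (2:ℝ)^(lam+200) ≤ K2*M*P := h2lam.trans (by gcongr)
    have f3 : K4 ≤ M := by linarith only [hMv1, hvK, hK, hKc, habs, hK4p, hC3p, har]
    have f4 : 0.05*(c1*(Q/(8*M)/1600)*(1/M))/(K2*M*P)/2 ≤ 0.05*(c1*(T/1600)*V1)/2^(lam+200)/2 := by
      gcongr
    refine le_trans ?_ f4
    have f5 : 0.05*(c1*(Q/(8*M)/1600)*(1/M))/(K2*M*P)/2 = Q/(M^3*K4) := by
      rw [hK4]; field_simp; norm_num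
    rw [f5]
    have : M^4 = M^3*M := by ring
    rw [this]
    gcongr
  rw [hM] at hcount
  refine hcount.trans (hcomb.trans ?_)
  -- inclusion
  have hinj : ∀ t t' : ℕ, 4*a1*W*(1+a2*t) = 4*a1*W*(1+a2*t') → t = t' := by
    intro t t' h
    have h1 := Nat.eq_of_mul_eq_mul_left (by positivity : 0 < 4*a1*W) h
    have h2 : a2*t = a2*t' := by omega
    exact Nat.eq_of_mul_eq_mul_left ha20 h2
  set F := (Ico t1 (t1+T)).filter (fun t => Sf a2 W k z t ∧
      k*κ/2^(lam+200) ≤ (((Icc 1 k).filter (fun j => IsSumTwoSquares (Lf a2 W j t))).card : ℝ)) with hF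
  have hcard : F.card = (F.image (fun t => 4*a1*W*(1+a2*t))).card := by
    rw [card_image_of_injective _ (fun t t' h => hinj t t' h)]
  rw [hcard, ← Set.ncard_coe_finset]
  have hfin : ({q : ℕ | Q ≤ (q : ℝ) ∧ (q : ℝ) ≤ 2 * Q ∧
              κ/(K2*P)/(1152*C1*(|frakS|+1)) * frakS * x / (phiS q * (x / (q : ℝ)) ^ ((9 : ℝ) / 10)) ≤ (SAP x q a : ℝ)}).Finite := by
    apply Set.Finite.subset (Set.finite_Iic ⌊2*Q⌋₊)
    intro q hq
    exact Nat.le_floor hq.2.1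
  refine Nat.cast_le.2 (Set.ncard_le_ncard ?_ hfin)
  intro q hq
  obtain ⟨t, ht, rfl⟩ := mem_image.1 (mem_coe.1 hq)
  obtain ⟨htI, htS, htc⟩ := mem_filter.1 ht
  obtain ⟨ht1, ht2⟩ := mem_Ico.1 htI
  obtain ⟨hq1, hq2⟩ := hqQ t ht1 ht2.le
  refine ⟨hq1, by linarith only [hq2, hQp], ?_⟩
  have hSAP := SAP_lower a a1 a2 W k t x haa hs1 hW0 (le_trans (by gcongr) (hnx t ht2.le))
  refine le_trans ?_ (htc.trans (by exact_mod_cast hSAP))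
  obtain ⟨q, hqd⟩ : ∃ q, q = 4*a1*W*(1+a2*t) := ⟨_, rfl⟩
  rw [← hqd] at hq1 hq2 ⊢
  have hq0 : 0 < q := by rw [hqd]; positivity
  have hqr : (0:ℝ) < q := by exact_mod_cast hq0
  have hqx : (q:ℝ) ≤ x := by linarith only [hq2, hQx, hxp]
  have hphi := hC1 q (2*k+4) z hq0 (by rw [hqd]; exact ⟨a1*W*(1+a2*t), by ring⟩) (by omega) (by omega) (by
      calc Real.log q ≤ Real.log x := Real.log_le_log hqr hqx
        _ = v^18 := by rw [hx, Real.log_exp]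
        _ ≤ 2*M := by have := pow_pos hvp 9; linarith only [this, hMv]
        _ ≤ M^2*M := by
            gcongr
            nlinarith only [hMv1, hv1]
        _ = M^3 := by ring
        _ ≤ z := hzM) (by rw [hqd]; exact q_primes a1 a2 W k z t hW hd1 htS)
  have hlogk : 0 ≤ Real.log ((2*k+4:ℕ):ℝ) := Real.log_natCast_nonneg _
  have htb := target_bound x q Q C1 (Real.log ((2*k+4:ℕ):ℝ)) (1152 * (k:ℝ)^((1:ℝ)/6)) (phiS q) hxp hQp hq1 (phiS_pos q) hC1p
    hlogk hphi (log_pow_bound k (x/Q) hk (by linarith only [hH2]) hkH)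
  have hk16 : (0:ℝ) < (k:ℝ)^((1:ℝ)/6) := by positivity
  have g1 : κ/(K2*P)*(k:ℝ)^((1:ℝ)/6) ≤ k*κ/2^(lam+200) := by
    have e : (k:ℝ)^((1:ℝ)/6)*(k:ℝ)^((5:ℝ)/6) = k := by
      rw [← Real.rpow_add hkpos]; norm_num
    rw [le_div_iff₀ h2pos]
    calc κ/(K2*P)*(k:ℝ)^((1:ℝ)/6)*2^(lam+200) ≤ κ/(K2*P)*(k:ℝ)^((1:ℝ)/6)*(K2*(k:ℝ)^((5:ℝ)/6)*P) := by gcongr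
      _ = κ*((k:ℝ)^((1:ℝ)/6)*(k:ℝ)^((5:ℝ)/6)) := by field_simp
      _ = k*κ := by rw [e]; ring
  refine le_trans ?_ g1
  have hph := phiS_pos q
  have hR0 : 0 ≤ x/(phiS q*(x/(q:ℝ))^((9:ℝ)/10)) := by positivity
  have hf := abs_nonneg frakS
  calc κ/(K2*P)/(1152*C1*(|frakS|+1)) * frakS * x / (phiS q * (x / (q : ℝ)) ^ ((9 : ℝ) / 10))
      = κ/(K2*P)/(1152*C1*(|frakS|+1)) * frakS * (x / (phiS q * (x / (q : ℝ)) ^ ((9 : ℝ) / 10))) := by ring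
    _ ≤ κ/(K2*P)/(1152*C1*(|frakS|+1)) * (|frakS|+1) * (C1*(1152 * (k:ℝ)^((1:ℝ)/6))) := by
        gcongr
        have := le_abs_self frakS
        linarith only [this]
    _ = _ := by field_simp


lemma Q_pow_bound (v x Q : ℝ) (hv : 100 ≤ v) (hlog : 144*Real.log v ≤ v) (hx : x = Real.exp (v^18))
    (hxQ : x ≤ Q*v^10) (hQx : Q ≤ x/2) :
    Q^(1 - 1/Real.log (Real.log Q)) ≤ Q/Real.exp (v^9)^4 := by
  have hvp : 0 < v := by linarith
  have hxp : 0 < x := by rw [hx]; exact Real.exp_pos _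
  have hQp : 0 < Q := by
    by_contra h
    push Not at h
    have := mul_nonpos_of_nonpos_of_nonneg h (pow_nonneg hvp.le 10)
    linarith only [this, hxQ, hxp]
  have h9 : 100 ≤ v^9 := hv.trans (le_self_pow₀ (by linarith) (by norm_num))
  have h99 : v^9*v^9 = v^18 := by ring
  have h18 : 100*v ≤ v^18 := by
    have : v ≤ v^9 := le_self_pow₀ (by linarith) (by norm_num)
    nlinarith
  have hL1 : v^18 ≤ Real.log Q + 10*Real.log v := by
    have := Real.log_le_log hxp hxQ
    rw [Real.log_mul hQp.ne' (by positivity), Real.log_pow, hx, Real.log_exp] at this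
    push_cast at this; exact this
  have hL2 : Real.log Q ≤ v^18 := by
    have := Real.log_le_log hQp (hQx.trans (by linarith : x/2 ≤ x))
    rwa [hx, Real.log_exp] at this
  have hL3 : v^18/2 ≤ Real.log Q := by linarith
  have hL4 : 1 < Real.log Q := by linarith
  have hLL : 0 < Real.log (Real.log Q) := Real.log_pos hL4
  have hLL2 : Real.log (Real.log Q) ≤ 18*Real.log v := by
    have := Real.log_le_log (by linarith) hL2
    rw [Real.log_pow] at this
    push_cast at this; exact this
  have key : 4*v^9 ≤ Real.log Q/Real.log (Real.log Q) := by
    rw [le_div_iff₀ hLL]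
    calc 4*v^9*Real.log (Real.log Q) ≤ 4*v^9*(18*Real.log v) := by gcongr
      _ = v^9*(144*Real.log v)/2 := by ring
      _ ≤ v^9*v^9/2 := by
          gcongr
          exact hlog.trans (le_self_pow₀ (by linarith) (by norm_num))
      _ = v^18/2 := by rw [h99]
      _ ≤ _ := hL3
  rw [Real.rpow_def_of_pos hQp, ← Real.exp_nat_mul]
  conv_rhs => rw [← Real.exp_log hQp]
  rw [← Real.exp_sub]
  apply Real.exp_le_exp.2
  have : Real.log Q*(1 - 1/Real.log (Real.log Q)) = Real.log Q - Real.log Q/Real.log (Real.log Q) := by ring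
  rw [this]
  push_cast
  linarith

theorem main_thm :
    ∃ c : ℝ, 0 < c ∧ ∃ c0 : ℝ, 0 < c0 ∧ ∀ a : ℕ, IsSumTwoSquares a →
      ∃ x0 : ℝ, ∀ x : ℝ, x0 ≤ x →
        ∀ Q : ℝ, c0 ≤ Q → x * Real.log x ^ (-(5 : ℝ) / 9) ≤ Q → Q ≤ x / 2 →
          Q ^ (1 - 1 / Real.log (Real.log Q)) ≤
            (({q : ℕ | Q ≤ (q : ℝ) ∧ (q : ℝ) ≤ 2 * Q ∧
              c * frakS * x / (phiS q * (x / (q : ℝ)) ^ ((9 : ℝ) / 10)) ≤ (SAP x q a : ℝ)}).ncard : ℝ) := by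
  obtain ⟨c, hc, h⟩ := main_v
  refine ⟨c, hc, 1, one_pos, ?_⟩
  intro a ha
  obtain ⟨V, hV⟩ := h a ha
  obtain ⟨V', hV'⟩ := large_v 100
  set V0 := max V (max V' 1) with hV0
  have hV01 : 1 ≤ V0 := (le_max_right _ _).trans (le_max_right _ _)
  refine ⟨Real.exp (V0^18), ?_⟩
  intro x hx Q _ hQ1 hQ2
  have hxp : 0 < x := lt_of_lt_of_le (Real.exp_pos _) hx
  have hlx : V0^18 ≤ Real.log x := by rwa [Real.le_log_iff_exp_le hxp]
  have hlx1 : 1 ≤ Real.log x := (one_le_pow₀ hV01).trans hlx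
  set v := Real.log x ^ ((1:ℝ)/18) with hv
  have hv18 : v^18 = Real.log x := by
    rw [hv, ← Real.rpow_natCast, ← Real.rpow_mul (by linarith)]; norm_num
  have hvp : 0 < v := by positivity
  have hvV : V0 ≤ v := by
    refine le_of_pow_le_pow_left₀ (n := 18) (by norm_num) hvp.le ?_
    rw [hv18]; exact hlx
  have hxv : x = Real.exp (v^18) := by rw [hv18, Real.exp_log hxp]
  have h59 : Real.log x ^ (-(5:ℝ)/9) = (v^10)⁻¹ := by
    rw [hv, ← Real.rpow_natCast, ← Real.rpow_mul (by linarith), ← Real.rpow_neg (by linarith)]; norm_num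
  have hxQ : x ≤ Q*v^10 := by
    rw [h59, ← div_eq_mul_inv, div_le_iff₀ (by positivity)] at hQ1
    exact hQ1
  obtain ⟨g1, g2⟩ := hV' v (((le_max_left _ _).trans (le_max_right _ _)).trans hvV)
  exact (Q_pow_bound v x Q g1 (by linarith) hxv hxQ hQ2).trans
    (hV v ((le_max_left _ _).trans hvV) Q x hxv hxQ hQ2)


end Helpers

theorem sums_of_two_squares_in_progressions_varying_modulus :
    ∃ c : ℝ, 0 < c ∧ ∃ c0 : ℝ, 0 < c0 ∧ ∀ a : ℕ, IsSumTwoSquares a →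
      ∃ x0 : ℝ, ∀ x : ℝ, x0 ≤ x →
        ∀ Q : ℝ, c0 ≤ Q → x * Real.log x ^ (-(5 : ℝ) / 9) ≤ Q → Q ≤ x / 2 →
          Q ^ (1 - 1 / Real.log (Real.log Q)) ≤
            (({q : ℕ | Q ≤ (q : ℝ) ∧ (q : ℝ) ≤ 2 * Q ∧
              c * frakS * x / (phiS q * (x / (q : ℝ)) ^ ((9 : ℝ) / 10)) ≤ (SAP x q a : ℝ)}).ncard : ℝ) := by
  exact main_thm
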